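/- Let q be a prime power and d ≥ 2 an integer with gcd(q, d!) = 1. For each integer j ≥ 1, let R(q,d,j) be the average, over all rational functions φ ∈ F_{q^j}(X) of degree exactly d, of |Per(P^1(F_{q^j}), φ)| / (q^j + 1), where Per(P^1(F_{q^j}), φ) is the set of periodic points of the self-map of P^1(F_{q^j}) induced by φ. Then lim_{j→∞} R(q,d,j) = 0; that is, for every ε > 0 there exists J such that R(q,d,j) < ε for all j ≥ J. -/

import Mathlib

/-- The degree of a rational function: `max (deg f) (deg g)` where `φ = f / g` in
lowest terms. -/
noncomputable def ratDegree {K : Type*} [Field K] (φ : RatFunc K) : ℕ :=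
  max φ.num.natDegree φ.denom.natDegree

open scoped Classical in
/-- The self-map of `P^1(F) = F ∪ {∞}` (encoded as `Option F`, with `none = ∞`)
induced by the rational function `f / g`, via the degree-`d` homogenizations of
`f` and `g` : `[x : y] ↦ [F_d(x, y) : G_d(x, y)]`. -/
noncomputable def projMap {F : Type*} [Field F] (f g : Polynomial F) (d : ℕ) :
    Option F → Option F
  | some x =>
      if Polynomial.eval x g = 0 then none
      else some (Polynomial.eval x f / Polynomial.eval x g)
  | none =>
      if g.coeff d = 0 then none else some (f.coeff d / g.coeff d)


open Polynomial
set_option linter.all false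

set_option linter.style.haveILetI false

namespace APP

section Stepanov
lemma coe_taylor_ev {k A : Type*} [Field k] [CommRing A] [Algebra k A]
    (ev : A →ₐ[k] PowerSeries k) (t : A) (τ : k)
    (hev : ev t = PowerSeries.C τ + PowerSeries.X) (r : k[X]) :
    ev (aeval t r) = ((taylor τ r : k[X]) : PowerSeries k) := by
  have h1 : ev (aeval t r) = aeval (PowerSeries.C τ + PowerSeries.X : PowerSeries k) r := by
    rw [← hev, aeval_algHom_apply]
  rw [h1]
  have h2 : (PowerSeries.C τ + PowerSeries.X : PowerSeries k)
      = Polynomial.coeToPowerSeries.algHom k (X + C τ) := by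
    simp [Polynomial.coeToPowerSeries.algHom_apply, add_comm]
  rw [h2, aeval_algHom_apply]
  rw [taylor_apply, Polynomial.comp_eq_aeval]
  simp [Polynomial.coeToPowerSeries.algHom_apply]

lemma rootMult_of_X_pow_dvd {k : Type*} [Field k] (r : k[X]) (hr : r ≠ 0) (τ : k) (n : ℕ)
    (h : (PowerSeries.X : PowerSeries k) ^ n ∣ ((taylor τ r : k[X]) : PowerSeries k)) :
    n ≤ r.rootMultiplicity τ := by
  have h1 : (X : k[X]) ^ n ∣ taylor τ r := by
    rw [Polynomial.X_pow_dvd_iff]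
    intro m hm
    rw [PowerSeries.X_pow_dvd_iff] at h
    simpa using h m hm
  rw [le_rootMultiplicity_iff hr]
  obtain ⟨s, hs⟩ := h1
  refine ⟨taylor (-τ) s, ?_⟩
  have := congrArg (taylor (-τ)) hs
  rw [taylor_taylor] at this
  simpa [sub_eq_add_neg] using this

variable {k A : Type*} [Field k] [CommRing A] [IsDomain A] [Algebra k A]

lemma stepB1 {ι : Type*} [Fintype ι] (W : Submodule k A) (t : A) (σ : ι → (A →ₐ[k] A)) (i₀ : ι)
    (hi₀ : σ i₀ = AlgHom.id k A)
    (hnorm : ∀ m : ℕ, ∀ a ∈ W ^ m, a ≠ 0 → ∃ r : k[X], r ≠ 0 ∧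
      r.natDegree ≤ Fintype.card ι * m ∧ aeval t r = ∏ i, σ i a)
    (ev : A →ₐ[k] PowerSeries k) (τ : k)
    (hev : ev t = PowerSeries.C τ + PowerSeries.X) (m : ℕ) (a : A) (ha : a ∈ W ^ m)
    (n : ℕ) (hn : Fintype.card ι * m < n) (hdvd : PowerSeries.X ^ n ∣ ev a) : a = 0 := by
  by_contra h0
  obtain ⟨r, hr0, hrd, hr⟩ := hnorm m a ha h0
  have h1 : a ∣ aeval t r := by
    rw [hr]
    have := Finset.dvd_prod_of_mem (fun i => σ i a) (Finset.mem_univ i₀)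
    simpa [hi₀] using this
  have h2 := hdvd.trans (map_dvd ev h1)
  rw [coe_taylor_ev ev t τ hev] at h2
  have h3 := rootMult_of_X_pow_dvd r hr0 τ n h2
  have h4 : r.rootMultiplicity τ ≤ r.natDegree := by
    classical
    rw [← count_roots]
    exact (Multiset.count_le_card _ _).trans (card_roots' r)
  omega

lemma stepB2 {ι : Type*} [Fintype ι] (W : Submodule k A) (t : A) (σ : ι → (A →ₐ[k] A)) (i₀ : ι)
    (hi₀ : σ i₀ = AlgHom.id k A)
    (hnorm : ∀ m : ℕ, ∀ a ∈ W ^ m, a ≠ 0 → ∃ r : k[X], r ≠ 0 ∧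
      r.natDegree ≤ Fintype.card ι * m ∧ aeval t r = ∏ i, σ i a)
    (p : ℕ) [Fact p.Prime] [CharP k p]
    (ev : A →ₐ[k] PowerSeries k) (hinj : Function.Injective ev) (τ : k)
    (hev : ev t = PowerSeries.C τ + PowerSeries.X) (m e : ℕ)
    (hm : Fintype.card ι * m < p ^ e)
    {J : Type*} [Fintype J] (u : J → A) (hu : ∀ j, u j ∈ W ^ m) (hind : LinearIndependent k u)
    (B : J → A) (hB : ∑ j, u j * B j ^ (p ^ e) = 0) : ∀ j, B j = 0 := by
  classical
  by_contra hcon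
  push Not at hcon
  obtain ⟨j1, hj1⟩ := hcon
  -- minimal order
  have hex : ∃ n, ∃ j, PowerSeries.coeff n (ev (B j)) ≠ 0 := by
    by_contra h
    push Not at h
    apply hj1
    apply hinj
    rw [map_zero]
    ext n
    simpa using h n j1
  set n := Nat.find hex with hn
  obtain ⟨j0, hj0⟩ := Nat.find_spec hex
  have hmin : ∀ j, PowerSeries.X ^ n ∣ ev (B j) := by
    intro j
    rw [PowerSeries.X_pow_dvd_iff]
    intro l hl
    have := Nat.find_min hex hl
    push Not at this
    exact this j
  choose γ hγ using hmin
  haveI : CharP (PowerSeries k) p := charP_of_injective_algebraMap (algebraMap k (PowerSeries k)).injective p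
  haveI : ExpChar (PowerSeries k) p := ExpChar.prime Fact.out
  have hsum : ∑ j, ev (u j) * γ j ^ (p ^ e) = 0 := by
    have h1 := congrArg ev hB
    simp only [map_sum, map_mul, map_pow, map_zero] at h1
    have h2 : (PowerSeries.X ^ n : PowerSeries k) ^ (p ^ e) * ∑ j, ev (u j) * γ j ^ (p ^ e) = 0 := by
      rw [← h1, Finset.mul_sum]
      refine Finset.sum_congr rfl fun j _ => ?_
      rw [hγ j]; ring
    rcases mul_eq_zero.mp h2 with h3 | h3
    · exact absurd h3 (by simp [PowerSeries.X_ne_zero])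
    · exact h3
  have hcong : ∀ j, (PowerSeries.X : PowerSeries k) ^ (p ^ e) ∣
      γ j ^ (p ^ e) - PowerSeries.C (PowerSeries.constantCoeff (γ j) ^ (p ^ e)) := by
    intro j
    rw [map_pow, ← sub_pow_expChar_pow]
    apply pow_dvd_pow_of_dvd
    rw [PowerSeries.X_dvd_iff]
    simp
  have hdvd : (PowerSeries.X : PowerSeries k) ^ (p ^ e) ∣
      ev (∑ j, (PowerSeries.constantCoeff (γ j) ^ (p ^ e)) • u j) := by
    have h1 : ev (∑ j, (PowerSeries.constantCoeff (γ j) ^ (p ^ e)) • u j) =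
      - ∑ j, ev (u j) * (γ j ^ (p ^ e) - PowerSeries.C (PowerSeries.constantCoeff (γ j) ^ (p ^ e))) := by
      simp only [mul_sub, Finset.sum_sub_distrib, hsum, zero_sub, neg_neg, map_sum, map_smul]
      refine Finset.sum_congr rfl fun j _ => ?_
      rw [PowerSeries.smul_eq_C_mul, mul_comm]
    rw [h1, dvd_neg]
    exact Finset.dvd_sum fun j _ => Dvd.dvd.mul_left (hcong j) _
  have hz := stepB1 W t σ i₀ hi₀ hnorm ev τ hev m _
    (Submodule.sum_mem _ fun j _ => Submodule.smul_mem _ _ (hu j)) _ hm hdvd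
  have h5 := (Fintype.linearIndependent_iff.mp hind) _ hz j0
  have h6 : PowerSeries.constantCoeff (γ j0) = 0 := by
    exact (pow_eq_zero_iff (pow_pos (Nat.Prime.pos Fact.out) _).ne').mp h5
  apply hj0
  rw [hγ j0, ← hn, PowerSeries.coeff_X_pow_mul']
  simp [h6]

theorem stepanov {ι : Type*} [Fintype ι] [IsAlgClosed k] (W : Submodule k A) (hW1 : (1 : A) ∈ W)
    (t θ : A) (ht : t ∈ W) (hθ : θ ∈ W) (σ : ι → (A →ₐ[k] A)) (i₀ : ι)
    (hi₀ : σ i₀ = AlgHom.id k A) (D : ℕ) (hD : Fintype.card ι = D)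
    (hnorm : ∀ m : ℕ, ∀ a ∈ W ^ m, a ≠ 0 → ∃ r : k[X], r ≠ 0 ∧
      r.natDegree ≤ Fintype.card ι * m ∧ aeval t r = ∏ i, σ i a)
    (hind : LinearIndependent k (fun x : ℕ × Fin D => t ^ x.1 * θ ^ (x.2 : ℕ)))
    (p : ℕ) [Fact p.Prime] [CharP k p]
    (ev : k → (A →ₐ[k] PowerSeries k)) (S : Finset (k × ι))
    (hinj : ∀ x ∈ S, Function.Injective (ev x.1))
    (hev : ∀ x ∈ S, ev x.1 t = PowerSeries.C x.1 + PowerSeries.X)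
    (e₁ e₂ : ℕ) (z : A →+* A) (hzinj : Function.Injective z)
    (hzk : ∀ c : k, z (algebraMap k A c) ^ (p ^ e₁ * p ^ e₂) = algebraMap k A c)
    (hzW : ∀ a ∈ W, z a ∈ W)
    (hS : ∀ x ∈ S, ∀ b : A, PowerSeries.constantCoeff (ev x.1 (σ x.2 (z b))) ^ (p ^ e₁ * p ^ e₂)
      = PowerSeries.constantCoeff (ev x.1 (σ x.2 b)))
    (m₀ l₀ : ℕ) (hdim : D * ((m₀ + D) * p ^ e₁ + (l₀ + D)) + 1 < D ^ 2 * (m₀ + 1) * (l₀ + 1))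
    (hP : D * (m₀ + D) < p ^ e₂) :
    S.card ≤ D * ((m₀ + D) + (l₀ + D) * p ^ e₂) := by
  classical
  rcases S.eq_empty_or_nonempty with hSe | ⟨s₀, hs₀⟩
  · simp [hSe]
  set P₁ := p ^ e₁ with hP₁
  set P₂ := p ^ e₂ with hP₂
  have hWmono : ∀ {a b : ℕ}, a ≤ b → W ^ a ≤ W ^ b := by
    intro a b hab
    exact pow_le_pow_right' (Submodule.one_le.mpr hW1) hab
  let mon : (m : ℕ) → (Fin (m + 1) × Fin D) → A := fun m x => t ^ (x.1 : ℕ) * θ ^ (x.2 : ℕ)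
  have hmonW : ∀ m x, mon m x ∈ W ^ (m + D) := by
    intro m x
    have h1 : mon m x ∈ W ^ ((x.1 : ℕ) + (x.2 : ℕ)) := by
      rw [pow_add]
      exact Submodule.mul_mem_mul (Submodule.pow_mem_pow _ ht _) (Submodule.pow_mem_pow _ hθ _)
    exact hWmono (by omega) h1
  have hmonind : ∀ m, LinearIndependent k (mon m) := by
    intro m
    exact hind.comp (fun x : Fin (m+1) × Fin D => ((x.1 : ℕ), x.2))
      (fun a b h => by
        rw [Prod.mk.injEq] at h
        exact Prod.ext (Fin.ext h.1) h.2)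
  let I := (Fin (m₀ + 1) × Fin D) × (Fin (l₀ + 1) × Fin D)
  -- the linear map
  let M₁ := (m₀ + D) * P₁ + (l₀ + D)
  let w : I → A := fun x => mon m₀ x.1 ^ P₁ * mon l₀ x.2
  have hw : ∀ x, w x ∈ W ^ M₁ := by
    intro x
    show _ ∈ W ^ ((m₀ + D) * P₁ + (l₀ + D))
    rw [pow_add, pow_mul]
    exact Submodule.mul_mem_mul (Submodule.pow_mem_pow _ (hmonW _ _) _) (hmonW _ _)
  let L : (I → k) →ₗ[k] (Fin (D * M₁ + 1) → k) :=
    { toFun := fun c n => PowerSeries.coeff (n : ℕ) (ev s₀.1 (∑ x, c x • w x))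
      map_add' := by
        intro c c'; funext n
        simp [add_smul, Finset.sum_add_distrib]
      map_smul' := by
        intro a c; funext n
        simp [mul_smul, ← Finset.smul_sum, Finset.mul_sum] }
  have hLker : ∃ c : I → k, c ≠ 0 ∧ L c = 0 := by
    have : ¬ Function.Injective L := by
      intro hLi
      have := LinearMap.finrank_le_finrank_of_injective hLi
      simp only [Module.finrank_fintype_fun_eq_card, Fintype.card_fin, I, Fintype.card_prod] at this
      have h2 : (m₀ + 1) * D * ((l₀ + 1) * D) = D ^ 2 * (m₀ + 1) * (l₀ + 1) := by ring
      rw [h2] at this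
      have h3 : D * M₁ + 1 = D * ((m₀ + D) * P₁ + (l₀ + D)) + 1 := rfl
      omega
    rw [injective_iff_map_eq_zero] at this
    push Not at this
    obtain ⟨c, hc, hc0⟩ := this
    exact ⟨c, hc0, hc⟩
  obtain ⟨c, hc0, hLc⟩ := hLker
  have hcw : ∑ x, c x • w x = 0 := by
    refine stepB1 W t σ i₀ hi₀ hnorm (ev s₀.1) s₀.1 (hev _ hs₀) M₁ _
      (Submodule.sum_mem _ fun j _ => Submodule.smul_mem _ _ (hw j)) (D * M₁ + 1) (by rw [hD]; omega) ?_
    rw [PowerSeries.X_pow_dvd_iff]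
    intro n hn
    exact congrFun hLc ⟨n, hn⟩
  have hPpos : 0 < P₁ * P₂ := Nat.mul_pos (pow_pos (Nat.Prime.pos Fact.out) _) (pow_pos (Nat.Prime.pos Fact.out) _)
  have hroot : ∀ x, ∃ c' : k, c' ^ (P₁ * P₂) = c x := fun x => IsAlgClosed.exists_pow_nat_eq _ hPpos
  choose c' hc' using hroot
  have hzc : ∀ x, z (algebraMap k A (c x)) = algebraMap k A (c' x) := by
    intro x
    rw [← hc' x, map_pow, map_pow, hzk]
  let B : (Fin (m₀ + 1) × Fin D) → A := fun x => ∑ y, algebraMap k A (c' (x, y)) * z (mon l₀ y)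
  have hBz : ∀ x, B x = z (∑ y, c (x, y) • mon l₀ y) := by
    intro x
    simp only [B, map_sum, Algebra.smul_def, map_mul, hzc]
  let g : A := ∑ x, mon m₀ x * B x ^ P₂
  have hg0 : g ≠ 0 := by
    intro hg
    have h1 := stepB2 W t σ i₀ hi₀ hnorm p (ev s₀.1) (hinj _ hs₀) s₀.1 (hev _ hs₀) (m₀ + D) e₂
      (by rw [hD]; exact hP) (mon m₀) (hmonW m₀) (hmonind m₀) B hg
    apply hc0
    funext ⟨x, y⟩
    have h2 := h1 x
    rw [hBz, map_eq_zero_iff z hzinj] at h2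
    exact Fintype.linearIndependent_iff.mp (hmonind l₀) _ h2 y
  have hzWm : ∀ m, ∀ a ∈ W ^ m, z a ∈ W ^ m := by
    intro m
    induction m with
    | zero =>
      intro a ha
      rw [pow_zero, Submodule.mem_one] at ha ⊢
      obtain ⟨y, rfl⟩ := ha
      obtain ⟨y', hy'⟩ := IsAlgClosed.exists_pow_nat_eq y hPpos
      exact ⟨y', by rw [← hy', map_pow, map_pow, hzk]⟩
    | succ m ih =>
      intro a ha
      rw [pow_succ] at ha ⊢
      induction ha using Submodule.mul_induction_on' with
      | mem_mul_mem a ha b hb =>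
        rw [map_mul]
        exact Submodule.mul_mem_mul (ih _ ha) (hzW _ hb)
      | add a ha b hb h1 h2 => rw [map_add]; exact add_mem h1 h2
  set mg := (m₀ + D) + (l₀ + D) * P₂ with hmg
  have hgW : g ∈ W ^ mg := by
    refine Submodule.sum_mem _ fun x _ => ?_
    rw [hmg, pow_add, pow_mul]
    refine Submodule.mul_mem_mul (hmonW _ _) (Submodule.pow_mem_pow _ ?_ _)
    rw [hBz]
    exact hzWm _ _ (Submodule.sum_mem _ fun y _ => Submodule.smul_mem _ _ (hmonW _ _))
  have hgS : ∀ x ∈ S, PowerSeries.constantCoeff (ev x.1 (σ x.2 g)) = 0 := by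
    intro x hx
    haveI : CharP (PowerSeries k) p := charP_of_injective_algebraMap (algebraMap k (PowerSeries k)).injective p
    haveI : ExpChar k p := ExpChar.prime Fact.out
    let π : A →+* k := (PowerSeries.constantCoeff (R := k)).comp ((ev x.1).comp (σ x.2)).toRingHom
    have hπ : ∀ b, π (z b) ^ (P₁ * P₂) = π b := fun b => hS x hx b
    have hπk : ∀ c, π (algebraMap k A c) = c := by
      intro c
      show PowerSeries.constantCoeff (ev x.1 (σ x.2 (algebraMap k A c))) = c
      rw [AlgHom.commutes, AlgHom.commutes]
      simp
    have h1 : π g ^ P₁ = 0 := by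
      have h2 : π g ^ P₁ = π (∑ x, c x • w x) := by
        have e1 : π g = ∑ x, π (mon m₀ x) * π (B x) ^ P₂ := by
          simp only [g, map_sum, map_mul, map_pow]
        have e2 : π (∑ x, c x • w x) = ∑ x, ∑ y, π (c (x, y) • w (x, y)) := by
          rw [map_sum π]
          exact Fintype.sum_prod_type _
        rw [e1, e2, hP₁, sum_pow_char_pow]
        refine Finset.sum_congr rfl fun x _ => ?_
        rw [mul_pow, ← hP₁, ← pow_mul, mul_comm P₂ P₁]
        rw [hBz, hπ, map_sum, Finset.mul_sum]
        refine Finset.sum_congr rfl fun y _ => ?_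
        simp only [w, Algebra.smul_def, map_mul, map_pow]
        ring
      rw [h2, hcw, map_zero]
    exact pow_eq_zero_iff (pow_pos (Nat.Prime.pos Fact.out) _).ne' |>.mp h1
  obtain ⟨r, hr0, hrd, hr⟩ := hnorm mg g hgW hg0
  rw [hD] at hrd
  refine le_trans ?_ hrd
  have hmult : ∀ τ : k, (S.filter (fun x => x.1 = τ)).card ≤ r.rootMultiplicity τ := by
    intro τ
    rcases (S.filter (fun x => x.1 = τ)).eq_empty_or_nonempty with he | ⟨s, hs⟩
    · simp [he]
    rw [Finset.mem_filter] at hs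
    obtain ⟨hs, rfl⟩ := hs
    apply rootMult_of_X_pow_dvd r hr0
    rw [← coe_taylor_ev (ev s.1) t s.1 (hev _ hs), hr, map_prod]
    have h1 : ∏ i ∈ (S.filter (fun x => x.1 = s.1)).image Prod.snd, (PowerSeries.X : PowerSeries k) ∣
        ∏ i, ev s.1 (σ i g) := by
      refine (Finset.prod_dvd_prod_of_dvd _ (fun i => ev s.1 (σ i g)) ?_).trans
        (Finset.prod_dvd_prod_of_subset _ _ _ (Finset.subset_univ _))
      intro i hi
      rw [Finset.mem_image] at hi
      obtain ⟨x, hx, rfl⟩ := hi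
      rw [Finset.mem_filter] at hx
      rw [PowerSeries.X_dvd_iff, ← hx.2]
      exact hgS x hx.1
    rw [Finset.prod_const, Finset.card_image_of_injOn] at h1
    · exact h1
    · intro a ha b hb hab
      simp only [Finset.coe_filter, Set.mem_ofPred_eq] at ha hb
      exact Prod.ext (ha.2.trans hb.2.symm) hab
  calc S.card = ∑ τ ∈ S.image Prod.fst, (S.filter (fun x => x.1 = τ)).card :=
        Finset.card_eq_sum_card_image _ _
    _ ≤ ∑ τ ∈ S.image Prod.fst, r.rootMultiplicity τ := Finset.sum_le_sum fun τ _ => hmult τ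
    _ = ∑ τ ∈ S.image Prod.fst, r.roots.count τ := by simp
    _ ≤ Multiset.card r.roots := by
        rw [← Multiset.toFinset_sum_count_eq]
        rw [← Finset.sum_filter_add_sum_filter_not _ (fun τ => τ ∈ r.roots.toFinset)]
        rw [add_comm, Finset.sum_eq_zero, zero_add]
        · exact Finset.sum_le_sum_of_subset (fun x hx => (Finset.mem_filter.mp hx).2)
        · intro x hx
          have := (Finset.mem_filter.mp hx).2
          rw [Multiset.mem_toFinset] at this
          exact Multiset.count_eq_zero_of_notMem this
    _ ≤ r.natDegree := card_roots' r
end Stepanov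
end APP

set_option linter.style.haveILetI false

namespace APP
section Hensel
variable {k : Type*} [Field k]

lemma hensel_unique (P : (PowerSeries k)[X]) (x y : PowerSeries k)
    (hx : P.eval x = 0) (hy : P.eval y = 0)
    (hxy : PowerSeries.constantCoeff x = PowerSeries.constantCoeff y)
    (hd : (derivative (P.map PowerSeries.constantCoeff)).eval (PowerSeries.constantCoeff x) ≠ 0) :
    x = y := by
  refine IsLocalRing.eq_of_eval_eq_zero_of_not_isUnit_sub hx hy ?_ ?_
  · rw [PowerSeries.isUnit_iff_constantCoeff, map_sub, hxy, sub_self]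
    exact not_isUnit_zero
  · rw [PowerSeries.isUnit_iff_constantCoeff, isUnit_iff_ne_zero]
    rwa [derivative_map, eval_map_apply] at hd

lemma hensel_exists (P : (PowerSeries k)[X]) (a : k)
    (h0 : (P.map PowerSeries.constantCoeff).eval a = 0)
    (hd : (derivative (P.map PowerSeries.constantCoeff)).eval a ≠ 0) :
    ∃ x : PowerSeries k, PowerSeries.constantCoeff x = a ∧ P.eval x = 0 := by
  set b := (derivative (P.map PowerSeries.constantCoeff)).eval a with hb
  have hstep : ∀ n : ℕ, 1 ≤ n → ∀ c : PowerSeries k, PowerSeries.constantCoeff c = a →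
      PowerSeries.X ^ n ∣ P.eval c → ∃ c' : PowerSeries k, PowerSeries.X ^ n ∣ c' - c ∧
        PowerSeries.constantCoeff c' = a ∧ PowerSeries.X ^ (n + 1) ∣ P.eval c' := by
    intro n hn c hc hdv
    have hdc : (PowerSeries.X : PowerSeries k) ∣ 1 - (derivative P).eval c * PowerSeries.C b⁻¹ := by
      rw [PowerSeries.X_dvd_iff]
      have : PowerSeries.constantCoeff ((derivative P).eval c) = b := by
        rw [hb, derivative_map, ← hc, eval_map_apply]
      simp [this, hd]
    refine ⟨c + (-(P.eval c * PowerSeries.C b⁻¹)), ?_, ?_, ?_⟩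
    · rw [add_sub_cancel_left, dvd_neg]; exact hdv.mul_right _
    · have : PowerSeries.constantCoeff (P.eval c) = 0 := by
        rw [← PowerSeries.X_dvd_iff]
        exact (dvd_pow_self _ (by omega)).trans hdv
      simp [hc, this]
    · obtain ⟨q, hq⟩ := Polynomial.binomExpansion P c (-(P.eval c * PowerSeries.C b⁻¹))
      rw [hq]
      have e : P.eval c + (derivative P).eval c * -(P.eval c * PowerSeries.C b⁻¹) +
          q * (-(P.eval c * PowerSeries.C b⁻¹)) ^ 2 =
          P.eval c * (1 - (derivative P).eval c * PowerSeries.C b⁻¹) +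
            (P.eval c * P.eval c) * (q * PowerSeries.C b⁻¹ ^ 2) := by ring
      rw [e]
      refine dvd_add ?_ (Dvd.dvd.mul_right ?_ _)
      · rw [pow_succ]; exact mul_dvd_mul hdv hdc
      · refine (pow_dvd_pow _ (by omega : n + 1 ≤ n + n)).trans ?_
        rw [pow_add]; exact mul_dvd_mul hdv hdv
  choose! nxt hn1 hn2 hn3 using hstep
  let c : ℕ → PowerSeries k := fun n => Nat.rec (PowerSeries.C a) (fun n x => nxt (n + 1) x) n
  have hc : ∀ n, PowerSeries.constantCoeff (c n) = a ∧ PowerSeries.X ^ (n + 1) ∣ P.eval (c n) := by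
    intro n
    induction n with
    | zero =>
      refine ⟨by simp [c], ?_⟩
      rw [zero_add, pow_one, PowerSeries.X_dvd_iff, ← eval_map_apply]
      simpa [c] using h0
    | succ n ih =>
      exact ⟨hn2 (n+1) (by omega) _ ih.1 ih.2, hn3 (n+1) (by omega) _ ih.1 ih.2⟩
  have hcd : ∀ n, PowerSeries.X ^ (n + 1) ∣ c (n + 1) - c n := fun n =>
    hn1 (n+1) (by omega) _ (hc n).1 (hc n).2
  have hcd2 : ∀ n m, PowerSeries.X ^ (n + 1) ∣ c (n + m) - c n := by
    intro n m
    induction m with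
    | zero => simp
    | succ m ih =>
      have : c (n + (m+1)) - c n = (c (n + m + 1) - c (n + m)) + (c (n + m) - c n) := by
        rw [← add_assoc]; ring
      rw [this]
      exact dvd_add ((pow_dvd_pow _ (by omega)).trans (hcd (n+m))) ih
  let x : PowerSeries k := PowerSeries.mk fun n => PowerSeries.coeff n (c n)
  have hx : ∀ n, PowerSeries.X ^ (n + 1) ∣ x - c n := by
    intro n
    rw [PowerSeries.X_pow_dvd_iff]
    intro m hm
    have h1 := hcd2 m (n - m)
    rw [PowerSeries.X_pow_dvd_iff] at h1
    have h2 := h1 m (by omega)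
    rw [show m + (n - m) = n by omega, map_sub] at h2
    rw [map_sub, PowerSeries.coeff_mk]
    linear_combination -h2
  refine ⟨x, ?_, ?_⟩
  · simp [x, PowerSeries.coeff_zero_eq_constantCoeff_apply, c, ← PowerSeries.coeff_zero_eq_constantCoeff]
  · have : ∀ n, PowerSeries.X ^ (n + 1) ∣ P.eval x := by
      intro n
      have h1 : x - c n ∣ P.eval x - P.eval (c n) := sub_dvd_eval_sub _ _ _
      have := dvd_add ((hx n).trans h1) (hc n).2
      simpa using this
    ext n
    have := this n
    rw [PowerSeries.X_pow_dvd_iff] at this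
    simpa using this n (by omega)
end Hensel
end APP

set_option linter.style.haveILetI false
set_option linter.unusedSectionVars false

namespace APP
section GroupContraction
open Classical in
/-- number of `g` such that `g ∘ α` has a fixed point -/
noncomputable def cntFix (G : Type*) [Group G] [Fintype G] {Ω : Type*} [MulAction G Ω]
    (α : Ω → Ω) : ℕ := (Finset.univ.filter (fun g : G => ∃ x : Ω, g • α x = x)).card

variable {G : Type*} [Group G] [Fintype G]
variable {Ω Ω' : Type*} [Fintype Ω] [Fintype Ω'] [MulAction G Ω] [MulAction G Ω']

open Classical in
lemma card_perm_fixing {Ω' : Type*} [Fintype Ω'] (R : Finset Ω') :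
    (Finset.univ.filter (fun π : Equiv.Perm Ω' => ∀ x, x ∉ R → π x = x)).card = R.card.factorial := by
  have h1 := Fintype.card_congr (Equiv.Perm.subtypeEquivSubtypePerm (fun x => x ∈ R))
  rw [Fintype.card_perm, Fintype.card_coe] at h1
  rw [h1, Fintype.card_subtype]

lemma exists_derange (par : Ω' → Ω) (hpar : ∀ (g : G) x, par (g • x) = g • par x)
    (hsurj : Function.Surjective par)
    (α : Ω → Ω) (α' : Ω' → Ω') (hα : ∀ x, par (α' x) = α (par x)) (hα'i : Function.Injective α')
    (hswap : ∀ x : Ω', ∃ x', x' ≠ x ∧ par x' = par x ∧ ∃ s : G, s • x = x' ∧ s • x' = x ∧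
      ∀ z, z ≠ x → z ≠ x' → s • z = z) (n : ℕ) :
    ∀ g : G, (Set.ncard {x | g • α' x = x}) ≤ n → ∃ h : G, (∀ x, (h * g) • α' x ≠ x) ∧
      (∀ x, par (h • x) = par x) ∧ (∀ x, g • α (par x) ≠ par x → h • x = x) := by
  induction n with
  | zero =>
    intro g hg
    refine ⟨1, ?_, by simp, by simp⟩
    intro x hx
    rw [one_mul] at hx
    have : ({x | g • α' x = x} : Set Ω') = ∅ := (Set.ncard_eq_zero (Set.toFinite _)).mp (by omega)
    have h2 : x ∈ ({x | g • α' x = x} : Set Ω') := hx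
    rw [this] at h2
    exact h2
  | succ n ih =>
    intro g hg
    by_cases hne : ∃ x, g • α' x = x
    swap
    · push Not at hne
      exact ⟨1, by simpa using hne, by simp, by simp⟩
    obtain ⟨x, hx⟩ := hne
    obtain ⟨x', hx'ne, hx'par, s, hs1, hs2, hs3⟩ := hswap x
    have hspar : ∀ z, par (s • z) = par z := by
      intro z
      by_cases h1 : z = x
      · rw [h1, hs1, hx'par]
      by_cases h2 : z = x'
      · rw [h2, hs2, hx'par]
      rw [hs3 z h1 h2]
    have hsΩ : ∀ w : Ω, s • w = w := by
      intro w
      obtain ⟨z, rfl⟩ := hsurj w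
      rw [← hpar, hspar]
    have hsub : ({z | (s * g) • α' z = z} : Set Ω') ⊂ {z | g • α' z = z} := by
      rw [Set.ssubset_iff_of_subset]
      · refine ⟨x, hx, ?_⟩
        intro h
        have h' : (s * g) • α' x = x := h
        rw [mul_smul, hx, hs1] at h'
        exact hx'ne h'
      · intro z hz
        have hz' : s • g • α' z = z := by rw [← mul_smul]; exact hz
        show g • α' z = z
        by_cases h1 : g • α' z = x
        · have : z = x := hα'i (MulAction.injective g (h1.trans hx.symm))
          rw [this]; exact hx
        by_cases h2 : g • α' z = x'
        · rw [h2, hs2] at hz'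
          rw [← hz'] at h2
          exact absurd (h2.symm.trans hx) hx'ne
        rwa [hs3 _ h1 h2] at hz'
    have hlt := Set.ncard_lt_ncard hsub (Set.toFinite _)
    obtain ⟨h, h1, h2, h3⟩ := ih (s * g) (by omega)
    refine ⟨h * s, ?_, ?_, ?_⟩
    · intro z; rw [mul_assoc]; exact h1 z
    · intro z; rw [mul_smul, h2, hspar]
    · intro z hz
      have hzx : z ≠ x := by
        rintro rfl
        apply hz
        rw [← hα, ← hpar, hx]
      have hzx' : z ≠ x' := by
        rintro rfl
        apply hz
        rw [hx'par, ← hα, ← hpar, hx]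
      rw [mul_smul, hs3 z hzx hzx']
      apply h3
      rwa [mul_smul, hsΩ]

open Classical in
lemma sum_fix (α : Ω → Ω) (htr : MulAction.IsPretransitive G Ω) [Nonempty Ω] :
    ∑ g : G, (Finset.univ.filter (fun x : Ω => g • α x = x)).card ≤ Fintype.card G := by
  have h1 : ∑ g : G, (Finset.univ.filter (fun x : Ω => g • α x = x)).card =
      ∑ x : Ω, (Finset.univ.filter (fun g : G => g • α x = x)).card := by
    simp only [Finset.card_filter]
    exact Finset.sum_comm
  rw [h1]
  have h2 : ∀ x : Ω, (Finset.univ.filter (fun g : G => g • α x = x)).card * Fintype.card Ω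
      = Fintype.card G := by
    intro x
    have h3 : ∀ y ∈ (Finset.univ : Finset Ω), (Finset.univ.filter (fun g : G => g • α x = y)).card =
        (Finset.univ.filter (fun g : G => g • α x = x)).card := by
      intro y _
      obtain ⟨h, hh⟩ := htr.exists_smul_eq x y
      refine (Finset.card_bij (fun g _ => h * g) ?_ ?_ ?_).symm
      · intro g hg
        simp only [Finset.mem_filter, Finset.mem_univ, true_and] at hg ⊢
        rw [mul_smul, hg, hh]
      · intro a _ b _ hab; simpa using hab
      · intro g hg
        simp only [Finset.mem_filter, Finset.mem_univ, true_and] at hg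
        refine ⟨h⁻¹ * g, ?_, by simp⟩
        simp only [Finset.mem_filter, Finset.mem_univ, true_and]
        rw [mul_smul, hg, ← hh, inv_smul_smul]
    have h4 := Finset.card_eq_sum_card_fiberwise (f := fun g : G => g • α x)
      (s := Finset.univ) (t := Finset.univ) (by intro g _; simp)
    rw [Finset.sum_congr rfl h3, Finset.sum_const, Finset.card_univ, Finset.card_univ, smul_eq_mul] at h4
    rw [h4]; ring
  have h5 : (∑ x : Ω, (Finset.univ.filter (fun g : G => g • α x = x)).card) * Fintype.card Ω
      = Fintype.card G * Fintype.card Ω := by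
    rw [Finset.sum_mul, Finset.sum_congr rfl (fun x _ => h2 x)]
    simp [mul_comm]
  have := Nat.eq_of_mul_eq_mul_right Fintype.card_pos h5
  exact this.le

open Classical in
lemma contraction_step (par : Ω' → Ω) (hpar : ∀ (g : G) x, par (g • x) = g • par x)
    (hsurj : Function.Surjective par)
    (α : Ω → Ω) (α' : Ω' → Ω') (hα : ∀ x, par (α' x) = α (par x)) (hα'i : Function.Injective α')
    (hswap : ∀ x : Ω', ∃ x', x' ≠ x ∧ par x' = par x ∧ ∃ s : G, s • x = x' ∧ s • x' = x ∧
      ∀ z, z ≠ x → z ≠ x' → s • z = z)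
    (htr : MulAction.IsPretransitive G Ω) [Nonempty Ω]
    (d M : ℕ) (hfib : ∀ w, (Finset.univ.filter (fun x => par x = w)).card ≤ d) :
    M * cntFix G α ≤ M * ((d * M).factorial * (cntFix G α - cntFix G α')) + Fintype.card G ∧
    cntFix G α' ≤ cntFix G α := by
  let X : G → ℕ := fun g => (Finset.univ.filter (fun x : Ω => g • α x = x)).card
  have hX : ∀ g, (∃ x : Ω, g • α x = x) ↔ 1 ≤ X g := by
    intro g
    simp only [X, Nat.one_le_iff_ne_zero, Finset.card_ne_zero, Finset.filter_nonempty_iff,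
      Finset.mem_univ, true_and]
  let A := Finset.univ.filter (fun g : G => ∃ x : Ω, g • α x = x)
  let A' := Finset.univ.filter (fun g : G => ∃ x : Ω', g • α' x = x)
  have hA'A : A' ⊆ A := by
    intro g hg
    simp only [A, A', Finset.mem_filter, Finset.mem_univ, true_and] at hg ⊢
    obtain ⟨x, hx⟩ := hg
    exact ⟨par x, by rw [← hα, ← hpar, hx]⟩
  let B := A.filter (fun g => X g ≤ M)
  let Z := A \ A'
  have hAc : A.card = cntFix G α := by unfold cntFix; congr!
  have hAc' : A'.card = cntFix G α' := by unfold cntFix; congr!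
  have hZ : Z.card = cntFix G α - cntFix G α' := by
    rw [← hAc, ← hAc']; exact Finset.card_sdiff_of_subset hA'A
  have hlarge : M * (A.filter (fun g => ¬ X g ≤ M)).card ≤ Fintype.card G := by
    refine le_trans ?_ (sum_fix (G := G) α htr)
    calc M * (A.filter (fun g => ¬ X g ≤ M)).card = ∑ g ∈ A.filter (fun g => ¬ X g ≤ M), M := by
          rw [Finset.sum_const, smul_eq_mul, mul_comm]
      _ ≤ ∑ g ∈ A.filter (fun g => ¬ X g ≤ M), X g := by
          refine Finset.sum_le_sum fun g hg => ?_
          have := (Finset.mem_filter.mp hg).2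
          omega
      _ ≤ ∑ g : G, X g := Finset.sum_le_sum_of_subset (Finset.subset_univ _)
  have hsplit : B.card + (A.filter (fun g => ¬ X g ≤ M)).card = A.card :=
    Finset.card_filter_add_card_filter_not _
  have hB : B.card ≤ (d * M).factorial * Z.card := by
    -- choose lifts
    let toP : G →* Equiv.Perm Ω' := MulAction.toPermHom G Ω'
    have hlift : ∃ L : Equiv.Perm Ω' → G, ∀ h : G, toP (L (toP h)) = toP h := by
      refine ⟨fun π => if h : ∃ g, toP g = π then h.choose else 1, fun h => ?_⟩
      have hex : ∃ g, toP g = toP h := ⟨h, rfl⟩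
      simp only [hex, dif_pos]
      exact hex.choose_spec
    obtain ⟨L, hL⟩ := hlift
    have hder : ∀ g : G, ∃ π : Equiv.Perm Ω', toP (L π) = π ∧ (∀ x, π (g • α' x) ≠ x) ∧
        (∀ x, par (π x) = par x) ∧ (∀ x, g • α (par x) ≠ par x → π x = x) := by
      intro g
      obtain ⟨h, h1, h2, h3⟩ := exists_derange par hpar hsurj α α' hα hα'i hswap _ g le_rfl
      refine ⟨toP h, hL h, ?_, h2, h3⟩
      intro x hx
      apply h1 x
      rw [mul_smul]; exact hx
    choose π hπ1 hπ2 hπ3 hπ4 using hder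
    have hΩ : ∀ (g : G) (w : Ω), L (π g) • w = w := by
      intro g w
      obtain ⟨z, rfl⟩ := hsurj w
      rw [← hpar]
      have : L (π g) • z = π g z := by
        conv_rhs => rw [← hπ1 g]
        rfl
      rw [this, hπ3]
    have hmaps : ∀ g ∈ B, L (π g) * g ∈ Z := by
      intro g hg
      simp only [B, A, Finset.mem_filter, Finset.mem_univ, true_and] at hg
      simp only [Z, A, A', Finset.mem_sdiff, Finset.mem_filter, Finset.mem_univ, true_and]
      refine ⟨?_, ?_⟩
      · obtain ⟨x, hx⟩ := hg.1
        exact ⟨x, by rw [mul_smul, hΩ, hx]⟩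
      · rintro ⟨x, hx⟩
        apply hπ2 g x
        rw [mul_smul] at hx
        conv_lhs => rw [← hπ1 g]
        exact hx
    refine Finset.card_le_mul_card_image_of_maps_to hmaps _ ?_
    intro g' hg'
    by_cases hne : (B.filter (fun g => L (π g) * g = g')).Nonempty
    swap
    · rw [Finset.not_nonempty_iff_eq_empty] at hne
      simp [hne]
    obtain ⟨g1, hg1⟩ := hne
    let R : Finset Ω' := Finset.univ.filter (fun x => g' • α (par x) = par x)
    have hsame : ∀ g, L (π g) * g = g' → ∀ w : Ω, g' • w = g • w := by
      intro g hg w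
      rw [← hg, mul_smul, hΩ]
    have hR : R.card ≤ d * M := by
      have hXg : X g' ≤ M := by
        have h1 := Finset.mem_filter.mp hg1
        have h2 := (Finset.mem_filter.mp h1.1).2
        have : X g' = X g1 := by
          simp only [ X ]
          congr 1
          ext w
          simp only [hsame g1 h1.2]
        omega
      have h1 := Finset.card_le_mul_card_image_of_maps_to (f := par) (s := R)
        (t := Finset.univ.filter (fun x : Ω => g' • α x = x)) (by
          intro x hx
          simpa [R] using hx) d (by
          intro w _
          refine (Finset.card_le_card ?_).trans (hfib w)
          intro x hx
          simp only [Finset.mem_filter] at hx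
          simpa using hx.2)
      exact h1.trans (Nat.mul_le_mul_left _ hXg)
    calc (B.filter (fun g => L (π g) * g = g')).card
        ≤ (Finset.univ.filter (fun π : Equiv.Perm Ω' => ∀ x, x ∉ R → π x = x)).card := by
          refine Finset.card_le_card_of_injOn π ?_ ?_
          · intro g hg
            have h1 := (Finset.mem_filter.mp hg).2
            refine Finset.mem_coe.mpr (Finset.mem_filter.mpr ⟨Finset.mem_univ _, ?_⟩)
            intro x hx
            apply hπ4 g x
            intro h2
            apply hx
            refine Finset.mem_filter.mpr ⟨Finset.mem_univ _, ?_⟩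
            rw [hsame g h1, h2]
          · intro a ha b hb hab
            have h1 := (Finset.mem_filter.mp ha).2
            have h2 := (Finset.mem_filter.mp hb).2
            rw [hab] at h1
            exact mul_left_cancel (h1.trans h2.symm)
      _ = R.card.factorial := card_perm_fixing R
      _ ≤ (d * M).factorial := Nat.factorial_le hR
  refine ⟨?_, by rw [← hAc, ← hAc']; exact Finset.card_le_card hA'A⟩
  rw [← hZ]
  rw [← hAc, ← hsplit, mul_add]
  exact add_le_add (Nat.mul_le_mul_left _ hB) hlarge

end GroupContraction
end APP

namespace APP
lemma iterate_contraction (c M G : ℕ) (hG : 0 < G) (U : ℕ → ℕ) (N : ℕ) (hN : M * c < N)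
    (h0 : U 0 ≤ G)
    (hstep : ∀ i < N, M * U i ≤ M * (c * (U i - U (i + 1))) + G ∧ U (i + 1) ≤ U i) :
    M * U N ≤ 2 * G := by
  by_contra hcon
  push Not at hcon
  have hmono : ∀ i ≤ N, U N ≤ U (N - i) := by
    intro i hi
    induction i with
    | zero => simp
    | succ i ih =>
      have h1 := ih (by omega)
      have h2 := (hstep (N - (i + 1)) (by omega)).2
      rw [show N - (i + 1) + 1 = N - i by omega] at h2
      omega
  have hsum : ∀ i ≤ N, i * G + M * c * U i ≤ M * c * U 0 := by
    intro i hi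
    induction i with
    | zero => simp
    | succ i ih =>
      have h1 := ih (by omega)
      obtain ⟨h2, h3⟩ := hstep i (by omega)
      have h4 := hmono (N - i) (by omega)
      rw [show N - (N - i) = i by omega] at h4
      have h5 : M * U N ≤ M * U i := Nat.mul_le_mul_left _ h4
      have h6 : G ≤ M * (c * (U i - U (i + 1))) := by omega
      obtain ⟨e, he⟩ := Nat.exists_eq_add_of_le h3
      rw [he, Nat.add_sub_cancel_left] at h6
      rw [he] at h1
      nlinarith
  have h1 := hsum N le_rfl
  have h2 : M * c * U 0 ≤ M * c * G := Nat.mul_le_mul_left _ h0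
  have h3 : N * G ≤ M * c * G := by
    have : 0 ≤ M * c * U N := Nat.zero_le _
    omega
  have := Nat.le_of_mul_le_mul_right h3 hG
  omega
end APP


namespace APP
section Iterates
variable {R S T : Type*} [CommRing R] [CommRing S] [CommRing T]

/-- degree `d` homogenization of `f`, evaluated at `(a, b)` -/
noncomputable def homE (d : ℕ) (φ : R →+* S) (f : R[X]) (a b : S) : S :=
  ∑ j ∈ Finset.range (d + 1), φ (f.coeff j) * a ^ j * b ^ (d - j)

lemma map_homE (d : ℕ) (φ : R →+* S) (ψ : S →+* T) (f : R[X]) (a b : S) :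
    ψ (homE d φ f a b) = homE d (ψ.comp φ) f (ψ a) (ψ b) := by
  simp [homE]

lemma homE_map (d : ℕ) (φ : R →+* S) (ψ : S →+* T) (f : R[X]) (a b : T) :
    homE d ψ (f.map φ) a b = homE d (ψ.comp φ) f a b := by
  simp [homE]

lemma homE_zero_right (d : ℕ) (φ : R →+* S) (f : R[X]) (a : S) :
    homE d φ f a 0 = φ (f.coeff d) * a ^ d := by
  rw [homE, Finset.sum_eq_single d]
  · simp
  · intro j hj hne
    have : d - j ≠ 0 := by have := Finset.mem_range.mp hj; omega
    simp [this]
  · simp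

lemma homE_one (d : ℕ) (φ : R →+* S) (f : R[X]) (hf : f.natDegree ≤ d) (a : S) :
    homE d φ f a 1 = eval₂ φ a f := by
  rw [homE, eval₂_eq_sum_range' φ (Nat.lt_succ_of_le hf)]
  simp

lemma homE_smul (d : ℕ) (φ : R →+* S) (f : R[X]) (a b c : S) :
    homE d φ f (c * a) (c * b) = c ^ d * homE d φ f a b := by
  rw [homE, homE, Finset.mul_sum]
  refine Finset.sum_congr rfl fun j hj => ?_
  have : c ^ d = c ^ j * c ^ (d - j) := by
    rw [← pow_add]; congr 1; have := Finset.mem_range.mp hj; omega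
  rw [this]; ring

lemma homE_field {L : Type*} [Field L] (d : ℕ) (φ : R →+* L) (f : R[X]) (hf : f.natDegree ≤ d)
    (a b : L) (hb : b ≠ 0) : homE d φ f a b = b ^ d * eval₂ φ (a / b) f := by
  rw [← homE_one d φ f hf, ← homE_smul, mul_div_cancel₀ _ hb, mul_one]

/-- iterates of `f / g` as pairs of polynomials -/
noncomputable def itP (d : ℕ) (f g : R[X]) : ℕ → R[X] × R[X]
  | 0 => (X, 1)
  | n + 1 => (homE d C f (itP d f g n).1 (itP d f g n).2, homE d C g (itP d f g n).1 (itP d f g n).2)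

lemma itP_map (d : ℕ) (f g : R[X]) (φ : R →+* S) (n : ℕ) :
    itP d (f.map φ) (g.map φ) n = ((itP d f g n).1.map φ, (itP d f g n).2.map φ) := by
  induction n with
  | zero => simp [itP]
  | succ n ih =>
    simp only [itP, ih]
    have h := fun (f : R[X]) => map_homE d (C : R →+* R[X]) (mapRingHom φ) f (itP d f g n).1 (itP d f g n).2
    have hc : (mapRingHom φ).comp (C : R →+* R[X]) = (C : S →+* S[X]).comp φ := by ext; simp
    refine Prod.ext ?_ ?_
    · have := map_homE d (C : R →+* R[X]) (mapRingHom φ) f (itP d f g n).1 (itP d f g n).2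
      simp only [coe_mapRingHom] at this
      show homE d C (map φ f) _ _ = map φ _
      rw [this, hc, homE_map]
    · have := map_homE d (C : R →+* R[X]) (mapRingHom φ) g (itP d f g n).1 (itP d f g n).2
      simp only [coe_mapRingHom] at this
      show homE d C (map φ g) _ _ = map φ _
      rw [this, hc, homE_map]

lemma eval₂_itP_succ (d : ℕ) (f g : R[X]) (φ : R →+* S) (x : S) (n : ℕ) :
    eval₂ φ x (itP d f g (n+1)).1 = homE d φ f (eval₂ φ x (itP d f g n).1) (eval₂ φ x (itP d f g n).2) ∧
    eval₂ φ x (itP d f g (n+1)).2 = homE d φ g (eval₂ φ x (itP d f g n).1) (eval₂ φ x (itP d f g n).2) := by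
  have hc : (eval₂RingHom φ x).comp (C : R →+* R[X]) = φ := by ext; simp
  constructor
  · have := map_homE d (C : R →+* R[X]) (eval₂RingHom φ x) f (itP d f g n).1 (itP d f g n).2
    rw [hc] at this
    exact this
  · have := map_homE d (C : R →+* R[X]) (eval₂RingHom φ x) g (itP d f g n).1 (itP d f g n).2
    rw [hc] at this
    exact this

lemma natDegree_homE_le (d e : ℕ) (f a b : R[X]) (ha : a.natDegree ≤ e) (hb : b.natDegree ≤ e) :
    (homE d C f a b).natDegree ≤ d * e := by
  refine natDegree_sum_le_of_forall_le _ _ fun j hj => ?_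
  have hj := Finset.mem_range.mp hj
  refine (natDegree_mul_le).trans ?_
  have h1 : (C (f.coeff j) * a ^ j).natDegree ≤ j * e :=
    (natDegree_C_mul_le _ _).trans ((natDegree_pow_le).trans (Nat.mul_le_mul_left _ ha))
  have h2 : (b ^ (d - j)).natDegree ≤ (d - j) * e :=
    (natDegree_pow_le).trans (Nat.mul_le_mul_left _ hb)
  calc _ ≤ j * e + (d - j) * e := add_le_add h1 h2
    _ = d * e := by rw [← add_mul]; congr 1; omega

lemma natDegree_itP_le (d : ℕ) (f g : R[X]) (n : ℕ) (hd : 1 ≤ d) :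
    (itP d f g n).1.natDegree ≤ d ^ n ∧ (itP d f g n).2.natDegree ≤ d ^ n := by
  induction n with
  | zero => simp [itP, natDegree_X_le]
  | succ n ih =>
    rw [pow_succ']
    exact ⟨natDegree_homE_le d _ f _ _ ih.1 ih.2, natDegree_homE_le d _ g _ _ ih.1 ih.2⟩

lemma coeff_homE_top (d e : ℕ) (f a b : R[X]) (ha : a.natDegree ≤ e) (hb : b.natDegree ≤ e) :
    (homE d C f a b).coeff (d * e) = homE d (RingHom.id R) f (a.coeff e) (b.coeff e) := by
  rw [homE, homE, finsetSum_coeff]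
  refine Finset.sum_congr rfl fun j hj => ?_
  have hj := Finset.mem_range.mp hj
  have h3 : d * e = j * e + (d - j) * e := by rw [← add_mul]; congr 1; omega
  have h1 : (a ^ j).natDegree ≤ j * e := (natDegree_pow_le).trans (Nat.mul_le_mul_left _ ha)
  have h2 : (b ^ (d - j)).natDegree ≤ (d - j) * e :=
    (natDegree_pow_le).trans (Nat.mul_le_mul_left _ hb)
  rw [mul_assoc, coeff_C_mul, h3, coeff_mul_add_eq_of_natDegree_le h1 h2,
    coeff_pow_of_natDegree_le ha, coeff_pow_of_natDegree_le hb, RingHom.id_apply, mul_assoc]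

lemma coeff_itP_top_succ (d : ℕ) (f g : R[X]) (n : ℕ) (hd : 1 ≤ d) :
    (itP d f g (n+1)).1.coeff (d ^ (n+1)) = homE d (RingHom.id R) f ((itP d f g n).1.coeff (d ^ n))
      ((itP d f g n).2.coeff (d ^ n)) ∧
    (itP d f g (n+1)).2.coeff (d ^ (n+1)) = homE d (RingHom.id R) g ((itP d f g n).1.coeff (d ^ n))
      ((itP d f g n).2.coeff (d ^ n)) := by
  rw [pow_succ']
  obtain ⟨h1, h2⟩ := natDegree_itP_le d f g n hd
  exact ⟨coeff_homE_top d _ f _ _ h1 h2, coeff_homE_top d _ g _ _ h1 h2⟩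

lemma homE_eq_zero {k L : Type*} [Field k] [Field L] (φ : k →+* L) (d : ℕ) (f g : k[X])
    (hf : f.natDegree ≤ d) (hg : g.natDegree ≤ d) (hfg : IsCoprime f g)
    (htop : f.coeff d ≠ 0 ∨ g.coeff d ≠ 0) (a b : L) (h1 : homE d φ f a b = 0)
    (h2 : homE d φ g a b = 0) : a = 0 ∧ b = 0 := by
  by_cases hb : b = 0
  · refine ⟨?_, hb⟩
    rw [hb, homE_zero_right] at h1 h2
    by_contra ha
    have had : a ^ d ≠ 0 := pow_ne_zero _ ha
    rcases htop with h | h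
    · rcases mul_eq_zero.mp h1 with h3 | h3
      · exact h ((map_eq_zero φ).mp h3)
      · exact had h3
    · rcases mul_eq_zero.mp h2 with h3 | h3
      · exact h ((map_eq_zero φ).mp h3)
      · exact had h3
  · exfalso
    rw [homE_field d φ _ hf _ _ hb] at h1
    rw [homE_field d φ _ hg _ _ hb] at h2
    have hbd : b ^ d ≠ 0 := pow_ne_zero _ hb
    have h3 := (mul_eq_zero.mp h1).resolve_left hbd
    have h4 := (mul_eq_zero.mp h2).resolve_left hbd
    obtain ⟨u, v, huv⟩ := hfg
    have h5 := congrArg (eval₂ φ (a / b)) huv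
    simp only [eval₂_add, eval₂_mul, h3, h4, mul_zero, add_zero, eval₂_one] at h5
    exact zero_ne_one h5

variable {k : Type*} [Field k]

lemma itP_no_common_root {L : Type*} [Field L] (φ : k →+* L) (d : ℕ) (f g : k[X])
    (hf : f.natDegree ≤ d) (hg : g.natDegree ≤ d) (hfg : IsCoprime f g)
    (htop : f.coeff d ≠ 0 ∨ g.coeff d ≠ 0) (x : L) (n : ℕ) :
    ¬ (eval₂ φ x (itP d f g n).1 = 0 ∧ eval₂ φ x (itP d f g n).2 = 0) := by
  induction n with
  | zero => simp [itP]
  | succ n ih =>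
    rintro ⟨h1, h2⟩
    obtain ⟨e1, e2⟩ := eval₂_itP_succ d f g φ x n
    rw [e1] at h1
    rw [e2] at h2
    exact ih (homE_eq_zero φ d f g hf hg hfg htop _ _ h1 h2)

lemma itP_top (d : ℕ) (hd : 1 ≤ d) (f g : k[X])
    (hf : f.natDegree ≤ d) (hg : g.natDegree ≤ d) (hfg : IsCoprime f g)
    (htop : f.coeff d ≠ 0 ∨ g.coeff d ≠ 0) (n : ℕ) :
    ¬ ((itP d f g n).1.coeff (d ^ n) = 0 ∧ (itP d f g n).2.coeff (d ^ n) = 0) := by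
  induction n with
  | zero => simp [itP]
  | succ n ih =>
    rintro ⟨h1, h2⟩
    obtain ⟨e1, e2⟩ := coeff_itP_top_succ d f g n hd
    rw [e1] at h1
    rw [e2] at h2
    exact ih (homE_eq_zero _ d f g hf hg hfg htop _ _ h1 h2)

lemma itP_coprime [IsAlgClosed k] (d : ℕ) (f g : k[X])
    (hf : f.natDegree ≤ d) (hg : g.natDegree ≤ d) (hfg : IsCoprime f g)
    (htop : f.coeff d ≠ 0 ∨ g.coeff d ≠ 0) (n : ℕ) :
    IsCoprime (itP d f g n).1 (itP d f g n).2 := by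
  rw [← isRelPrime_iff_isCoprime]
  intro q h1 h2
  by_contra hq
  by_cases hq0 : q.degree = 0
  · exact hq (isUnit_iff_degree_eq_zero.mpr hq0)
  obtain ⟨x, hx⟩ := IsAlgClosed.exists_root q hq0
  apply itP_no_common_root (RingHom.id k) d f g hf hg hfg htop x n
  exact ⟨by simpa using! (dvd_iff_isRoot.mpr hx |>.trans h1 |> dvd_iff_isRoot.mp), by
    simpa using! (dvd_iff_isRoot.mpr hx |>.trans h2 |> dvd_iff_isRoot.mp)⟩

/-- `a - t b` -/
noncomputable def PP {R S : Type*} [CommRing R] [CommRing S] (φ : R →+* S) (t : S) (a b : R[X]) : S[X] :=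
  a.map φ - C t * b.map φ

lemma PP_map (φ : R →+* S) (t : S) (a b : R[X]) (ψ : S →+* T) :
    (PP φ t a b).map ψ = PP (ψ.comp φ) (ψ t) a b := by
  simp [PP, Polynomial.map_map]

lemma PP_eval (φ : R →+* S) (t : S) (a b : R[X]) (x : S) :
    (PP φ t a b).eval x = eval₂ φ x a - t * eval₂ φ x b := by
  simp [PP, eval_map]

lemma PP_eval₂ (φ : R →+* S) (t : S) (a b : R[X]) (ψ : S →+* T) (x : T) :
    (PP φ t a b).eval₂ ψ x = eval₂ (ψ.comp φ) x a - ψ t * eval₂ (ψ.comp φ) x b := by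
  rw [← eval_map, PP_map, PP_eval]

lemma PP_coeff (φ : R →+* S) (t : S) (a b : R[X]) (n : ℕ) :
    (PP φ t a b).coeff n = φ (a.coeff n) - t * φ (b.coeff n) := by
  simp [PP]

lemma PP_natDegree_le (φ : R →+* S) (t : S) (a b : R[X]) (n : ℕ) (ha : a.natDegree ≤ n)
    (hb : b.natDegree ≤ n) : (PP φ t a b).natDegree ≤ n := by
  rw [natDegree_le_iff_coeff_eq_zero] at *
  intro m hm
  rw [PP_coeff, ha m hm, hb m hm]; simp

lemma biv_irreducible (a b : k[X]) (hb : b ≠ 0) (hab : IsCoprime a b) :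
    Irreducible (PP (C : k →+* k[X]) X a b) := by
  have : PP (C : k →+* k[X]) X a b = Bivariate.swap
      (Polynomial.C a - Polynomial.X * Polynomial.C b) := by
    rw [map_sub, map_mul, Bivariate.swap_C, Bivariate.swap_C, Bivariate.swap_Y, PP]
  rw [this, MulEquiv.irreducible_iff]
  have h2 : (Polynomial.C a - Polynomial.X * Polynomial.C b : k[X][X]) =
      C (-b) * X + C a := by rw [map_neg]; ring
  rw [h2]
  exact irreducible_C_mul_X_add_C (neg_ne_zero.mpr hb)
      ((IsCoprime.neg_right_iff _ _).mpr hab).symm.isRelPrime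

lemma PT_irreducible (a b : k[X]) (n : ℕ) (hn : 0 < n) (hb : b ≠ 0) (hab : IsCoprime a b)
    (htop : ¬ (a.coeff n = 0 ∧ b.coeff n = 0)) :
    Irreducible (PP (RatFunc.C : k →+* RatFunc k) RatFunc.X a b) := by
  have h := biv_irreducible a b hb hab
  have e : PP (RatFunc.C : k →+* RatFunc k) RatFunc.X a b =
      (PP (C : k →+* k[X]) X a b).map (algebraMap k[X] (RatFunc k)) := by
    rw [PP_map]
    congr 1
  rw [e, ← IsPrimitive.irreducible_iff_irreducible_map_fraction_map]
  · exact h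
  · apply h.isPrimitive
    intro H
    have h1 := coeff_eq_zero_of_natDegree_lt (p := PP (C : k →+* k[X]) X a b) (n := n) (by omega)
    rw [PP_coeff] at h1
    apply htop
    have h2 := congrArg (fun p => coeff p 0) h1
    have h3 := congrArg (fun p => coeff p 1) h1
    simp only [coeff_sub, coeff_C_zero, coeff_X_mul_zero, coeff_zero, sub_zero] at h2
    have : coeff (X * C (b.coeff n)) 1 = b.coeff n := by
      rw [show (1:ℕ) = 0 + 1 by rfl, coeff_X_mul]; simp
    simp [coeff_C] at h3
    exact ⟨h2, h3⟩

end Iterates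
end APP


namespace APP
section Galois

/-- Basic hypotheses on a pair `(f, g)`. -/
structure GoodPair {k : Type*} [Field k] (d : ℕ) (f g : k[X]) : Prop where
  hd : 2 ≤ d
  hf : f.natDegree ≤ d
  hg : g.natDegree ≤ d
  hgd : g.coeff d ≠ 0
  cop : IsCoprime f g
  hdk : (d : k) ≠ 0

variable {k : Type*} [Field k] [IsAlgClosed k]
variable {d : ℕ} {f g : k[X]}
variable (K : Type*) [Field K] [Algebra k K] [Algebra (RatFunc k) K] [IsScalarTower k (RatFunc k) K]

lemma nonconst_eval {L : Type*} [Field L] (φ : k →+* L) (x : L) (hx : ∀ c, x ≠ φ c) (q : k[X])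
    (hq : q ≠ 0) : eval₂ φ x q ≠ 0 := by
  have h := (IsAlgClosed.splits q).eq_prod_roots
  rw [h, eval₂_mul, eval₂_C, ← coe_eval₂RingHom, map_multiset_prod, Multiset.map_map]
  refine mul_ne_zero ?_ ?_
  · rw [Ne, map_eq_zero]; exact leadingCoeff_ne_zero.mpr hq
  · rw [Ne, Multiset.prod_eq_zero_iff, Multiset.mem_map]
    rintro ⟨r, _, hr⟩
    simp only [Function.comp_apply, coe_eval₂RingHom, eval₂_sub, eval₂_X, eval₂_C] at hr
    exact hx r (sub_eq_zero.mp hr)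

/-- the rational map on a field -/
noncomputable def psi {L : Type*} [Field L] (φ : k →+* L) (f g : k[X]) (x : L) : L :=
  eval₂ φ x f / eval₂ φ x g

lemma GoodPair.g_ne (H : GoodPair d f g) : g ≠ 0 := by
  intro h; apply H.hgd; rw [h, coeff_zero]

lemma GoodPair.itg_ne (H : GoodPair d f g) (n : ℕ) : (itP d f g n).2 ≠ 0 := by
  have hd := H.hd
  intro h
  have h1 := itP_coprime d f g H.hf H.hg H.cop (Or.inr H.hgd) n
  rw [h, isCoprime_zero_right] at h1
  apply itP_top d (by omega) f g H.hf H.hg H.cop (Or.inr H.hgd) n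
  rw [h]
  refine ⟨?_, by simp⟩
  apply coeff_eq_zero_of_natDegree_lt
  rw [natDegree_eq_zero_of_isUnit h1]
  positivity

lemma GoodPair.sub_ne (H : GoodPair d f g) (c : k) : f - C c * g ≠ 0 := by
  intro h
  have h1 : g ∣ f := ⟨C c, by rw [sub_eq_zero.mp h]; ring⟩
  have h2 := H.cop.isUnit_of_dvd' h1 dvd_rfl
  have h3 := natDegree_eq_zero_of_isUnit h2
  have := le_natDegree_of_ne_zero H.hgd
  have := H.hd
  omega

lemma GoodPair.psi_nonconst (H : GoodPair d f g) {L : Type*} [Field L] (φ : k →+* L) (x : L)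
    (hx : ∀ c, x ≠ φ c) : ∀ c, psi φ f g x ≠ φ c := by
  intro c hc
  have h1 := nonconst_eval φ x hx g H.g_ne
  rw [psi, div_eq_iff h1] at hc
  apply nonconst_eval φ x hx _ (H.sub_ne c)
  rw [eval₂_sub, eval₂_mul, eval₂_C, hc, sub_self]

lemma GoodPair.psi_iterate_nonconst (H : GoodPair d f g) {L : Type*} [Field L] (φ : k →+* L) (x : L)
    (hx : ∀ c, x ≠ φ c) (n : ℕ) : ∀ c, (psi φ f g)^[n] x ≠ φ c := by
  induction n with
  | zero => simpa using hx
  | succ n ih =>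
    rw [Function.iterate_succ_apply']
    exact H.psi_nonconst φ _ ih

lemma GoodPair.psi_iterate (H : GoodPair d f g) {L : Type*} [Field L] (φ : k →+* L) (x : L)
    (hx : ∀ c, x ≠ φ c) (n : ℕ) :
    (psi φ f g)^[n] x = eval₂ φ x (itP d f g n).1 / eval₂ φ x (itP d f g n).2 := by
  induction n with
  | zero => simp [itP]
  | succ n ih =>
    have h0 := nonconst_eval φ x hx _ (H.itg_ne n)
    obtain ⟨e1, e2⟩ := eval₂_itP_succ d f g φ x n
    rw [Function.iterate_succ_apply', ih, psi, e1, e2, homE_field d φ f H.hf _ _ h0,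
      homE_field d φ g H.hg _ _ h0, mul_div_mul_left _ _ (pow_ne_zero _ h0)]

/-- `f_n - t g_n` over `k(t)` -/
noncomputable abbrev PT (d : ℕ) (f g : k[X]) (n : ℕ) : (RatFunc k)[X] :=
  PP (RatFunc.C : k →+* RatFunc k) RatFunc.X (itP d f g n).1 (itP d f g n).2

lemma GoodPair.PT_irred (H : GoodPair d f g) (n : ℕ) : Irreducible (PT d f g n) := by
  have := H.hd
  exact PT_irreducible _ _ (d ^ n) (by positivity) (H.itg_ne n)
    (itP_coprime d f g H.hf H.hg H.cop (Or.inr H.hgd) n)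
    (itP_top d (by omega) f g H.hf H.hg H.cop (Or.inr H.hgd) n)

lemma ratX_ne_C (c : k) : (RatFunc.X : RatFunc k) ≠ RatFunc.C c := by
  rw [← RatFunc.algebraMap_X, ← RatFunc.algebraMap_C]
  intro h
  have := RatFunc.algebraMap_injective k h
  exact Polynomial.X_ne_C c this

lemma comb_ne_zero {L : Type*} [Field L] (φ : k →+* L) (z : L) (hz : ∀ c, z ≠ φ c) (a b : k)
    (hab : ¬ (a = 0 ∧ b = 0)) : φ a - z * φ b ≠ 0 := by
  intro h
  by_cases hb : b = 0
  · rw [hb, map_zero, mul_zero, sub_zero, map_eq_zero] at h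
    exact hab ⟨h, hb⟩
  · apply hz (a / b)
    rw [map_div₀, eq_div_iff ((map_ne_zero φ).mpr hb)]
    linear_combination -h

lemma GoodPair.PT_natDegree (H : GoodPair d f g) (n : ℕ) : (PT d f g n).natDegree = d ^ n := by
  have := H.hd
  obtain ⟨h1, h2⟩ := natDegree_itP_le d f g n (by omega)
  refine le_antisymm (PP_natDegree_le _ _ _ _ _ h1 h2) (le_natDegree_of_ne_zero ?_)
  rw [PP_coeff]
  exact comb_ne_zero _ _ ratX_ne_C _ _ (itP_top d (by omega) f g H.hf H.hg H.cop (Or.inr H.hgd) n)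

lemma GoodPair.PT_sep (H : GoodPair d f g) (n : ℕ) : (PT d f g n).Separable := by
  have := H.hd
  rw [separable_iff_derivative_ne_zero (H.PT_irred n)]
  intro h
  have h1 := congrArg (fun q => coeff q (d ^ n - 1)) h
  simp only [coeff_derivative, coeff_zero] at h1
  have hpos : 0 < d ^ n := by positivity
  rw [Nat.sub_add_cancel hpos] at h1
  rcases mul_eq_zero.mp h1 with h2 | h2
  · rw [← H.PT_natDegree n, coeff_natDegree, leadingCoeff_eq_zero] at h2
    exact (H.PT_irred n).ne_zero h2
  · have : ((d ^ n - 1 : ℕ) : RatFunc k) + 1 = RatFunc.C ((d : k) ^ n) := by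
      rw [← Nat.cast_add_one, Nat.sub_add_cancel hpos]; simp
    rw [this, map_eq_zero] at h2
    exact pow_ne_zero _ H.hdk h2

/-- the transcendental `t` in `K` -/
noncomputable abbrev TT (k : Type*) [Field k] (K : Type*) [Field K] [Algebra (RatFunc k) K] : K := algebraMap (RatFunc k) K RatFunc.X

lemma TT_ne (c : k) : TT k K ≠ algebraMap k K c := by
  rw [IsScalarTower.algebraMap_apply k (RatFunc k) K]
  intro h
  have := (algebraMap (RatFunc k) K).injective h
  rw [RatFunc.algebraMap_eq_C] at this
  exact ratX_ne_C c this

/-- The level-`n` set. -/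
def Om (f g : k[X]) (n : ℕ) : Set K :=
  {x | (∀ c, x ≠ algebraMap k K c) ∧ (psi (algebraMap k K) f g)^[n] x = TT k K}

variable {K}

lemma aeval_PT (n : ℕ) (x : K) : aeval x (PT d f g n) =
    eval₂ (algebraMap k K) x (itP d f g n).1 - TT k K * eval₂ (algebraMap k K) x (itP d f g n).2 := by
  rw [aeval_def, PP_eval₂, ← RatFunc.algebraMap_eq_C, ← IsScalarTower.algebraMap_eq k (RatFunc k) K]

lemma GoodPair.mem_Om (H : GoodPair d f g) (n : ℕ) (x : K) :
    x ∈ Om K f g n ↔ aeval x (PT d f g n) = 0 := by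
  rw [aeval_PT]
  constructor
  · rintro ⟨h1, h2⟩
    rw [H.psi_iterate _ x h1, div_eq_iff (nonconst_eval _ x h1 _ (H.itg_ne n))] at h2
    rw [h2, sub_self]
  · intro h
    have h1 : ∀ c, x ≠ algebraMap k K c := by
      rintro c rfl
      have e : ∀ q : k[X], eval₂ (algebraMap k K) (algebraMap k K c) q = algebraMap k K (eval c q) := by
        intro q; rw [eval₂_at_apply]
      rw [e, e] at h
      refine comb_ne_zero (algebraMap k K) (TT k K) (TT_ne K) _ _ ?_ h
      have := itP_no_common_root (RingHom.id k) d f g H.hf H.hg H.cop (Or.inr H.hgd) c n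
      simpa using! this
    refine ⟨h1, ?_⟩
    rw [H.psi_iterate _ x h1, div_eq_iff (nonconst_eval _ x h1 _ (H.itg_ne n))]
    exact sub_eq_zero.mp h

lemma GoodPair.psi_mem (H : GoodPair d f g) (n : ℕ) (x : K) (hx : x ∈ Om K f g (n + 1)) :
    psi (algebraMap k K) f g x ∈ Om K f g n :=
  ⟨H.psi_nonconst _ _ hx.1, by rw [← Function.iterate_succ_apply]; exact hx.2⟩

lemma GoodPair.Om_finite (H : GoodPair d f g) (n : ℕ) : (Om K f g n).Finite := by
  have : Om K f g n = (PT d f g n).rootSet K := by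
    ext x
    rw [H.mem_Om, mem_rootSet]
    simp [(H.PT_irred n).ne_zero]
  rw [this]
  exact rootSet_finite _ _

lemma GoodPair.Om_eq_rootSet (H : GoodPair d f g) (n : ℕ) : Om K f g n = (PT d f g n).rootSet K := by
  ext x
  rw [H.mem_Om, mem_rootSet]
  simp [(H.PT_irred n).ne_zero]

lemma psi_map {L L' : Type*} [Field L] [Field L'] (φ : k →+* L) (σ : L →+* L') (f g : k[X]) (x : L) :
    σ (psi φ f g x) = psi (σ.comp φ) f g (σ x) := by
  rw [psi, psi, map_div₀, hom_eval₂, hom_eval₂]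

lemma GoodPair.splits (H : GoodPair d f g) (N : ℕ) [Normal (RatFunc k) K]
    (hN : (Om K f g N).Nonempty) (n : ℕ) (hn : n ≤ N) :
    ((PT d f g n).map (algebraMap (RatFunc k) K)).Splits := by
  obtain ⟨x, hx⟩ := hN
  have hy : (psi (algebraMap k K) f g)^[N - n] x ∈ Om K f g n := by
    refine ⟨H.psi_iterate_nonconst _ _ hx.1 _, ?_⟩
    rw [← Function.iterate_add_apply, Nat.add_sub_cancel' hn]
    exact hx.2
  rw [H.mem_Om] at hy
  have h1 := minpoly.eq_of_irreducible (H.PT_irred n) hy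
  have h2 := Normal.splits (F := RatFunc k) (K := K) inferInstance ((psi (algebraMap k K) f g)^[N - n] x)
  rw [← h1, Polynomial.map_mul, map_C] at h2
  have hne : PT d f g n * C (PT d f g n).leadingCoeff⁻¹ ≠ 0 :=
    mul_ne_zero (H.PT_irred n).ne_zero (C_ne_zero.mpr (inv_ne_zero (leadingCoeff_ne_zero.mpr (H.PT_irred n).ne_zero)))
  refine h2.of_dvd ?_ (dvd_mul_right _ _)
  rw [← map_C, ← Polynomial.map_mul]
  exact (Polynomial.map_ne_zero_iff (algebraMap (RatFunc k) K).injective).mpr hne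

lemma GoodPair.ncard_Om (H : GoodPair d f g) (N : ℕ) [Normal (RatFunc k) K]
    (hN : (Om K f g N).Nonempty) (n : ℕ) (hn : n ≤ N) : (Om K f g n).ncard = d ^ n := by
  rw [H.Om_eq_rootSet, ← Nat.card_coe_set_eq, Nat.card_eq_fintype_card,
    card_rootSet_eq_natDegree (H.PT_sep n) (H.splits N hN n hn), H.PT_natDegree]

lemma GoodPair.trans (H : GoodPair d f g) [Normal (RatFunc k) K] (n : ℕ)
    (x y : K) (hx : x ∈ Om K f g n) (hy : y ∈ Om K f g n) :
    ∃ s : K ≃ₐ[RatFunc k] K, s x = y := by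
  rw [H.mem_Om] at hx hy
  have h1 := minpoly.eq_of_irreducible (H.PT_irred n) hx
  have h2 := minpoly.eq_of_irreducible (H.PT_irred n) hy
  obtain ⟨s, hs⟩ := isConjRoot_iff_exists_algEquiv.mp (show IsConjRoot (RatFunc k) y x from h2.symm.trans h1)
  exact ⟨s, hs.symm ▸ rfl⟩

lemma GoodPair.fib_le (H : GoodPair d f g) {L : Type*} [Field L] (φ : k →+* L) (z : L)
    (hz : ∀ c, z ≠ φ c) : ({x : L | (∀ c, x ≠ φ c) ∧ psi φ f g x = z}).Finite ∧
    ({x : L | (∀ c, x ≠ φ c) ∧ psi φ f g x = z}).ncard ≤ d := by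
  classical
  have hne : PP φ z f g ≠ 0 := by
    intro h
    have h1 := PP_coeff φ z f g d
    rw [h, coeff_zero] at h1
    exact comb_ne_zero φ z hz (f.coeff d) (g.coeff d) (fun h => H.hgd h.2) h1.symm
  have hsub : {x : L | (∀ c, x ≠ φ c) ∧ psi φ f g x = z} ⊆ ((PP φ z f g).roots.toFinset : Set L) := by
    rintro x ⟨hx1, hx2⟩
    rw [Finset.mem_coe, Multiset.mem_toFinset, mem_roots hne, IsRoot, PP_eval]
    rw [psi, div_eq_iff (nonconst_eval φ x hx1 g H.g_ne)] at hx2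
    rw [hx2, sub_self]
  refine ⟨(Finset.finite_toSet _).subset hsub, ?_⟩
  refine (Set.ncard_le_ncard hsub (Finset.finite_toSet _)).trans ?_
  rw [Set.ncard_coe_finset]
  exact (Multiset.toFinset_card_le _).trans ((card_roots' _).trans (PP_natDegree_le _ _ _ _ _ H.hf H.hg))

lemma GoodPair.fib_eq (H : GoodPair d f g) (N : ℕ) [Normal (RatFunc k) K]
    (hN : (Om K f g N).Nonempty) (n : ℕ) (hn : n + 1 ≤ N) (z : K) (hz : z ∈ Om K f g n) :
    ({x : K | x ∈ Om K f g (n + 1) ∧ psi (algebraMap k K) f g x = z}).ncard = d := by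
  classical
  have hfin := fun n => H.Om_finite (K := K) n
  let A := (hfin (n + 1)).toFinset
  let B := (hfin n).toFinset
  have hA : A.card = d ^ (n + 1) := by
    rw [← Set.ncard_eq_toFinset_card _ (hfin (n+1)), H.ncard_Om N hN _ hn]
  have hB : B.card = d ^ n := by
    rw [← Set.ncard_eq_toFinset_card _ (hfin n), H.ncard_Om N hN _ (by omega)]
  have hsum := Finset.card_eq_sum_card_fiberwise (f := psi (algebraMap k K) f g) (s := A) (t := B) (by
    intro x hx
    simp only [A, B, Set.Finite.coe_toFinset] at hx ⊢
    exact H.psi_mem n x hx)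
  have hset : ∀ w, ((A.filter (fun x => psi (algebraMap k K) f g x = w) : Finset K) : Set K) =
      {x : K | x ∈ Om K f g (n + 1) ∧ psi (algebraMap k K) f g x = w} := by
    intro w; ext x; simp [A]
  have hle : ∀ w ∈ B, (A.filter (fun x => psi (algebraMap k K) f g x = w)).card ≤ d := by
    intro w hw
    have hw' : w ∈ Om K f g n := by simpa [B] using hw
    rw [← Set.ncard_coe_finset, hset]
    refine (Set.ncard_le_ncard ?_ (H.fib_le (algebraMap k K) w hw'.1).1).trans (H.fib_le (algebraMap k K) w hw'.1).2
    rintro x ⟨hx1, hx2⟩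
    exact ⟨hx1.1, hx2⟩
  have heq : ∑ w ∈ B, (A.filter (fun x => psi (algebraMap k K) f g x = w)).card = ∑ w ∈ B, d := by
    rw [← hsum, hA, Finset.sum_const, hB, smul_eq_mul, pow_succ]
  have := (Finset.sum_eq_sum_iff_of_le hle).mp heq z (by simpa [B] using hz)
  rw [← hset, Set.ncard_coe_finset, this]

end Galois
end APP


namespace APP
section Emb

variable {k : Type*} [Field k] [IsAlgClosed k]
variable {d : ℕ} {f g : k[X]}
variable {K : Type*} [Field K] [Algebra k K] [Algebra (RatFunc k) K] [IsScalarTower k (RatFunc k) K]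

lemma ratfunc_emb {L : Type*} [Field L] (φ : k →+* L) (x : L) (hx : ∀ c, x ≠ φ c) :
    ∃ e : RatFunc k →+* L, (∀ c, e (RatFunc.C c) = φ c) ∧ e RatFunc.X = x := by
  have hinj : Function.Injective (eval₂RingHom φ x) := by
    rw [injective_iff_map_eq_zero]
    intro q hq
    by_contra h
    exact nonconst_eval φ x hx q h hq
  refine ⟨RatFunc.liftRingHom (eval₂RingHom φ x)
    (nonZeroDivisors_le_comap_nonZeroDivisors_of_injective _ hinj), ?_, ?_⟩
  · intro c
    rw [← RatFunc.algebraMap_C, RatFunc.liftRingHom_algebraMap]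
    simp
  · rw [← RatFunc.algebraMap_X, RatFunc.liftRingHom_algebraMap]
    simp

lemma ratfunc_ext {L : Type*} [Field L] (e e' : RatFunc k →+* L)
    (h1 : ∀ c, e (RatFunc.C c) = e' (RatFunc.C c)) (h2 : e RatFunc.X = e' RatFunc.X) : e = e' := by
  have h3 : e.comp (algebraMap k[X] (RatFunc k)) = e'.comp (algebraMap k[X] (RatFunc k)) := by
    apply Polynomial.ringHom_ext
    · intro c; simpa using h1 c
    · simpa using h2
  exact IsLocalization.ringHom_ext (nonZeroDivisors k[X]) h3

lemma exists_emb (N : ℕ) [IsSplittingField (RatFunc k) K (PT d f g N)] {L : Type*} [Field L]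
    (φ : k →+* L) (x : L) (hx : ∀ c, x ≠ φ c)
    (hsp : (PP φ x (itP d f g N).1 (itP d f g N).2).Splits) :
    ∃ ι : K →+* L, (∀ c, ι (algebraMap k K c) = φ c) ∧ ι (TT k K) = x := by
  obtain ⟨e, he1, he2⟩ := ratfunc_emb φ x hx
  letI : Algebra (RatFunc k) L := e.toAlgebra
  have h : ((PT d f g N).map (algebraMap (RatFunc k) L)).Splits := by
    rw [PP_map, show (algebraMap (RatFunc k) L) = e from rfl, he2]
    rwa [show e.comp RatFunc.C = φ from RingHom.ext he1]
  let ι := IsSplittingField.lift K (PT d f g N) h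
  refine ⟨ι.toRingHom, ?_, ?_⟩
  · intro c
    rw [IsScalarTower.algebraMap_apply k (RatFunc k) K, RatFunc.algebraMap_eq_C]
    exact (ι.commutes _).trans (he1 c)
  · exact (ι.commutes _).trans he2

lemma subfield_top (N : ℕ) [IsSplittingField (RatFunc k) K (PT d f g N)] (S : Subfield K)
    (h1 : ∀ c, algebraMap k K c ∈ S) (h2 : TT k K ∈ S) (h3 : ∀ x ∈ (PT d f g N).rootSet K, x ∈ S) :
    S = ⊤ := by
  have hk : ∀ x : RatFunc k, algebraMap (RatFunc k) K x ∈ S := by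
    intro x
    have hp : ∀ q : k[X], algebraMap (RatFunc k) K (algebraMap k[X] (RatFunc k) q) ∈ S := by
      intro q
      induction q using Polynomial.induction_on' with
      | add p q hp hq => rw [map_add, map_add]; exact S.add_mem hp hq
      | monomial n a =>
        rw [← C_mul_X_pow_eq_monomial, map_mul, map_mul, map_pow, map_pow]
        refine S.mul_mem ?_ (S.pow_mem ?_ _)
        · rw [RatFunc.algebraMap_C, ← RatFunc.algebraMap_eq_C, ← IsScalarTower.algebraMap_apply]
          exact h1 a
        · rw [RatFunc.algebraMap_X]; exact h2
    rw [← RatFunc.num_div_denom x, map_div₀]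
    exact S.div_mem (hp _) (hp _)
  let A : Subalgebra (RatFunc k) K := { S.toSubsemiring with algebraMap_mem' := hk }
  have hA : A = ⊤ := by
    rw [eq_top_iff, ← IsSplittingField.adjoin_rootSet K (PT d f g N)]
    exact Algebra.adjoin_le h3
  rw [eq_top_iff]
  intro x _
  have : x ∈ A := by rw [hA]; trivial
  exact this

lemma emb_le (N : ℕ) [IsSplittingField (RatFunc k) K (PT d f g N)] {M : Type*} [Field M]
    (H : GoodPair d f g)
    (j h : K →+* M) (hc : ∀ c : k, ∃ c' : k, h (algebraMap k K c) = j (algebraMap k K c'))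
    (hT : h (TT k K) = j (TT k K))
    (hP : ((PT d f g N).map (algebraMap (RatFunc k) K)).map h =
      ((PT d f g N).map (algebraMap (RatFunc k) K)).map j) : h.fieldRange ≤ j.fieldRange := by
  have h1 : (j.fieldRange.comap h) = ⊤ := by
    apply subfield_top (d := d) (f := f) (g := g) N
    · intro c
      obtain ⟨c', hc'⟩ := hc c
      rw [Subfield.mem_comap, hc']
      exact ⟨_, rfl⟩
    · rw [Subfield.mem_comap, hT]; exact ⟨_, rfl⟩
    · intro x hx
      rw [Subfield.mem_comap]
      have hsp := IsSplittingField.splits K (PT d f g N)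
      have hx' : ((PT d f g N).map (algebraMap (RatFunc k) K)).eval x = 0 := by
        have := (mem_rootSet.mp hx).2
        rwa [aeval_def, ← eval_map] at this
      have h2 : (((PT d f g N).map (algebraMap (RatFunc k) K)).map j).eval (h x) = 0 := by
        rw [← hP, eval_map, eval₂_at_apply, hx', map_zero]
      have hne : ((PT d f g N).map (algebraMap (RatFunc k) K)).map j ≠ 0 := by
        rw [Polynomial.map_ne_zero_iff j.injective,
          Polynomial.map_ne_zero_iff (algebraMap (RatFunc k) K).injective]
        exact (H.PT_irred N).ne_zero
      have h3 : h x ∈ (((PT d f g N).map (algebraMap (RatFunc k) K)).map j).roots :=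
        (mem_roots hne).mpr h2
      rw [hsp.roots_map, Multiset.mem_map] at h3
      obtain ⟨r, _, hr⟩ := h3
      exact ⟨r, hr⟩
  rintro _ ⟨x, rfl⟩
  have : x ∈ (j.fieldRange.comap h) := by rw [h1]; trivial
  exact this

lemma emb_factor (N : ℕ) [IsSplittingField (RatFunc k) K (PT d f g N)] {M : Type*} [Field M]
    (H : GoodPair d f g)
    (j h : K →+* M) (hc : ∀ c : k, ∃ c' : k, h (algebraMap k K c) = j (algebraMap k K c'))
    (hc' : ∀ c : k, ∃ c' : k, j (algebraMap k K c) = h (algebraMap k K c'))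
    (hT : h (TT k K) = j (TT k K))
    (hP : ((PT d f g N).map (algebraMap (RatFunc k) K)).map h =
      ((PT d f g N).map (algebraMap (RatFunc k) K)).map j) : ∃ y : K ≃+* K, ∀ x, j (y x) = h x := by
  have h1 := emb_le N H j h hc hT hP
  have h2 := emb_le N H h j hc' hT.symm hP.symm
  have e1 : ∀ x, ∃ y, j y = h x := fun x => h1 ⟨x, rfl⟩
  have e2 : ∀ x, ∃ y, h y = j x := fun x => h2 ⟨x, rfl⟩
  choose y hy using e1
  choose z hz using e2
  refine ⟨{ toFun := y, invFun := z, left_inv := ?_, right_inv := ?_, map_mul' := ?_, map_add' := ?_ }, hy⟩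
  · intro x; apply h.injective; rw [hz, hy]
  · intro x; apply j.injective; rw [hy, hz]
  · intro a b; apply j.injective; rw [hy, map_mul, map_mul, hy, hy]
  · intro a b; apply j.injective; rw [hy, map_add, map_add, hy, hy]

/-- reduction condition, constants vs. coefficient maps -/
lemma PTmap_eq (N : ℕ) {M : Type*} [Field M]
    (j h : K →+* M) (hf : f.map (h.comp (algebraMap k K)) = f.map (j.comp (algebraMap k K)))
    (hg : g.map (h.comp (algebraMap k K)) = g.map (j.comp (algebraMap k K)))
    (hT : h (TT k K) = j (TT k K)) :
    ((PT d f g N).map (algebraMap (RatFunc k) K)).map h =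
      ((PT d f g N).map (algebraMap (RatFunc k) K)).map j := by
  rw [PP_map, PP_map, PP_map, hT, ← RatFunc.algebraMap_eq_C, ← IsScalarTower.algebraMap_eq k (RatFunc k) K]
  have e1 := itP_map d f g (h.comp (algebraMap k K)) N
  have e2 := itP_map d f g (j.comp (algebraMap k K)) N
  rw [hf, hg, e2] at e1
  rw [Prod.mk.injEq] at e1
  rw [PP, PP, e1.1, e1.2]

lemma algEquiv_of (y : K ≃+* K) (h1 : ∀ c, y (algebraMap k K c) = algebraMap k K c)
    (h2 : y (TT k K) = TT k K) : ∃ s : K ≃ₐ[RatFunc k] K, ∀ x, s x = y x := by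
  have : (y : K →+* K).comp (algebraMap (RatFunc k) K) = algebraMap (RatFunc k) K := by
    apply ratfunc_ext
    · intro c
      have := h1 c
      rw [IsScalarTower.algebraMap_apply k (RatFunc k) K, RatFunc.algebraMap_eq_C] at this
      exact this
    · exact h2
  exact ⟨AlgEquiv.ofRingEquiv (f := y) (fun r => congrArg (fun e => e r) this), fun x => rfl⟩

end Emb

section Ser
variable {k : Type*} [Field k] [IsAlgClosed k]

/-- the base hom -/
noncomputable abbrev cL (k : Type*) [Field k] : k →+* FractionRing (PowerSeries k) :=
  (algebraMap (PowerSeries k) (FractionRing (PowerSeries k))).comp PowerSeries.C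

lemma ser_nonconst (s : PowerSeries k) (m : ℕ) (hm : 0 < m) (hs : PowerSeries.coeff m s ≠ 0) (c : k) :
    algebraMap (PowerSeries k) (FractionRing (PowerSeries k)) s ≠ cL k c := by
  intro h
  have : s = PowerSeries.C c := IsFractionRing.injective (PowerSeries k) (FractionRing (PowerSeries k)) h
  rw [this, PowerSeries.coeff_C, if_neg (by omega)] at hs
  exact hs rfl

lemma PP_ser_const (s : PowerSeries k) (a b : k[X]) :
    (PP (PowerSeries.C : k →+* PowerSeries k) s a b).map PowerSeries.constantCoeff =
      PP (RingHom.id k) (PowerSeries.constantCoeff s) a b := by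
  rw [PP_map]; congr 1

/-- separable reduction of full degree: all roots are power series -/
lemma ser_splits (s : PowerSeries k) (a b : k[X]) (E : ℕ) (ha : a.natDegree ≤ E) (hb : b.natDegree ≤ E)
    (hdeg : (PP (RingHom.id k) (PowerSeries.constantCoeff s) a b).natDegree = E)
    (hne : PP (RingHom.id k) (PowerSeries.constantCoeff s) a b ≠ 0)
    (hsep : (PP (RingHom.id k) (PowerSeries.constantCoeff s) a b).Separable) :
    (PP (cL k) (algebraMap _ _ s) a b).Splits ∧ ∀ x, (PP (cL k) (algebraMap _ _ s) a b).eval x = 0 →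
      ∃ r : PowerSeries k, algebraMap _ _ r = x ∧
        (PP (PowerSeries.C : k →+* PowerSeries k) s a b).eval r = 0 := by
  classical
  set P0 := PP (RingHom.id k) (PowerSeries.constantCoeff s) a b with hP0
  set P := PP (PowerSeries.C : k →+* PowerSeries k) s a b with hP
  have hmap : P.map PowerSeries.constantCoeff = P0 := PP_ser_const s a b
  have hlift : ∀ c ∈ P0.roots.toFinset, ∃ x : PowerSeries k, PowerSeries.constantCoeff x = c ∧ P.eval x = 0 := by
    intro c hc
    have hc0 : P0.eval c = 0 := by
      rw [Multiset.mem_toFinset, mem_roots hne] at hc; exact hc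
    apply hensel_exists P c
    · rw [hmap]; exact hc0
    · rw [hmap]
      have := hsep.eval₂_derivative_ne_zero (RingHom.id k) (x := c) (by simpa [eval₂_id] using! hc0)
      simpa using! this
  choose! r hr using hlift
  have hcard : P0.roots.toFinset.card = E := by
    rw [Multiset.toFinset_card_of_nodup (nodup_roots hsep), ← hdeg]
    exact (splits_iff_card_roots.mp (IsAlgClosed.splits P0))
  set Λ := FractionRing (PowerSeries k)
  have hmapΛ : P.map (algebraMap (PowerSeries k) Λ) = PP (cL k) (algebraMap _ _ s) a b := by
    rw [hP, PP_map]
  set PΛ := PP (cL k) (algebraMap _ Λ s) a b with hPΛ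
  have hPne : PΛ ≠ 0 := by
    rw [← hmapΛ, Polynomial.map_ne_zero_iff (IsFractionRing.injective _ _)]
    intro h; rw [h, Polynomial.map_zero] at hmap; exact hne hmap.symm
  have hle : PΛ.natDegree ≤ E := PP_natDegree_le _ _ _ _ _ ha hb
  let I : Finset Λ := P0.roots.toFinset.image (fun c => algebraMap _ Λ (r c))
  have hI : I.card = E := by
    rw [Finset.card_image_of_injOn, hcard]
    intro c hc c' hc' h
    have := IsFractionRing.injective (PowerSeries k) Λ h
    rw [← (hr c hc).1, ← (hr c' hc').1]
    exact congrArg _ this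
  have hsub : I.val ≤ PΛ.roots := by
    rw [Multiset.le_iff_subset I.nodup]
    intro x hx
    obtain ⟨c, hc, rfl⟩ := Finset.mem_image.mp hx
    rw [mem_roots hPne, IsRoot, ← hmapΛ, eval_map, eval₂_at_apply, (hr c hc).2, map_zero]
  have hc1 : E ≤ PΛ.roots.card := by rw [← hI]; exact Multiset.card_le_card hsub
  have hc2 := card_roots' PΛ
  have heq : I.val = PΛ.roots := Multiset.eq_of_le_of_card_le hsub (by
    rw [show I.val.card = E from hI]; omega)
  refine ⟨splits_iff_card_roots.mpr (by omega), ?_⟩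
  intro x hx
  have : x ∈ PΛ.roots := (mem_roots hPne).mpr hx
  rw [← heq] at this
  obtain ⟨c, hc, rfl⟩ := Finset.mem_image.mp (show x ∈ I from this)
  exact ⟨r c, rfl, (hr c hc).2⟩

end Ser
end APP


namespace APP
section Swap
variable {k : Type*} [Field k] [IsAlgClosed k]

/-- `v ↦ -v` -/
noncomputable def wS (k : Type*) [Field k] : PowerSeries k ≃+* PowerSeries k :=
  RingEquiv.ofRingHom (PowerSeries.rescale (-1)) (PowerSeries.rescale (-1))
    (by ext f n; simp [PowerSeries.coeff_rescale, ← mul_assoc, ← mul_pow])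
    (by ext f n; simp [PowerSeries.coeff_rescale, ← mul_assoc, ← mul_pow])

lemma wS_coeff (s : PowerSeries k) (n : ℕ) : PowerSeries.coeff n (wS k s) = (-1) ^ n * PowerSeries.coeff n s :=
  PowerSeries.coeff_rescale _ _ _

lemma wS_const (s : PowerSeries k) : PowerSeries.constantCoeff (wS k s) = PowerSeries.constantCoeff s := by
  rw [← PowerSeries.coeff_zero_eq_constantCoeff_apply, wS_coeff]; simp

lemma wS_C (c : k) : wS k (PowerSeries.C c) = PowerSeries.C c := by
  ext n; rw [wS_coeff, PowerSeries.coeff_C]; split_ifs with h <;> simp [h]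

lemma wS_X : wS k PowerSeries.X = - PowerSeries.X := PowerSeries.rescale_neg_one_X

lemma wS_wS (s : PowerSeries k) : wS k (wS k s) = s := by
  ext n; rw [wS_coeff, wS_coeff, ← mul_assoc, ← mul_pow]; simp

lemma exists_wbar : ∃ w : AlgebraicClosure (FractionRing (PowerSeries k)) ≃+*
    AlgebraicClosure (FractionRing (PowerSeries k)),
    ∀ r : PowerSeries k, w (algebraMap (FractionRing (PowerSeries k)) _ (algebraMap _ _ r)) =
      algebraMap (FractionRing (PowerSeries k)) _ (algebraMap _ _ (wS k r)) := by
  refine ⟨IsAlgClosure.equivOfEquiv _ _ (IsFractionRing.ringEquivOfRingEquiv (K := FractionRing (PowerSeries k))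
    (L := FractionRing (PowerSeries k)) (wS k)), ?_⟩
  intro r
  rw [IsAlgClosure.equivOfEquiv_algebraMap, IsFractionRing.ringEquivOfRingEquiv_algebraMap]

lemma PP_eval_wS (t0 : k) (a b : k[X]) (r : PowerSeries k)
    (hr : (PP (PowerSeries.C : k →+* PowerSeries k) (PowerSeries.C t0 + PowerSeries.X ^ 2) a b).eval r = 0) :
    (PP (PowerSeries.C : k →+* PowerSeries k) (PowerSeries.C t0 + PowerSeries.X ^ 2) a b).eval (wS k r) = 0 := by
  have h := congrArg (wS k) hr
  rw [map_zero, PP_eval, map_sub, map_mul, map_add, map_pow, wS_C, wS_X, neg_sq] at h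
  rw [PP_eval]
  have e : (wS k : PowerSeries k →+* PowerSeries k).comp PowerSeries.C = PowerSeries.C := by
    ext1 c; exact wS_C c
  have e2 : ∀ q : k[X], wS k (eval₂ PowerSeries.C r q) = eval₂ PowerSeries.C (wS k r) q := by
    intro q
    have := hom_eval₂ q PowerSeries.C (wS k : PowerSeries k →+* PowerSeries k) r
    rw [e] at this
    exact this
  rwa [e2, e2] at h

lemma ser_double (h2 : (2 : k) ≠ 0) (t0 c : k) (a b : k[X]) (E : ℕ) (ha : a.natDegree ≤ E)
    (hb : b.natDegree ≤ E) (V : k[X]) (hV : PP (RingHom.id k) t0 a b = (X - C c) ^ 2 * V)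
    (hdeg : (PP (RingHom.id k) t0 a b).natDegree = E) (hne : V ≠ 0) (hsep : V.Separable)
    (hVc : V.eval c ≠ 0) (hbc : b.eval c ≠ 0) :
    ∃ r₁ r₂ : PowerSeries k, r₁ ≠ r₂ ∧ wS k r₁ = r₂ ∧ wS k r₂ = r₁ ∧
      (PP (PowerSeries.C : k →+* PowerSeries k) (PowerSeries.C t0 + PowerSeries.X ^ 2) a b).eval r₁ = 0 ∧
      (PP (PowerSeries.C : k →+* PowerSeries k) (PowerSeries.C t0 + PowerSeries.X ^ 2) a b).eval r₂ = 0 ∧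
      ∀ (M : Type _) [Field M] (e : PowerSeries k →+* M) (he : Function.Injective e) (x : M),
        (PP (e.comp PowerSeries.C) (e (PowerSeries.C t0 + PowerSeries.X ^ 2)) a b).eval x = 0 →
        x = e r₁ ∨ x = e r₂ ∨ ∃ r, x = e r ∧ wS k r = r := by
  classical
  set s : PowerSeries k := PowerSeries.C t0 + PowerSeries.X ^ 2 with hs
  have hs0 : PowerSeries.constantCoeff s = t0 := by simp [hs]
  set P := PP (PowerSeries.C : k →+* PowerSeries k) s a b with hP
  have hmap : P.map PowerSeries.constantCoeff = (X - C c) ^ 2 * V := by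
    rw [hP, PP_ser_const s a b, hs0, hV]
  -- simple roots
  have hlift : ∀ u ∈ V.roots.toFinset, ∃ x : PowerSeries k, PowerSeries.constantCoeff x = u ∧
      P.eval x = 0 ∧ wS k x = x := by
    intro u hu
    have hu0 : V.eval u = 0 := by
      rw [Multiset.mem_toFinset, mem_roots hne] at hu; exact hu
    have hd : (derivative (P.map PowerSeries.constantCoeff)).eval u ≠ 0 := by
      rw [hmap, derivative_mul, eval_add, eval_mul, eval_mul, hu0, mul_zero, zero_add]
      have h3 := hsep.eval₂_derivative_ne_zero (RingHom.id k) (x := u) (by simpa [eval₂_id] using! hu0)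
      refine mul_ne_zero ?_ (by simpa using! h3)
      rw [eval_pow]
      apply pow_ne_zero
      rw [eval_sub, eval_X, eval_C, sub_ne_zero]
      rintro rfl
      exact hVc hu0
    obtain ⟨x, hx1, hx2⟩ := hensel_exists P u (by rw [hmap, eval_mul, hu0, mul_zero]) hd
    refine ⟨x, hx1, hx2, ?_⟩
    apply hensel_unique P _ _ (PP_eval_wS t0 a b x hx2) hx2 (wS_const x)
    rw [wS_const, hx1]; exact hd
  choose! r hr using hlift
  -- double root
  let sub : (PowerSeries k)[X] := C (PowerSeries.C c) + C PowerSeries.X * X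
  let R : (PowerSeries k)[X] := X ^ 2 * (V.map PowerSeries.C).comp sub - (b.map PowerSeries.C).comp sub
  have hRmap : R.map PowerSeries.constantCoeff = X ^ 2 * C (V.eval c) - C (b.eval c) := by
    have e : ∀ q : k[X], ((q.map PowerSeries.C).comp sub).map PowerSeries.constantCoeff = C (q.eval c) := by
      intro q
      rw [Polynomial.map_comp, Polynomial.map_map]
      have : (PowerSeries.constantCoeff (R := k)).comp PowerSeries.C = RingHom.id k := by ext; simp
      rw [this, Polynomial.map_id]
      simp [sub]
    simp only [R, Polynomial.map_sub, Polynomial.map_mul, e, Polynomial.map_pow, map_X]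
  obtain ⟨β, hβ⟩ := IsAlgClosed.exists_pow_nat_eq (b.eval c / V.eval c) (n := 2) (by norm_num)
  have hβ0 : β ≠ 0 := by
    rintro rfl
    rw [zero_pow (by norm_num), eq_comm, div_eq_zero_iff] at hβ
    tauto
  obtain ⟨z, hz1, hz2⟩ := hensel_exists R β
    (by rw [hRmap]; simp [hβ]; field_simp; ring) (by rw [hRmap]; simp [hVc, hβ0]; rw [one_add_one_eq_two]; exact h2)
  have hkey : ∀ z : PowerSeries k, P.eval (PowerSeries.C c + PowerSeries.X * z) =
      PowerSeries.X ^ 2 * R.eval z := by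
    intro z
    have h5 : ∀ q : k[X], eval₂ PowerSeries.C (PowerSeries.C c + PowerSeries.X * z) q =
        ((q.map PowerSeries.C).comp sub).eval z := by
      intro q
      rw [eval_comp, eval_map]; simp [sub]
    have h6 := congrArg (fun q => eval₂ (PowerSeries.C : k →+* PowerSeries k)
      (PowerSeries.C c + PowerSeries.X * z) q) hV
    simp only [PP, Polynomial.map_id, eval₂_sub, eval₂_mul, eval₂_C, eval₂_pow, eval₂_X] at h6
    rw [hP, PP_eval, hs]
    simp only [R, eval_sub, eval_mul, eval_pow, eval_X, ← h5]
    linear_combination h6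
  set r₁ : PowerSeries k := PowerSeries.C c + PowerSeries.X * z with hr₁
  have hr₁0 : P.eval r₁ = 0 := by rw [hkey, hz2, mul_zero]
  have hr₂0 := PP_eval_wS t0 a b r₁ hr₁0
  have hne12 : r₁ ≠ wS k r₁ := by
    intro h
    rw [hr₁, map_add, map_mul, wS_C, wS_X, neg_mul] at h
    have h7 : PowerSeries.X * z = PowerSeries.X * (- wS k z) := by
      linear_combination h
    have h8 := congrArg PowerSeries.constantCoeff (mul_left_cancel₀ PowerSeries.X_ne_zero h7)
    rw [map_neg, wS_const, hz1] at h8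
    apply hβ0
    have : 2 * β = 0 := by linear_combination h8
    exact (mul_eq_zero.mp this).resolve_left h2
  refine ⟨r₁, wS k r₁, hne12, rfl, wS_wS r₁, hr₁0, hr₂0, ?_⟩
  intro M _ e he x hx
  have hc₁ : PowerSeries.constantCoeff r₁ = c := by simp [hr₁]
  have hmapM : P.map e = PP (e.comp PowerSeries.C) (e s) a b := by rw [hP, PP_map]
  set PM := PP (e.comp PowerSeries.C) (e s) a b with hPM
  have hPne : PM ≠ 0 := by
    rw [← hmapM, Polynomial.map_ne_zero_iff he]
    intro h; rw [h, Polynomial.map_zero] at hmap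
    exact mul_ne_zero (pow_ne_zero 2 (X_sub_C_ne_zero c)) hne hmap.symm
  have hle : PM.natDegree ≤ E := PP_natDegree_le _ _ _ _ _ ha hb
  have hcard : V.roots.toFinset.card + 2 = E := by
    rw [Multiset.toFinset_card_of_nodup (nodup_roots hsep),
      (splits_iff_card_roots.mp (IsAlgClosed.splits V)), ← hdeg, hV,
      natDegree_mul (pow_ne_zero 2 (X_sub_C_ne_zero c)) hne]
    simp [add_comm]
  let I0 : Finset M := V.roots.toFinset.image (fun u => e (r u))
  let I : Finset M := insert (e r₁) (insert (e (wS k r₁)) I0)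
  have hcI : ∀ v : PowerSeries k, PowerSeries.constantCoeff v = c → e v ∉ I0 := by
    intro v hv hmem
    obtain ⟨u, hu, huv⟩ := Finset.mem_image.mp hmem
    have := he huv
    have hu2 := (hr u hu).1
    rw [this, hv] at hu2
    rw [← hu2, Multiset.mem_toFinset, mem_roots hne] at hu
    exact hVc hu
  have hI : I.card = E := by
    rw [Finset.card_insert_of_notMem, Finset.card_insert_of_notMem, Finset.card_image_of_injOn, ← hcard]
    · intro u hu u' hu' h
      rw [← (hr u hu).1, ← (hr u' hu').1]
      exact congrArg _ (he h)
    · exact hcI _ (by rw [wS_const, hc₁])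
    · rw [Finset.mem_insert, not_or]
      exact ⟨fun h => hne12 (he h), hcI _ hc₁⟩
  have hrt : ∀ v, P.eval v = 0 → e v ∈ PM.roots := by
    intro v hv
    rw [mem_roots hPne, IsRoot, ← hmapM, eval_map, eval₂_at_apply, hv, map_zero]
  have hsub : I.val ≤ PM.roots := by
    rw [Multiset.le_iff_subset I.nodup]
    intro x hx
    rcases Finset.mem_insert.mp (show x ∈ I from hx) with rfl | hx
    · exact hrt _ hr₁0
    rcases Finset.mem_insert.mp hx with rfl | hx
    · exact hrt _ hr₂0
    obtain ⟨u, hu, rfl⟩ := Finset.mem_image.mp hx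
    exact hrt _ (hr u hu).2.1
  have hc2 := card_roots' PM
  have heq : I.val = PM.roots := Multiset.eq_of_le_of_card_le hsub (by
    rw [show I.val.card = E from hI]; omega)
  have hxm : x ∈ PM.roots := (mem_roots hPne).mpr hx
  rw [← heq] at hxm
  rcases Finset.mem_insert.mp (show x ∈ I from hxm) with rfl | hx
  · exact Or.inl rfl
  rcases Finset.mem_insert.mp hx with rfl | hx
  · exact Or.inr (Or.inl rfl)
  obtain ⟨u, hu, rfl⟩ := Finset.mem_image.mp hx
  exact Or.inr (Or.inr ⟨r u, rfl, (hr u hu).2.2⟩)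

variable {d : ℕ} {f g : k[X]}
variable {K : Type*} [Field K] [Algebra k K] [Algebra (RatFunc k) K] [IsScalarTower k (RatFunc k) K]

/-- a simple-ramification witness at level `i` -/
def SwapData (d : ℕ) (f g : k[X]) (i : ℕ) : Prop :=
  ∃ (t0 c : k) (V : k[X]), PP (RingHom.id k) t0 (itP d f g i).1 (itP d f g i).2 = (X - C c) ^ 2 * V ∧
    (PP (RingHom.id k) t0 (itP d f g i).1 (itP d f g i).2).natDegree = d ^ i ∧ V.Separable ∧ V.eval c ≠ 0

lemma GoodPair.Om_emb (H : GoodPair d f g) (N : ℕ) [IsSplittingField (RatFunc k) K (PT d f g N)]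
    (i : ℕ) (hi : i ≤ N) (hN : (Om K f g N).Nonempty) {M : Type*} [Field M] (j : K →+* M) (x : M)
    (hx : (PP (j.comp (algebraMap k K)) (j (TT k K)) (itP d f g i).1 (itP d f g i).2).eval x = 0) :
    ∃ y ∈ Om K f g i, j y = x := by
  haveI : Normal (RatFunc k) K := Normal.of_isSplittingField (PT d f g N)
  have hsp := H.splits N hN i hi
  have e : ((PT d f g i).map (algebraMap (RatFunc k) K)).map j =
      PP (j.comp (algebraMap k K)) (j (TT k K)) (itP d f g i).1 (itP d f g i).2 := by
    rw [PP_map, PP_map, ← RatFunc.algebraMap_eq_C, ← IsScalarTower.algebraMap_eq k (RatFunc k) K]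
  have hne : ((PT d f g i).map (algebraMap (RatFunc k) K)).map j ≠ 0 := by
    rw [Polynomial.map_ne_zero_iff j.injective,
      Polynomial.map_ne_zero_iff (algebraMap (RatFunc k) K).injective]
    exact (H.PT_irred i).ne_zero
  rw [← e] at hx
  have h3 := (mem_roots hne).mpr hx
  rw [hsp.roots_map, Multiset.mem_map] at h3
  obtain ⟨r, hr, rfl⟩ := h3
  refine ⟨r, ?_, rfl⟩
  rw [H.mem_Om, aeval_def, ← eval_map]
  exact (mem_roots'.mp hr).2

lemma GoodPair.Om_root (H : GoodPair d f g) (i : ℕ) {M : Type*} [Field M] (j : K →+* M) (x : K)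
    (hx : x ∈ Om K f g i) :
    (PP (j.comp (algebraMap k K)) (j (TT k K)) (itP d f g i).1 (itP d f g i).2).eval (j x) = 0 := by
  rw [H.mem_Om, aeval_PT] at hx
  rw [PP_eval, ← hom_eval₂, ← hom_eval₂, ← map_mul, ← map_sub, hx, map_zero]

lemma GoodPair.Om_nonempty (H : GoodPair d f g) (N : ℕ) [IsSplittingField (RatFunc k) K (PT d f g N)] :
    (Om K f g N).Nonempty := by
  have hsp := IsSplittingField.splits K (PT d f g N)
  have : ((PT d f g N).map (algebraMap (RatFunc k) K)).degree ≠ 0 := by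
    rw [degree_map, degree_eq_natDegree (H.PT_irred N).ne_zero, H.PT_natDegree]
    have := H.hd
    have : 0 < d ^ N := by positivity
    exact_mod_cast this.ne'
  obtain ⟨x, hx⟩ := hsp.exists_eval_eq_zero this
  refine ⟨x, ?_⟩
  rw [H.mem_Om, aeval_def, ← eval_map]; exact hx

lemma GoodPair.swap_one (H : GoodPair d f g) (N : ℕ) [IsSplittingField (RatFunc k) K (PT d f g N)]
    (h2 : (2 : k) ≠ 0) (i : ℕ) (hi : i ≤ N) (hS : SwapData d f g i) :
    ∃ x₁ ∈ Om K f g i, ∃ x₂ ∈ Om K f g i, x₁ ≠ x₂ ∧ ∃ s : K ≃ₐ[RatFunc k] K, s x₁ = x₂ ∧ s x₂ = x₁ ∧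
      ∀ x ∈ Om K f g i, x ≠ x₁ → x ≠ x₂ → s x = x := by
  have hN := H.Om_nonempty (K := K) N
  have hd := H.hd
  obtain ⟨t0, c, V, hV, hdeg, hsep, hVc⟩ := hS
  obtain ⟨ha, hb⟩ := natDegree_itP_le d f g i (by omega)
  have hbc : (itP d f g i).2.eval c ≠ 0 := by
    intro h0
    have h1 := congrArg (eval c) hV
    rw [PP_eval, ← eval_map, ← eval_map, Polynomial.map_id, Polynomial.map_id, h0] at h1
    simp at h1
    apply itP_no_common_root (RingHom.id k) d f g H.hf H.hg H.cop (Or.inr H.hgd) c i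
    simpa using! ⟨h1, h0⟩
  have hVne : V ≠ 0 := by rintro rfl; simp at hVc
  obtain ⟨r₁, r₂, hne, hw1, hw2, hr1, hr2, hall⟩ :=
    ser_double h2 t0 c _ _ (d ^ i) ha hb V hV hdeg hVne hsep hVc hbc
  set s : PowerSeries k := PowerSeries.C t0 + PowerSeries.X ^ 2 with hs
  let M := AlgebraicClosure (FractionRing (PowerSeries k))
  let e : PowerSeries k →+* M := (algebraMap (FractionRing (PowerSeries k)) M).comp (algebraMap _ _)
  have he : Function.Injective e :=
    (algebraMap (FractionRing (PowerSeries k)) M).injective.comp (IsFractionRing.injective _ _)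
  obtain ⟨w, hw⟩ := exists_wbar (k := k)
  have hw : ∀ r, w (e r) = e (wS k r) := hw
  have hsn : ∀ c, e s ≠ (e.comp PowerSeries.C) c := by
    intro c h
    have := he h
    have h1 := congrArg (PowerSeries.coeff 2) this
    rw [hs, map_add, PowerSeries.coeff_C, PowerSeries.coeff_X_pow] at h1
    change _ = PowerSeries.coeff 2 (PowerSeries.C c) at h1
    rw [PowerSeries.coeff_C] at h1
    simp at h1
  obtain ⟨j, hj1, hj2⟩ := exists_emb (K := K) (d := d) (f := f) (g := g) N (e.comp PowerSeries.C) (e s) hsn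
    (IsAlgClosed.splits _)
  let h : K →+* M := (w : M →+* M).comp j
  have hjc : j.comp (algebraMap k K) = e.comp PowerSeries.C := RingHom.ext hj1
  have hhc : ∀ c, h (algebraMap k K c) = j (algebraMap k K c) := by
    intro c
    change w (j (algebraMap k K c)) = _
    rw [hj1]
    change w (e (PowerSeries.C c)) = e (PowerSeries.C c)
    rw [hw, wS_C]
  have hhT : h (TT k K) = j (TT k K) := by
    change w (j (TT k K)) = _
    rw [hj2, hw, hs, map_add, map_pow, wS_C, wS_X, neg_sq]
  have hcomp : h.comp (algebraMap k K) = j.comp (algebraMap k K) := RingHom.ext hhc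
  obtain ⟨y, hy⟩ := emb_factor N H j h (fun c => ⟨c, hhc c⟩) (fun c => ⟨c, (hhc c).symm⟩) hhT
    (PTmap_eq N j h (by rw [hcomp]) (by rw [hcomp]) hhT)
  have hy' : ∀ x, j (y x) = w (j x) := hy
  obtain ⟨σ, hσ⟩ := algEquiv_of (k := k) y (fun c => j.injective (by rw [hy, hhc])) (j.injective (by rw [hy, hhT]))
  have hrt : ∀ r, (PP (PowerSeries.C : k →+* PowerSeries k) s (itP d f g i).1 (itP d f g i).2).eval r = 0 →
      (PP (j.comp (algebraMap k K)) (j (TT k K)) (itP d f g i).1 (itP d f g i).2).eval (e r) = 0 := by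
    intro r hr
    rw [hjc, hj2, ← PP_map, eval_map, eval₂_at_apply, hr, map_zero]
  obtain ⟨x₁, hx1, hjx1⟩ := H.Om_emb N i hi hN j (e r₁) (hrt _ hr1)
  obtain ⟨x₂, hx2, hjx2⟩ := H.Om_emb N i hi hN j (e r₂) (hrt _ hr2)
  refine ⟨x₁, hx1, x₂, hx2, ?_, σ, ?_, ?_, ?_⟩
  · rintro rfl; exact hne (he (hjx1.symm.trans hjx2))
  · apply j.injective; rw [hσ, hy', hjx1, hjx2, hw, hw1]
  · apply j.injective; rw [hσ, hy', hjx1, hjx2, hw, hw2]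
  · intro x hx h1 h2
    have hx0 := H.Om_root i j x hx
    rw [hjc, hj2] at hx0
    rcases hall M e he (j x) hx0 with h3 | h3 | ⟨r, h3, h4⟩
    · exact absurd (j.injective (h3.trans hjx1.symm)) h1
    · exact absurd (j.injective (h3.trans hjx2.symm)) h2
    · apply j.injective; rw [hσ, hy', h3, hw, h4]

lemma Om_smul (n : ℕ) (s : K ≃ₐ[RatFunc k] K) (x : K) (hx : x ∈ Om K f g n) : s x ∈ Om K f g n := by
  have hc : ∀ c, s (algebraMap k K c) = algebraMap k K c := by
    intro c
    rw [IsScalarTower.algebraMap_apply k (RatFunc k) K, s.commutes]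
  have hcc : (s : K →+* K).comp (algebraMap k K) = algebraMap k K := RingHom.ext hc
  have hp : ∀ (n : ℕ) x, s ((psi (algebraMap k K) f g)^[n] x) = (psi (algebraMap k K) f g)^[n] (s x) := by
    intro n
    induction n with
    | zero => intro x; rfl
    | succ n ih =>
      intro x
      rw [Function.iterate_succ_apply, ih, Function.iterate_succ_apply]
      congr 1
      have := psi_map (algebraMap k K) (s : K →+* K) f g x
      rw [hcc] at this
      exact this
  refine ⟨?_, ?_⟩
  · intro c hcx
    apply hx.1 c
    apply s.injective
    rw [hc, hcx]
  · rw [← hp, hx.2, s.commutes]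

lemma psi_smul (s : K ≃ₐ[RatFunc k] K) (x : K) :
    s (psi (algebraMap k K) f g x) = psi (algebraMap k K) f g (s x) := by
  have hc : ∀ c, s (algebraMap k K c) = algebraMap k K c := by
    intro c
    rw [IsScalarTower.algebraMap_apply k (RatFunc k) K, s.commutes]
  have hcc : (s : K →+* K).comp (algebraMap k K) = algebraMap k K := RingHom.ext hc
  have := psi_map (algebraMap k K) (s : K →+* K) f g x
  rw [hcc] at this
  exact this

lemma GoodPair.swap_all (H : GoodPair d f g) (N : ℕ) [IsSplittingField (RatFunc k) K (PT d f g N)]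
    (h2 : (2 : k) ≠ 0) (i : ℕ) (hi : i + 1 ≤ N) (hS : SwapData d f g (i + 1)) (x : K)
    (hx : x ∈ Om K f g (i + 1)) :
    ∃ x' ∈ Om K f g (i + 1), x' ≠ x ∧ psi (algebraMap k K) f g x' = psi (algebraMap k K) f g x ∧
      ∃ s : K ≃ₐ[RatFunc k] K, s x = x' ∧ s x' = x ∧
      ∀ z ∈ Om K f g (i + 1), z ≠ x → z ≠ x' → s z = z := by
  haveI : Normal (RatFunc k) K := Normal.of_isSplittingField (PT d f g N)
  have hN := H.Om_nonempty (K := K) N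
  obtain ⟨x₁, hx1, x₂, hx2, hne, s, hs1, hs2, hs3⟩ := H.swap_one (K := K) N h2 (i+1) hi hS
  have hsib : psi (algebraMap k K) f g x₂ = psi (algebraMap k K) f g x₁ := by
    by_contra hcon
    have hc := H.fib_eq N hN i hi _ (H.psi_mem i x₁ hx1)
    have h2' : 1 < ({x : K | x ∈ Om K f g (i + 1) ∧ psi (algebraMap k K) f g x =
      psi (algebraMap k K) f g x₁}).ncard := by rw [hc]; have := H.hd; omega
    obtain ⟨u, hu, hu1⟩ := Set.exists_ne_of_one_lt_ncard h2' x₁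
    have hu2 : u ≠ x₂ := by rintro rfl; exact hcon hu.2
    have h5 := hs3 u hu.1 hu1 hu2
    have h6 := psi_smul (f := f) (g := g) s u
    rw [h5, hu.2, psi_smul, hs1] at h6
    exact hcon h6
  obtain ⟨σ, hσ⟩ := H.trans (i+1) x₁ x hx1 hx
  refine ⟨σ x₂, Om_smul _ _ _ hx2, ?_, ?_, (σ.symm.trans s).trans σ, ?_, ?_, ?_⟩
  · rw [← hσ]; exact fun h => hne (σ.injective h).symm
  · rw [← hσ, ← psi_smul, ← psi_smul, hsib]
  · rw [← hσ]; simp [hs1]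
  · rw [← hσ]; simp [hs2]
  · intro z hz h1 h3
    simp only [AlgEquiv.trans_apply]
    rw [hs3 (σ.symm z) (Om_smul _ _ _ hz), AlgEquiv.apply_symm_apply]
    · intro h; apply h1; rw [← hσ, ← h, AlgEquiv.apply_symm_apply]
    · intro h; apply h3; rw [← h, AlgEquiv.apply_symm_apply]

end Swap
end APP


namespace APP
section Cnt
variable {k : Type*} [Field k] [IsAlgClosed k]
variable {d : ℕ} {f g : k[X]}
variable {K : Type*} [Field K] [Algebra k K] [Algebra (RatFunc k) K] [IsScalarTower k (RatFunc k) K]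

noncomputable instance OmAction (f g : k[X]) (n : ℕ) : MulAction (K ≃ₐ[RatFunc k] K) (Om K f g n) where
  smul s x := ⟨s x.1, Om_smul n s x.1 x.2⟩
  one_smul x := rfl
  mul_smul s t x := rfl

lemma OmAction_coe (f g : k[X]) (n : ℕ) (s : K ≃ₐ[RatFunc k] K) (x : Om K f g n) :
    ((s • x : Om K f g n) : K) = s x.1 := rfl

open Classical in
lemma GoodPair.cnt_bound (H : GoodPair d f g) (N M : ℕ) [IsSplittingField (RatFunc k) K (PT d f g N)]
    [Fintype (K ≃ₐ[RatFunc k] K)]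
    (h2 : (2 : k) ≠ 0) (hN : M * (d * M).factorial < N) (hS : ∀ i < N, SwapData d f g (i + 1))
    (y0 : K ≃+* K) (hy : ∀ i, ∀ x ∈ Om K f g i, y0 x ∈ Om K f g i)
    (hpsi : ∀ x, y0 (psi (algebraMap k K) f g x) = psi (algebraMap k K) f g (y0 x)) :
    M * (Finset.univ.filter (fun s : K ≃ₐ[RatFunc k] K => ∃ x ∈ Om K f g N, s (y0 x) = x)).card ≤
      2 * Fintype.card (K ≃ₐ[RatFunc k] K) := by
  haveI : Normal (RatFunc k) K := Normal.of_isSplittingField (PT d f g N)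
  have hNe := H.Om_nonempty (K := K) N
  haveI hfin : ∀ i, Fintype (Om K f g i) := fun i => (H.Om_finite i).fintype
  let G := K ≃ₐ[RatFunc k] K
  let α : ∀ i, Om K f g i → Om K f g i := fun i x => ⟨y0 x.1, hy i x.1 x.2⟩
  let U : ℕ → ℕ := fun i => cntFix G (α i)
  have key := iterate_contraction (d * M).factorial M (Fintype.card G) Fintype.card_pos U N hN
    (by
      refine (Finset.card_le_univ _)) (by
      intro i hi
      have hne : Nonempty (Om K f g i) := by
        obtain ⟨x, hx⟩ := hNe
        refine ⟨⟨(psi (algebraMap k K) f g)^[N - i] x, H.psi_iterate_nonconst _ _ hx.1 _, ?_⟩⟩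
        rw [← Function.iterate_add_apply, Nat.add_sub_cancel' (by omega)]
        exact hx.2
      refine contraction_step (G := G) (fun x : Om K f g (i+1) => (⟨_, H.psi_mem i x.1 x.2⟩ : Om K f g i))
        ?_ ?_ (α i) (α (i+1)) ?_ ?_ ?_ ?_ d M ?_
      · intro s x
        apply Subtype.ext
        exact (psi_smul s x.1).symm
      · rintro ⟨z, hz⟩
        have hc := H.fib_eq N hNe i hi z hz
        have : ({x : K | x ∈ Om K f g (i + 1) ∧ psi (algebraMap k K) f g x = z}).Nonempty := by
          apply Set.nonempty_of_ncard_ne_zero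
          rw [hc]; have := H.hd; omega
        obtain ⟨x, hx1, hx2⟩ := this
        exact ⟨⟨x, hx1⟩, Subtype.ext hx2⟩
      · intro x
        apply Subtype.ext
        exact (hpsi x.1).symm
      · intro x x' h
        apply Subtype.ext
        exact y0.injective (congrArg Subtype.val h)
      · rintro ⟨x, hx⟩
        obtain ⟨x', hx', hne', hp, s, hs1, hs2, hs3⟩ := H.swap_all N h2 i hi (hS i hi) x hx
        refine ⟨⟨x', hx'⟩, fun h => hne' (congrArg Subtype.val h), Subtype.ext hp, s,
          Subtype.ext hs1, Subtype.ext hs2, ?_⟩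
        rintro ⟨z, hz⟩ h1 h2
        apply Subtype.ext
        exact hs3 z hz (fun h => h1 (Subtype.ext h)) (fun h => h2 (Subtype.ext h))
      · constructor
        rintro ⟨x, hx⟩ ⟨y, hy⟩
        obtain ⟨s, hs⟩ := H.trans i x y hx hy
        exact ⟨s, Subtype.ext hs⟩
      · rintro ⟨w, hw⟩
        have hc := H.fib_eq N hNe i hi w hw
        rw [← Set.ncard_coe_finset, ← Set.ncard_image_of_injective _ Subtype.val_injective]
        refine (Set.ncard_le_ncard (t := {x : K | x ∈ Om K f g (i + 1) ∧
          psi (algebraMap k K) f g x = w}) ?_ ?_).trans hc.le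
        · rintro _ ⟨⟨x, hx⟩, hx2, rfl⟩
          refine ⟨hx, ?_⟩
          simpa using hx2
        · exact (H.Om_finite (i+1)).subset (fun x hx => hx.1))
  have e : U N = (Finset.univ.filter (fun s : K ≃ₐ[RatFunc k] K => ∃ x ∈ Om K f g N, s (y0 x) = x)).card := by
    change cntFix G (α N) = _
    rw [cntFix]
    congr 1
    ext s
    simp only [Finset.mem_filter, Finset.mem_univ, true_and]
    constructor
    · rintro ⟨⟨x, hx⟩, h⟩
      exact ⟨x, hx, congrArg Subtype.val h⟩
    · rintro ⟨x, hx, h⟩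
      exact ⟨⟨x, hx⟩, Subtype.ext h⟩
  rw [← e]
  exact key

end Cnt
end APP


namespace APP
section Integ
variable {k : Type*} [Field k] [IsAlgClosed k]
variable {d : ℕ} {f g : k[X]}
variable {K : Type*} [Field K] [Algebra k K] [Algebra (RatFunc k) K] [IsScalarTower k (RatFunc k) K]

lemma intg_lc {L : Type*} [Field L] (e : k[X] →+* L) (u w : k[X]) (a b : k[X]) (E : ℕ)
    (ha : a.natDegree ≤ E) (hb : b.natDegree ≤ E) (x : L)
    (hx : e u * eval₂ (e.comp C) x a - e w * eval₂ (e.comp C) x b = 0)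
    (hne : u * C (a.coeff E) - w * C (b.coeff E) ≠ 0) :
    e.IsIntegralElem ((e u * e (C (a.coeff E)) - e w * e (C (b.coeff E))) * x) := by
  let p : k[X][X] := C u * a.map C - C w * b.map C
  have hp : p.natDegree = E := by
    refine le_antisymm ?_ (le_natDegree_of_ne_zero ?_)
    · refine (natDegree_sub_le_of_le (natDegree_C_mul_le _ _) (natDegree_C_mul_le _ _)).trans ?_
      rw [max_le_iff]
      exact ⟨natDegree_map_le.trans ha, natDegree_map_le.trans hb⟩
    · simp only [p, coeff_sub, coeff_C_mul, coeff_map]; exact hne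
  have := RingHom.isIntegralElem_leadingCoeff_mul e p x (by
    simp only [p, eval₂_sub, eval₂_mul, eval₂_C, eval₂_map]; exact hx)
  rw [leadingCoeff, hp] at this
  simpa only [p, coeff_sub, coeff_C_mul, coeff_map, map_sub, map_mul] using this

/-- elements integral with respect to both charts -/
def Bd (K : Type*) [Field K] [Algebra k K] [Algebra (RatFunc k) K] (m : ℕ) (x : K) : Prop :=
  (aeval (R := k) (TT k K)).toRingHom.IsIntegralElem x ∧
  (aeval (R := k) (TT k K)⁻¹).toRingHom.IsIntegralElem ((TT k K)⁻¹ ^ m * x)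

lemma Bd.mul {m n : ℕ} {x y : K} (hx : Bd (k := k) K m x) (hy : Bd (k := k) K n y) :
    Bd (k := k) K (m + n) (x * y) := by
  refine ⟨hx.1.mul _ hy.1, ?_⟩
  have := hx.2.mul _ hy.2
  have e : (TT k K)⁻¹ ^ (m + n) * (x * y) = (TT k K)⁻¹ ^ m * x * ((TT k K)⁻¹ ^ n * y) := by
    rw [pow_add]; ring
  rw [e]; exact this

lemma Bd.add {m : ℕ} {x y : K} (hx : Bd (k := k) K m x) (hy : Bd (k := k) K m y) :
    Bd (k := k) K m (x + y) := by
  refine ⟨hx.1.add _ hy.1, ?_⟩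
  rw [mul_add]
  exact hx.2.add _ hy.2

lemma Bd_alg (c : k) : Bd (k := k) K 0 (algebraMap k K c) := by
  have : ∀ t : K, (aeval (R := k) t).toRingHom.IsIntegralElem (algebraMap k K c) := by
    intro t
    have := RingHom.isIntegralElem_map (aeval (R := k) t).toRingHom (x := C c)
    simpa using this
  exact ⟨this _, by simpa using this _⟩

lemma TT_ne_zero : TT k K ≠ 0 := by
  have := TT_ne (k := k) K 0
  rwa [map_zero] at this

lemma Bd_one : Bd (k := k) K 1 1 := by
  refine ⟨RingHom.isIntegralElem_one _, ?_⟩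
  have := RingHom.isIntegralElem_map (aeval (R := k) (TT k K)⁻¹).toRingHom (x := X)
  simpa using this

lemma Bd_T : Bd (k := k) K 1 (TT k K) := by
  refine ⟨?_, ?_⟩
  · have := RingHom.isIntegralElem_map (aeval (R := k) (TT k K)).toRingHom (x := X)
    simpa using this
  · rw [pow_one, inv_mul_cancel₀ TT_ne_zero]
    exact RingHom.isIntegralElem_one _

/-- leading coefficient -/
noncomputable def ell (K : Type*) [Field K] [Algebra k K] [Algebra (RatFunc k) K] (d : ℕ) (f g : k[X]) (N : ℕ) : K :=
  algebraMap k K ((itP d f g N).1.coeff (d ^ N)) - TT k K * algebraMap k K ((itP d f g N).2.coeff (d ^ N))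

lemma GoodPair.ell_ne (H : GoodPair d f g) (N : ℕ) : ell (k := k) K d f g N ≠ 0 := by
  have := H.hd
  exact comb_ne_zero _ _ (TT_ne K) _ _ (itP_top d (by omega) f g H.hf H.hg H.cop (Or.inr H.hgd) N)

lemma poly_comb_ne (a b : k) (h : ¬ (a = 0 ∧ b = 0)) : (1 * C a - X * C b : k[X]) ≠ 0 ∧ (X * C a - 1 * C b : k[X]) ≠ 0 := by
  constructor
  · intro h0
    apply h
    have h1 := congrArg (fun q => coeff q 0) h0
    have h2 := congrArg (fun q => coeff q 1) h0
    simp at h1 h2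
    exact ⟨h1, by simpa [coeff_C] using h2⟩
  · intro h0
    apply h
    have h1 := congrArg (fun q => coeff q 0) h0
    have h2 := congrArg (fun q => coeff q 1) h0
    simp at h1 h2
    exact ⟨by simpa [coeff_C] using h2, h1⟩

lemma GoodPair.Bd_root (H : GoodPair d f g) (N : ℕ) (x : K) (hx : x ∈ Om K f g N) :
    Bd (k := k) K 1 (ell (k := k) K d f g N * x) := by
  have hd := H.hd
  obtain ⟨ha, hb⟩ := natDegree_itP_le d f g N (by omega)
  obtain ⟨hn1, hn2⟩ := poly_comb_ne _ _ (itP_top d (by omega) f g H.hf H.hg H.cop (Or.inr H.hgd) N)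
  rw [H.mem_Om, aeval_PT] at hx
  have hc : ∀ t : K, (aeval (R := k) t).toRingHom.comp C = algebraMap k K := by
    intro t; ext c; simp
  have hT := TT_ne_zero (k := k) (K := K)
  refine ⟨?_, ?_⟩
  · have := intg_lc (aeval (R := k) (TT k K)).toRingHom 1 X _ _ _ ha hb x (by
      rw [hc]; simpa using hx) hn1
    simpa [ell] using this
  · have := intg_lc (aeval (R := k) (TT k K)⁻¹).toRingHom X 1 _ _ _ ha hb x (by
      rw [hc]
      simp only [AlgHom.toRingHom_eq_coe, RingHom.coe_coe, aeval_X, map_one, one_mul]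
      have e : (TT k K)⁻¹ * eval₂ (algebraMap k K) x (itP d f g N).1 - eval₂ (algebraMap k K) x (itP d f g N).2
        = (TT k K)⁻¹ * (eval₂ (algebraMap k K) x (itP d f g N).1 - TT k K * eval₂ (algebraMap k K) x (itP d f g N).2) := by
        field_simp
      rw [e, hx, mul_zero]) hn2
    convert this using 1
    simp [ell]
    field_simp

lemma Bd.smul {m : ℕ} {x : K} (hx : Bd (k := k) K m x) (s : K ≃ₐ[RatFunc k] K) : Bd (k := k) K m (s x) := by
  have hT : s (TT k K) = TT k K := s.commutes _
  have hc : ∀ c, s (algebraMap k K c) = algebraMap k K c := by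
    intro c
    rw [IsScalarTower.algebraMap_apply k (RatFunc k) K, s.commutes]
  have key : ∀ (t : K), s t = t → ∀ y, (aeval (R := k) t).toRingHom.IsIntegralElem y →
      (aeval (R := k) t).toRingHom.IsIntegralElem (s y) := by
    intro t ht y hy
    obtain ⟨q, hq, h0⟩ := hy
    refine ⟨q, hq, ?_⟩
    have h1 := congrArg s h0
    have h2 := hom_eval₂ q (aeval (R := k) t).toRingHom (s : K →+* K) y
    have h3 : (s : K →+* K).comp (aeval (R := k) t).toRingHom = (aeval (R := k) t).toRingHom := by
      apply Polynomial.ringHom_ext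
      · intro c; simp [hc]
      · simp [ht]
    rw [h3] at h2
    rw [map_zero] at h1
    exact h2.symm.trans h1
  refine ⟨key _ hT _ hx.1, ?_⟩
  have := key (TT k K)⁻¹ (by rw [map_inv₀, hT]) _ hx.2
  rwa [map_mul, map_pow, map_inv₀, hT] at this

lemma Bd_zero (n : ℕ) : Bd (k := k) K n 0 :=
  ⟨RingHom.isIntegralElem_zero _, by rw [mul_zero]; exact RingHom.isIntegralElem_zero _⟩

lemma Bd_prod {ι : Type*} (s : Finset ι) (x : ι → K) (m : ℕ) (h : ∀ i ∈ s, Bd (k := k) K m (x i)) :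
    Bd (k := k) K (s.card * m) (∏ i ∈ s, x i) := by
  classical
  induction s using Finset.induction_on with
  | empty => simpa using Bd_alg (K := K) (1 : k)
  | insert a s ha ih =>
    rw [Finset.prod_insert ha, Finset.card_insert_of_notMem ha, Nat.succ_mul, add_comm]
    exact (h a (Finset.mem_insert_self _ _)).mul (ih (fun i hi => h i (Finset.mem_insert_of_mem hi)))

lemma Bd_span (Z : Set K) (h : ∀ x ∈ Z, Bd (k := k) K 1 x) (m : ℕ) (a : K) (ha : a ∈ (Submodule.span k Z) ^ m) :
    Bd (k := k) K m a := by
  have h1 : ∀ x ∈ Submodule.span k Z, Bd (k := k) K 1 x := by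
    intro x hx
    induction hx using Submodule.span_induction with
    | mem x hx => exact h x hx
    | zero => exact Bd_zero 1
    | add x y _ _ hx hy => exact hx.add hy
    | smul c x _ hx => rw [Algebra.smul_def]; simpa using (Bd_alg c).mul hx
  induction ha using Submodule.pow_induction_on_left' with
  | algebraMap r => exact Bd_alg r
  | add x y i hx hy h1 h2 => exact h1.add h2
  | mem_mul w hw i x hx ih => rw [Nat.succ_eq_add_one, add_comm]; exact (h1 w hw).mul ih

/-- An element of `k(T)` bounded of order `m` is a polynomial of degree `≤ m`. -/
lemma Bd_ratfunc (m : ℕ) (ρ : RatFunc k) (h : Bd (k := k) K m (algebraMap _ K ρ)) :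
    ∃ r : k[X], r.natDegree ≤ m ∧ algebraMap k[X] (RatFunc k) r = ρ := by
  have desc : ∀ (e : k[X] →+* RatFunc k) (y : RatFunc k),
      ((algebraMap (RatFunc k) K).comp e).IsIntegralElem (algebraMap _ K y) → e.IsIntegralElem y := by
    rintro e y ⟨q, hq, h0⟩
    refine ⟨q, hq, (algebraMap (RatFunc k) K).injective ?_⟩
    rw [map_zero, hom_eval₂]; exact h0
  have icl : ∀ y : RatFunc k, (algebraMap k[X] (RatFunc k)).IsIntegralElem y → ∃ r, algebraMap k[X] (RatFunc k) r = y := by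
    intro y hy
    exact IsIntegrallyClosed.isIntegral_iff.mp hy
  have e1 : (aeval (R := k) (TT k K)).toRingHom = (algebraMap (RatFunc k) K).comp (algebraMap k[X] (RatFunc k)) := by
    apply Polynomial.ringHom_ext
    · intro c; simp [← RatFunc.algebraMap_eq_C, ← IsScalarTower.algebraMap_apply]
    · simp
  obtain ⟨r, rfl⟩ := icl ρ (desc _ _ (e1 ▸ h.1))
  refine ⟨r, ?_, rfl⟩
  by_contra hlt
  push Not at hlt
  have hXinv : ∀ c, (RatFunc.X : RatFunc k)⁻¹ ≠ RatFunc.C c := by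
    intro c hc
    apply ratX_ne_C c⁻¹
    rw [map_inv₀, ← hc, inv_inv]
  obtain ⟨ι, hι1, hι2⟩ := ratfunc_emb (RatFunc.C : k →+* RatFunc k) RatFunc.X⁻¹ hXinv
  let e' : k[X] →+* RatFunc k := eval₂RingHom RatFunc.C RatFunc.X⁻¹
  have e2 : (aeval (R := k) (TT k K)⁻¹).toRingHom = (algebraMap (RatFunc k) K).comp e' := by
    apply Polynomial.ringHom_ext
    · intro c; simp [e', ← RatFunc.algebraMap_eq_C, ← IsScalarTower.algebraMap_apply]
    · simp [e']
  have h2 := h.2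
  rw [e2, ← map_inv₀, ← map_pow, ← map_mul] at h2
  obtain ⟨q, hq, h0⟩ := desc _ _ h2
  have e3 : ι.comp e' = algebraMap k[X] (RatFunc k) := by
    apply Polynomial.ringHom_ext
    · intro c; simp [e', hι1]
    · simp [e', hι2]
  have h3 : (algebraMap k[X] (RatFunc k)).IsIntegralElem
      (ι ((RatFunc.X)⁻¹ ^ m * algebraMap k[X] (RatFunc k) r)) := by
    refine ⟨q, hq, ?_⟩
    have h6 := hom_eval₂ q e' ι ((RatFunc.X)⁻¹ ^ m * algebraMap k[X] (RatFunc k) r)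
    rw [e3] at h6
    exact h6.symm.trans (by rw [h0, map_zero])
  obtain ⟨s, hs⟩ := icl _ h3
  rw [map_mul, map_pow, map_inv₀, hι2, inv_inv] at hs
  have e4 : ι (algebraMap k[X] (RatFunc k) r) = eval₂ RatFunc.C RatFunc.X⁻¹ r := by
    have : ι.comp (algebraMap k[X] (RatFunc k)) = eval₂RingHom RatFunc.C RatFunc.X⁻¹ := by
      apply Polynomial.ringHom_ext
      · intro c; simp [hι1]
      · simp [hι2]
    exact congrArg (fun e => e r) this
  have hX0 : (RatFunc.X : RatFunc k) ≠ 0 := RatFunc.X_ne_zero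
  letI : Invertible ((RatFunc.X : RatFunc k)⁻¹) := invertibleOfNonzero (inv_ne_zero hX0)
  have h5 := eval₂_reverse_mul_pow (RatFunc.C : k →+* RatFunc k) (RatFunc.X)⁻¹ r
  rw [invOf_eq_inv, inv_inv, ← e4] at h5
  have h7 : eval₂ RatFunc.C RatFunc.X (reverse r) = algebraMap k[X] (RatFunc k) (reverse r) := by
    have : eval₂RingHom RatFunc.C RatFunc.X = algebraMap k[X] (RatFunc k) := by
      apply Polynomial.ringHom_ext
      · intro c; simp
      · simp
    exact congrArg (fun e => e (reverse r)) this
  rw [h7] at h5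
  have h8 : algebraMap k[X] (RatFunc k) (reverse r) = algebraMap k[X] (RatFunc k) (X ^ (r.natDegree - m) * s) := by
    rw [map_mul, map_pow, RatFunc.algebraMap_X, hs, ← h5, ← mul_assoc, ← pow_add, Nat.sub_add_cancel hlt.le,
      mul_comm, mul_assoc, ← mul_pow, inv_mul_cancel₀ hX0, one_pow, mul_one]
  have h9 := RatFunc.algebraMap_injective k h8
  have h10 := congrArg (fun q => coeff q 0) h9
  simp only [coeff_zero_reverse, mul_coeff_zero, coeff_X_pow] at h10
  rw [if_neg (by omega), zero_mul, leadingCoeff_eq_zero] at h10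
  rw [h10] at hlt; simp at hlt

end Integ
end APP


namespace APP
section Ring
variable {k : Type*} [Field k] [IsAlgClosed k]
variable {d : ℕ} {f g : k[X]}
variable {K : Type*} [Field K] [Algebra k K] [Algebra (RatFunc k) K] [IsScalarTower k (RatFunc k) K]

/-- generators -/
def GZ (K : Type*) [Field K] [Algebra k K] [Algebra (RatFunc k) K] (d : ℕ) (f g : k[X]) (N : ℕ) : Set K :=
  {1, TT k K} ∪ (fun x => ell (k := k) K d f g N * x) '' Om K f g N

/-- coordinate ring -/
noncomputable def AA (K : Type*) [Field K] [Algebra k K] [Algebra (RatFunc k) K] (d : ℕ) (f g : k[X]) (N : ℕ) :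
    Subalgebra k K := Algebra.adjoin k (GZ K d f g N)

/-- generating space -/
noncomputable def WW (K : Type*) [Field K] [Algebra k K] [Algebra (RatFunc k) K] (d : ℕ) (f g : k[X]) (N : ℕ) :
    Submodule k (AA K d f g N) := (Submodule.span k (GZ K d f g N)).comap (AA K d f g N).val.toLinearMap

lemma WW_pow (N m : ℕ) (a : AA K d f g N) (ha : a ∈ WW K d f g N ^ m) :
    (a : K) ∈ Submodule.span k (GZ K d f g N) ^ m := by
  have h1 : (AA K d f g N).val a ∈ (WW K d f g N ^ m).map (AA K d f g N).val.toLinearMap :=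
    Submodule.mem_map_of_mem ha
  rw [Submodule.map_pow] at h1
  exact (pow_le_pow_left' (Submodule.map_comap_le _ _) m) h1

/-- admissible ring endomorphisms -/
structure Adm (d : ℕ) (f g : k[X]) (N : ℕ) (y : K →+* K) : Prop where
  hc : ∀ c : k, ∃ c' : k, y (algebraMap k K c) = algebraMap k K c'
  hT : y (TT k K) = TT k K
  hl : y (ell (k := k) K d f g N) = ell (k := k) K d f g N
  hO : ∀ x ∈ Om K f g N, y x ∈ Om K f g N

lemma Adm.gz {N : ℕ} {y : K →+* K} (h : Adm d f g N y) (x : K) (hx : x ∈ GZ K d f g N) : y x ∈ GZ K d f g N := by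
  rcases hx with (rfl | rfl) | ⟨x, hx, rfl⟩
  · left; left; exact map_one y
  · left; right; exact h.hT
  · right; exact ⟨y x, h.hO x hx, by simp [h.hl]⟩

lemma Adm.span {N : ℕ} {y : K →+* K} (h : Adm d f g N y) (x : K) (hx : x ∈ Submodule.span k (GZ K d f g N)) :
    y x ∈ Submodule.span k (GZ K d f g N) := by
  induction hx using Submodule.span_induction with
  | mem x hx => exact Submodule.subset_span (h.gz x hx)
  | zero => rw [map_zero]; exact zero_mem _
  | add x y _ _ hx hy => rw [map_add]; exact add_mem hx hy
  | smul c x _ hx =>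
    obtain ⟨c', hc'⟩ := h.hc c
    rw [Algebra.smul_def, map_mul, hc', ← Algebra.smul_def]; exact Submodule.smul_mem _ _ hx

lemma Adm.alg {N : ℕ} {y : K →+* K} (h : Adm d f g N y) (x : K) (hx : x ∈ AA K d f g N) : y x ∈ AA K d f g N := by
  induction hx using Algebra.adjoin_induction with
  | mem x hx => exact Algebra.subset_adjoin (h.gz x hx)
  | algebraMap c =>
    obtain ⟨c', hc'⟩ := h.hc c
    rw [hc']; exact Subalgebra.algebraMap_mem _ _
  | add x y _ _ hx hy => rw [map_add]; exact add_mem hx hy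
  | mul x y _ _ hx hy => rw [map_mul]; exact mul_mem hx hy

/-- restriction to the coordinate ring -/
noncomputable def Adm.res {N : ℕ} {y : K →+* K} (h : Adm d f g N y) : AA K d f g N →+* AA K d f g N :=
  RingHom.codRestrict (y.comp (AA K d f g N).val.toRingHom) (AA K d f g N) (fun x => h.alg x x.2)

lemma Adm.res_coe {N : ℕ} {y : K →+* K} (h : Adm d f g N y) (a : AA K d f g N) :
    ((h.res a : AA K d f g N) : K) = y a := rfl

lemma Adm.res_inj {N : ℕ} {y : K →+* K} (h : Adm d f g N y) : Function.Injective h.res := by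
  intro a b hab
  have := congrArg (fun t : AA K d f g N => (t : K)) hab
  exact Subtype.ext (y.injective this)

lemma gal_alg (s : K ≃ₐ[RatFunc k] K) (c : k) : s (algebraMap k K c) = algebraMap k K c := by
  rw [IsScalarTower.algebraMap_apply k (RatFunc k) K, s.commutes]

lemma gal_adm (N : ℕ) (s : K ≃ₐ[RatFunc k] K) : Adm d f g N (s : K →+* K) where
  hc := fun c => ⟨c, gal_alg s c⟩
  hT := s.commutes _
  hl := by
    show s _ = _
    rw [ell, map_sub, map_mul, gal_alg, gal_alg, s.commutes]
  hO := fun x hx => Om_smul N s x hx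

/-- Galois action on the coordinate ring -/
noncomputable def sg (d : ℕ) (f g : k[X]) (N : ℕ) (s : K ≃ₐ[RatFunc k] K) : AA K d f g N →ₐ[k] AA K d f g N :=
  { (gal_adm (d := d) (f := f) (g := g) N s).res with
    commutes' := fun c => Subtype.ext (gal_alg s c) }

lemma sg_coe (N : ℕ) (s : K ≃ₐ[RatFunc k] K) (a : AA K d f g N) : ((sg d f g N s a : AA K d f g N) : K) = s a := rfl

lemma GoodPair.norm_poly (H : GoodPair d f g) (N : ℕ) [IsSplittingField (RatFunc k) K (PT d f g N)]
    [Fintype (K ≃ₐ[RatFunc k] K)] (m : ℕ) (a : AA K d f g N) (ha : a ∈ WW K d f g N ^ m) (ha0 : a ≠ 0) (t : AA K d f g N)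
    (ht : (t : K) = TT k K) :
    ∃ r : k[X], r ≠ 0 ∧ r.natDegree ≤ Fintype.card (K ≃ₐ[RatFunc k] K) * m ∧
      aeval t r = ∏ s : K ≃ₐ[RatFunc k] K, sg d f g N s a := by
  have hB : Bd (k := k) K m (a : K) := by
    apply Bd_span (GZ K d f g N) _ m a (WW_pow N m a ha)
    rintro x ((rfl | rfl) | ⟨x, hx, rfl⟩)
    · exact Bd_one
    · exact Bd_T
    · exact H.Bd_root N x hx
  have hp : Bd (k := k) K (Fintype.card (K ≃ₐ[RatFunc k] K) * m) (∏ s : K ≃ₐ[RatFunc k] K, s (a : K)) :=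
    Bd_prod _ _ m (fun s _ => hB.smul s)
  haveI : IsGalois (RatFunc k) K := IsGalois.of_separable_splitting_field (H.PT_sep N)
  haveI : FiniteDimensional (RatFunc k) K := IsSplittingField.finiteDimensional K (PT d f g N)
  have hfix : (∏ s : K ≃ₐ[RatFunc k] K, s (a : K)) ∈ Set.range (algebraMap (RatFunc k) K) := by
    rw [IsGalois.mem_range_algebraMap_iff_fixed]
    intro s
    rw [map_prod]
    exact Fintype.prod_equiv (Equiv.mulLeft s) _ _ (fun x => rfl)
  obtain ⟨ρ, hρ⟩ := hfix
  obtain ⟨r, hr, hr2⟩ := Bd_ratfunc (K := K) _ ρ (hρ ▸ hp)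
  have hval : ((aeval t r : AA K d f g N) : K) = ∏ s : K ≃ₐ[RatFunc k] K, s (a : K) := by
    have e1 : ((aeval t r : AA K d f g N) : K) = aeval (t : K) r := (aeval_algHom_apply (AA K d f g N).val t r).symm
    rw [e1, ht, ← hρ, ← hr2, TT, aeval_algebraMap_apply]
    congr 1
    have := aeval_algebraMap_apply (RatFunc k) (X : k[X]) r
    rw [RatFunc.algebraMap_X] at this
    rw [this, aeval_X_left_apply]
  refine ⟨r, ?_, hr, ?_⟩
  · rintro rfl
    rw [map_zero] at hval
    have := Finset.prod_eq_zero_iff.mp hval.symm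
    obtain ⟨s, _, hs⟩ := this
    rw [EmbeddingLike.map_eq_zero_iff] at hs
    exact ha0 (Subtype.ext hs)
  · apply Subtype.ext
    rw [hval]
    exact (map_prod (AA K d f g N).val (fun s => sg d f g N s a) Finset.univ).symm

lemma GoodPair.gal_ext (H : GoodPair d f g) (N : ℕ) [IsSplittingField (RatFunc k) K (PT d f g N)] 
    (s : K ≃ₐ[RatFunc k] K) (hs : ∀ x ∈ Om K f g N, s x = x) : s = 1 := by
  have h := subfield_top (d := d) (f := f) (g := g) (K := K) N ((s : K →+* K).eqLocusField (RingHom.id K)) (fun c => gal_alg s c) (s.commutes _)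
    (fun x hx => hs x (by rw [H.Om_eq_rootSet]; exact hx))
  ext x
  have : x ∈ (⊤ : Subfield K) := trivial
  rw [← h] at this
  exact this

lemma GoodPair.exists_theta (H : GoodPair d f g) (N : ℕ) [IsSplittingField (RatFunc k) K (PT d f g N)]
    [Fintype (K ≃ₐ[RatFunc k] K)] : ∃ θ ∈ Submodule.span k (GZ K d f g N),
      ∀ s : K ≃ₐ[RatFunc k] K, s θ = θ → s = 1 := by
  classical
  have hfin := H.Om_finite (K := K) N
  haveI := hfin.fintype
  let e := Fintype.equivFin (Om K f g N)
  let b : Fin (Fintype.card (Om K f g N)) → K := fun i => ell (k := k) K d f g N * (e.symm i : K)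
  let q : (K ≃ₐ[RatFunc k] K) → K[X] := fun s => ∑ i, C (s (b i) - b i) * X ^ (i : ℕ)
  have hq : ∀ s, s ≠ 1 → q s ≠ 0 := by
    intro s hs h0
    apply hs
    apply H.gal_ext N s
    intro x hx
    have h1 := congrArg (fun p => coeff p (e ⟨x, hx⟩ : ℕ)) h0
    simp only [q, finsetSum_coeff, coeff_C_mul, coeff_X_pow, coeff_zero] at h1
    rw [Finset.sum_eq_single (e ⟨x, hx⟩)] at h1
    · simp only [if_true, mul_one, b, Equiv.symm_apply_apply, map_mul] at h1
      have h2 : s (ell (k := k) K d f g N) = ell (k := k) K d f g N := (gal_adm (d := d) (f := f) (g := g) N s).hl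
      rw [h2, ← mul_sub] at h1
      exact sub_eq_zero.mp ((mul_eq_zero.mp h1).resolve_left (H.ell_ne N))
    · intro i _ hi
      rw [if_neg, mul_zero]
      intro h; exact hi (Fin.ext h.symm)
    · intro h; exact absurd (Finset.mem_univ _) h
  have hprod : (∏ s ∈ Finset.univ.filter (fun s : K ≃ₐ[RatFunc k] K => s ≠ 1), q s) ≠ 0 := by
    rw [Finset.prod_ne_zero_iff]
    intro s hs; exact hq s (Finset.mem_filter.mp hs).2
  obtain ⟨c, hc⟩ : ∃ c : k, (∏ s ∈ Finset.univ.filter (fun s : K ≃ₐ[RatFunc k] K => s ≠ 1), q s).eval (algebraMap k K c) ≠ 0 := by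
    by_contra hcon
    push Not at hcon
    apply hprod
    apply eq_zero_of_infinite_isRoot
    haveI : Infinite k := inferInstance
    exact (Set.infinite_range_of_injective (algebraMap k K).injective).mono (by
      rintro _ ⟨c, rfl⟩; exact hcon c)
  rw [eval_prod, Finset.prod_ne_zero_iff] at hc
  refine ⟨∑ i : Fin (Fintype.card (Om K f g N)), (c ^ (i : ℕ)) • b i, ?_, ?_⟩
  · refine Submodule.sum_mem _ fun i _ => Submodule.smul_mem _ _ (Submodule.subset_span ?_)
    right
    exact ⟨_, (e.symm i).2, rfl⟩
  · intro s hs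
    by_contra h1
    apply hc s (by simp [h1])
    simp only [q, eval_finsetSum, eval_mul, eval_C, eval_pow, eval_X]
    rw [map_sum] at hs
    rw [← sub_eq_zero, ← Finset.sum_sub_distrib] at hs
    rw [← hs]
    refine Finset.sum_congr rfl fun i _ => ?_
    rw [Algebra.smul_def, map_mul s (algebraMap k K _), gal_alg, map_pow]
    ring

lemma GoodPair.theta_ind (H : GoodPair d f g) (N : ℕ) [IsSplittingField (RatFunc k) K (PT d f g N)]
    [Fintype (K ≃ₐ[RatFunc k] K)] (θ : K) (hθ : ∀ s : K ≃ₐ[RatFunc k] K, s θ = θ → s = 1) :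
    LinearIndependent k (fun x : ℕ × Fin (Fintype.card (K ≃ₐ[RatFunc k] K)) => (TT k K)^x.1 * θ^(x.2:ℕ)) := by
  classical
  haveI : FiniteDimensional (RatFunc k) K := IsSplittingField.finiteDimensional K (PT d f g N)
  have hθintegral : IsIntegral (RatFunc k) θ := Algebra.IsIntegral.isIntegral θ
  have hinj : Function.Injective (fun s : K ≃ₐ[RatFunc k] K => s θ) := by
    intro s s' h
    have h1 : (s'⁻¹ * s) θ = θ := by
      rw [AlgEquiv.mul_apply]
      rw [show s θ = s' θ from h]
      exact s'.symm_apply_apply θ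
    have := hθ _ h1
    exact (inv_mul_eq_one.mp this).symm
  have hle : Fintype.card (K ≃ₐ[RatFunc k] K) ≤ (minpoly (RatFunc k) θ).natDegree := by
    have h0 : (minpoly (RatFunc k) θ).map (algebraMap _ K) ≠ 0 :=
      (Polynomial.map_ne_zero_iff (algebraMap (RatFunc k) K).injective).mpr (minpoly.ne_zero hθintegral)
    have h1 : (Finset.univ.image (fun s : K ≃ₐ[RatFunc k] K => s θ)) ⊆ ((minpoly (RatFunc k) θ).map (algebraMap _ K)).roots.toFinset := by
      intro x hx
      obtain ⟨s, _, rfl⟩ := Finset.mem_image.mp hx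
      rw [Multiset.mem_toFinset, mem_roots h0, IsRoot.def, eval_map_algebraMap]
      rw [← AlgEquiv.coe_algHom, aeval_algHom_apply, minpoly.aeval, map_zero]
    have h2 := Finset.card_le_card h1
    rw [Finset.card_image_of_injective _ hinj, Finset.card_univ] at h2
    refine h2.trans ((Multiset.toFinset_card_le _).trans ((card_roots' _).trans natDegree_map_le))
  have hc := (linearIndependent_pow (K := RatFunc k) θ).comp (Fin.castLE hle) (Fin.castLE_injective hle)
  have hb : LinearIndependent k (fun i : ℕ => (RatFunc.X : RatFunc k) ^ i) := by
    have := (Polynomial.basisMonomials k).linearIndependent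
    have h2 := this.map' ((Algebra.linearMap k[X] (RatFunc k)).restrictScalars k) (by
      rw [LinearMap.ker_eq_bot]; exact RatFunc.algebraMap_injective k)
    have e : (fun i : ℕ => (RatFunc.X : RatFunc k) ^ i) =
        ((Algebra.linearMap k[X] (RatFunc k)).restrictScalars k) ∘ (Polynomial.basisMonomials k) := by
      ext i
      simp [← X_pow_eq_monomial]
    rw [e]; exact h2
  have := linearIndependent_smul hb hc
  convert this using 1
  ext x
  simp [Algebra.smul_def]

end Ring
end APP


namespace APP
section Frob
variable {k : Type*} [Field k] [IsAlgClosed k]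
variable {d : ℕ} {f g : k[X]}
variable {K : Type*} [Field K] [Algebra k K] [Algebra (RatFunc k) K] [IsScalarTower k (RatFunc k) K]

lemma exists_Fr (φ : k →+* k) : ∃ Fr : FractionRing (PowerSeries k) →+* FractionRing (PowerSeries k),
    ∀ s, Fr (algebraMap (PowerSeries k) _ s) = algebraMap (PowerSeries k) _ (PowerSeries.map φ s) := by
  have hinj : Function.Injective ((algebraMap (PowerSeries k) (FractionRing (PowerSeries k))).comp (PowerSeries.map φ)) := by
    refine (IsFractionRing.injective (PowerSeries k) (FractionRing (PowerSeries k))).comp ?_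
    intro a b hab
    ext n
    have hab' : PowerSeries.map φ a = PowerSeries.map φ b := hab
    have := congrArg (PowerSeries.coeff n) hab'
    rw [PowerSeries.coeff_map, PowerSeries.coeff_map] at this
    exact φ.injective this
  exact ⟨IsFractionRing.lift hinj, fun s => IsFractionRing.lift_algebraMap hinj s⟩

/-- good fibre -/
def GoodTau (d : ℕ) (f g : k[X]) (N : ℕ) (τ : k) : Prop :=
  (PP (RingHom.id k) τ (itP d f g N).1 (itP d f g N).2).natDegree = d ^ N ∧
  (PP (RingHom.id k) τ (itP d f g N).1 (itP d f g N).2).Separable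

lemma GoodPair.exists_ev (H : GoodPair d f g) (N : ℕ) [IsSplittingField (RatFunc k) K (PT d f g N)]
    (τ : k) (hτ : GoodTau d f g N τ) :
    ∃ (ι : K →+* FractionRing (PowerSeries k)) (ev : AA K d f g N →ₐ[k] PowerSeries k),
      (∀ c, ι (algebraMap k K c) = cL k c) ∧ ι (TT k K) = algebraMap _ _ (PowerSeries.C τ + PowerSeries.X) ∧
      ∀ a, algebraMap (PowerSeries k) (FractionRing (PowerSeries k)) (ev a) = ι a := by
  have hd := H.hd
  obtain ⟨ha, hb⟩ := natDegree_itP_le d f g N (by omega)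
  have hcc : PowerSeries.constantCoeff (PowerSeries.C τ + PowerSeries.X : PowerSeries k) = τ := by simp
  obtain ⟨hsp, hroot⟩ := ser_splits (PowerSeries.C τ + PowerSeries.X) _ _ _ ha hb (by rw [hcc]; exact hτ.1)
    (by rw [hcc]; exact hτ.2.ne_zero) (by rw [hcc]; exact hτ.2)
  obtain ⟨ι, hι1, hι2⟩ := exists_emb (K := K) N (cL k) _ (fun c => ser_nonconst _ 1 one_pos (by simp [PowerSeries.coeff_C]) c) hsp
  have hinjΛ := IsFractionRing.injective (PowerSeries k) (FractionRing (PowerSeries k))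
  have hmem : ∀ a ∈ AA K d f g N, ∃ s : PowerSeries k, algebraMap _ (FractionRing (PowerSeries k)) s = ι a := by
    intro a ha
    induction ha using Algebra.adjoin_induction with
    | mem x hx =>
      rcases hx with (rfl | rfl) | ⟨x, hx, rfl⟩
      · exact ⟨1, by simp⟩
      · exact ⟨_, hι2.symm⟩
      · have h1 := H.Om_root N ι x hx
        rw [show ι.comp (algebraMap k K) = cL k from RingHom.ext hι1, hι2] at h1
        obtain ⟨r, hr, _⟩ := hroot _ h1
        refine ⟨(PowerSeries.C ((itP d f g N).1.coeff (d ^ N)) - (PowerSeries.C τ + PowerSeries.X) * PowerSeries.C ((itP d f g N).2.coeff (d ^ N))) * r, ?_⟩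
        simp only [ell, map_mul, map_sub, hr, hι1, hι2]
        rfl
    | algebraMap c => exact ⟨PowerSeries.C c, (hι1 c).symm⟩
    | add x y _ _ hx hy =>
      obtain ⟨a, ha⟩ := hx; obtain ⟨b, hb⟩ := hy
      exact ⟨a + b, by rw [map_add, map_add, ha, hb]⟩
    | mul x y _ _ hx hy =>
      obtain ⟨a, ha⟩ := hx; obtain ⟨b, hb⟩ := hy
      exact ⟨a * b, by rw [map_mul, map_mul, ha, hb]⟩
  choose! e he using hmem
  refine ⟨ι, { toFun := fun a => e a, map_one' := ?_, map_mul' := ?_, map_zero' := ?_, map_add' := ?_, commutes' := ?_ }, hι1, hι2, fun a => he a a.2⟩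
  · apply hinjΛ; rw [he _ (1 : AA K d f g N).2]; simp
  · intro a b; apply hinjΛ; rw [map_mul, he _ (a * b).2, he _ a.2, he _ b.2]; simp
  · apply hinjΛ; rw [he _ (0 : AA K d f g N).2]; simp
  · intro a b; apply hinjΛ; rw [map_add, he _ (a + b).2, he _ a.2, he _ b.2]; simp
  · intro c; apply hinjΛ; rw [he _ (algebraMap k (AA K d f g N) c).2]
    exact hι1 c

lemma eval_twist (φ : k →+* k) (y : K →+* K) (hyc : ∀ c, y (algebraMap k K c) = algebraMap k K (φ c))
    (q : k[X]) (hq : q.map φ = q) (x : K) :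
    y (eval₂ (algebraMap k K) x q) = eval₂ (algebraMap k K) (y x) q := by
  rw [hom_eval₂, show y.comp (algebraMap k K) = (algebraMap k K).comp φ from RingHom.ext hyc, ← eval₂_map, hq]

lemma itP_twist (φ : k →+* k) (hf : f.map φ = f) (hg : g.map φ = g) (d i : ℕ) :
    (itP d f g i).1.map φ = (itP d f g i).1 ∧ (itP d f g i).2.map φ = (itP d f g i).2 := by
  have := itP_map d f g φ i
  rw [hf, hg] at this
  exact ⟨(congrArg Prod.fst this).symm, (congrArg Prod.snd this).symm⟩

lemma GoodPair.twist_Om (H : GoodPair d f g) (φ : k →+* k) (hf : f.map φ = f) (hg : g.map φ = g)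
    (y : K →+* K) (hyc : ∀ c, y (algebraMap k K c) = algebraMap k K (φ c)) (hT : y (TT k K) = TT k K) (i : ℕ)
    (x : K) (hx : x ∈ Om K f g i) : y x ∈ Om K f g i := by
  rw [H.mem_Om, aeval_PT] at hx ⊢
  obtain ⟨h1, h2⟩ := itP_twist φ hf hg d i
  have := congrArg y hx
  rwa [map_sub, map_mul, hT, eval_twist φ y hyc _ h1, eval_twist φ y hyc _ h2, map_zero] at this

lemma twist_psi (φ : k →+* k) (hf : f.map φ = f) (hg : g.map φ = g)
    (y : K →+* K) (hyc : ∀ c, y (algebraMap k K c) = algebraMap k K (φ c)) (x : K) :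
    y (psi (algebraMap k K) f g x) = psi (algebraMap k K) f g (y x) := by
  rw [psi, psi, map_div₀, eval_twist φ y hyc _ hf, eval_twist φ y hyc _ hg]

lemma GoodPair.twist_adm (H : GoodPair d f g) (φ : k →+* k) (hf : f.map φ = f) (hg : g.map φ = g)
    (y : K →+* K) (hyc : ∀ c, y (algebraMap k K c) = algebraMap k K (φ c)) (hT : y (TT k K) = TT k K) (N : ℕ) :
    Adm d f g N y where
  hc := fun c => ⟨_, hyc c⟩
  hT := hT
  hl := by
    obtain ⟨h1, h2⟩ := itP_twist φ hf hg d N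
    have h3 := congrArg (fun q => coeff q (d ^ N)) h1
    have h4 := congrArg (fun q => coeff q (d ^ N)) h2
    simp only [coeff_map] at h3 h4
    rw [ell, map_sub, map_mul, hT, hyc, hyc, h3, h4]
  hO := fun x hx => H.twist_Om φ hf hg y hyc hT N x hx

lemma map_symm_eq (φ : k ≃+* k) (q : k[X]) (hq : q.map (φ : k →+* k) = q) : q.map (φ.symm : k →+* k) = q := by
  conv_lhs => rw [← hq]
  rw [Polynomial.map_map]
  have : ((φ.symm : k →+* k).comp (φ : k →+* k)) = RingHom.id k := by ext c; simp
  rw [this, Polynomial.map_id]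

/-- existence of the Frobenius element -/
lemma GoodPair.exists_frob (H : GoodPair d f g) (N : ℕ) [IsSplittingField (RatFunc k) K (PT d f g N)]
    (φ : k ≃+* k) (hf : f.map (φ : k →+* k) = f) (hg : g.map (φ : k →+* k) = g)
    (Fr : FractionRing (PowerSeries k) →+* FractionRing (PowerSeries k))
    (hFr : ∀ s, Fr (algebraMap (PowerSeries k) _ s) = algebraMap (PowerSeries k) _ (PowerSeries.map (φ : k →+* k) s))
    (τ : k) (hτ : φ τ = τ)
    (ι : K →+* FractionRing (PowerSeries k)) (hι1 : ∀ c, ι (algebraMap k K c) = cL k c)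
    (hι2 : ι (TT k K) = algebraMap _ _ (PowerSeries.C τ + PowerSeries.X)) (ω : K ≃ₐ[RatFunc k] K) :
    ∃ y : K ≃+* K, (∀ c, y (algebraMap k K c) = algebraMap k K (φ c)) ∧ y (TT k K) = TT k K ∧
      ∀ x, ι (ω (y x)) = Fr (ι (ω x)) := by
  let j : K →+* FractionRing (PowerSeries k) := ι.comp (ω : K →+* K)
  let h : K →+* FractionRing (PowerSeries k) := Fr.comp j
  have hj : ∀ c, j (algebraMap k K c) = cL k c := fun c => by
    show ι (ω _) = _
    rw [gal_alg, hι1]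
  have hjT : j (TT k K) = algebraMap _ _ (PowerSeries.C τ + PowerSeries.X) := by
    show ι (ω _) = _
    rw [ω.commutes]; exact hι2
  have hh : ∀ c, h (algebraMap k K c) = cL k (φ c) := fun c => by
    show Fr (j _) = _
    rw [hj]
    show Fr (algebraMap (PowerSeries k) _ (PowerSeries.C c)) = _
    rw [hFr, PowerSeries.map_C]; rfl
  have hhT : h (TT k K) = j (TT k K) := by
    show Fr (j _) = _
    rw [hjT, hFr, map_add, PowerSeries.map_C, PowerSeries.map_X]
    rw [show (φ : k →+* k) τ = τ from hτ]
  have hcomp : h.comp (algebraMap k K) = (j.comp (algebraMap k K)).comp (φ : k →+* k) := by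
    ext c; simp [hh, hj]
  obtain ⟨y, hy⟩ := emb_factor (d := d) (f := f) (g := g) N H j h
    (fun c => ⟨φ c, by rw [hh, hj]⟩) (fun c => ⟨φ.symm c, by rw [hh, hj, RingEquiv.apply_symm_apply]⟩) hhT
    (PTmap_eq N j h (by rw [hcomp, ← Polynomial.map_map, hf]) (by rw [hcomp, ← Polynomial.map_map, hg]) hhT)
  refine ⟨y, ?_, ?_, hy⟩
  · intro c; apply j.injective; rw [hy, hh, hj]
  · apply j.injective; rw [hy, hhT]

end Frob
end APP


namespace APP
section Core
variable {k : Type*} [Field k] [IsAlgClosed k]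
variable {d : ℕ} {f g : k[X]}
variable {K : Type*} [Field K] [Algebra k K] [Algebra (RatFunc k) K] [IsScalarTower k (RatFunc k) K]

open Classical in
/-- the Stepanov bound on one Frobenius class -/
lemma GoodPair.step_bound (H : GoodPair d f g) (N : ℕ) [IsSplittingField (RatFunc k) K (PT d f g N)]
    [Fintype (K ≃ₐ[RatFunc k] K)] (p : ℕ) [Fact p.Prime] [CharP k p] (e₁ e₂ : ℕ)
    (φ : k ≃+* k) (hφ : ∀ c, φ c = c ^ (p ^ e₁ * p ^ e₂))
    (hf : f.map (φ : k →+* k) = f) (hg : g.map (φ : k →+* k) = g)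
    (Fr : FractionRing (PowerSeries k) →+* FractionRing (PowerSeries k))
    (hFr : ∀ s, Fr (algebraMap (PowerSeries k) _ s) = algebraMap (PowerSeries k) _ (PowerSeries.map (φ : k →+* k) s))
    (ι : k → (K →+* FractionRing (PowerSeries k))) (ev : k → (AA K d f g N →ₐ[k] PowerSeries k))
    (T : Finset k)
    (hι2 : ∀ τ ∈ T, ι τ (TT k K) = algebraMap _ _ (PowerSeries.C τ + PowerSeries.X))
    (hev : ∀ τ ∈ T, ∀ a, algebraMap (PowerSeries k) (FractionRing (PowerSeries k)) (ev τ a) = ι τ a)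
    (y : K ≃+* K) (hyc : ∀ c, y (algebraMap k K c) = algebraMap k K (φ c)) (hyT : y (TT k K) = TT k K)
    (S : Finset (k × (K ≃ₐ[RatFunc k] K)))
    (hST : ∀ x ∈ S, x.1 ∈ T) (hS : ∀ x ∈ S, ∀ a, ι x.1 (x.2 (y a)) = Fr (ι x.1 (x.2 a)))
    (D : ℕ) (hD : Fintype.card (K ≃ₐ[RatFunc k] K) = D)
    (m₀ l₀ : ℕ) (hdim : D * ((m₀ + D) * p ^ e₁ + (l₀ + D)) + 1 < D ^ 2 * (m₀ + 1) * (l₀ + 1))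
    (hP : D * (m₀ + D) < p ^ e₂) :
    S.card ≤ D * ((m₀ + D) + (l₀ + D) * p ^ e₂) := by
  have hinjΛ := IsFractionRing.injective (PowerSeries k) (FractionRing (PowerSeries k))
  obtain ⟨θ, hθ1, hθ2⟩ := H.exists_theta (K := K) N
  have hsub : ∀ x ∈ Submodule.span k (GZ K d f g N), x ∈ AA K d f g N :=
    fun x hx => Algebra.span_le_adjoin k _ hx
  have hz : Adm d f g N (y.symm : K →+* K) :=
    H.twist_adm (φ.symm : k →+* k) (map_symm_eq φ f hf) (map_symm_eq φ g hg) _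
      (fun c => by
        show y.symm _ = algebraMap k K (φ.symm c)
        rw [RingEquiv.symm_apply_eq, hyc, RingEquiv.apply_symm_apply])
      (by show y.symm _ = _; rw [RingEquiv.symm_apply_eq, hyT]) N
  have hTs : TT k K ∈ Submodule.span k (GZ K d f g N) := Submodule.subset_span (Or.inl (Or.inr rfl))
  have hind := H.theta_ind N θ hθ2
  rw [hD] at hind
  refine stepanov (A := AA K d f g N) (WW K d f g N) (Submodule.subset_span (Or.inl (Or.inl rfl)))
    ⟨TT k K, hsub _ hTs⟩ ⟨θ, hsub _ hθ1⟩ hTs hθ1 (fun s => sg d f g N s) 1 ?_ D hD ?_ ?_ p ev S ?_ ?_ e₁ e₂ hz.res hz.res_inj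
    ?_ ?_ ?_ m₀ l₀ hdim hP
  · ext a; rfl
  · intro m a ha ha0
    exact H.norm_poly N m a ha ha0 _ rfl
  · refine LinearIndependent.of_comp (AA K d f g N).val.toLinearMap ?_
    exact hind
  · intro x hx a b hab
    have h1 := hev _ (hST x hx) a
    rw [hab, hev _ (hST x hx) b] at h1
    exact Subtype.ext ((ι x.1).injective h1).symm
  · intro x hx
    apply hinjΛ
    rw [hev _ (hST x hx)]
    exact hι2 _ (hST x hx)
  · intro c
    apply Subtype.ext
    have : y.symm (algebraMap k K c) = algebraMap k K (φ.symm c) := by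
      rw [RingEquiv.symm_apply_eq, hyc, RingEquiv.apply_symm_apply]
    show (y.symm (algebraMap k K c)) ^ _ = algebraMap k K c
    rw [this, ← map_pow, ← hφ, RingEquiv.apply_symm_apply]
  · intro a ha
    exact hz.span _ ha
  · intro x hx b
    have h1 := hS x hx (y.symm b)
    rw [RingEquiv.apply_symm_apply] at h1
    have h2 := hev _ (hST x hx) (sg d f g N x.2 b)
    have h3 := hev _ (hST x hx) (sg d f g N x.2 (hz.res b))
    rw [sg_coe] at h2 h3
    rw [hz.res_coe] at h3
    have h4 : algebraMap (PowerSeries k) (FractionRing (PowerSeries k)) (ev x.1 (sg d f g N x.2 b)) =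
      algebraMap _ _ (PowerSeries.map (φ : k →+* k) (ev x.1 (sg d f g N x.2 (hz.res b)))) := by
      rw [h2, h1, ← hFr, h3]; rfl
    have h5 := congrArg PowerSeries.constantCoeff (hinjΛ h4)
    rw [h5, ← PowerSeries.coeff_zero_eq_constantCoeff_apply, ← PowerSeries.coeff_zero_eq_constantCoeff_apply, PowerSeries.coeff_map]
    exact (hφ _).symm

open Classical in
lemma GoodPair.core (H : GoodPair d f g) (N M : ℕ) [IsSplittingField (RatFunc k) K (PT d f g N)]
    [Fintype (K ≃ₐ[RatFunc k] K)] (h2 : (2 : k) ≠ 0) (hN : M * (d * M).factorial < N)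
    (hSw : ∀ i < N, SwapData d f g (i + 1))
    (p : ℕ) [Fact p.Prime] [CharP k p] (e₁ e₂ : ℕ)
    (φ : k ≃+* k) (hφ : ∀ c, φ c = c ^ (p ^ e₁ * p ^ e₂))
    (hf : f.map (φ : k →+* k) = f) (hg : g.map (φ : k →+* k) = g)
    (T : Finset k) (hT : ∀ τ ∈ T, GoodTau d f g N τ ∧ φ τ = τ ∧
      ∃ x, φ x = x ∧ (PP (RingHom.id k) τ (itP d f g N).1 (itP d f g N).2).eval x = 0)
    (D : ℕ) (hD : Fintype.card (K ≃ₐ[RatFunc k] K) = D)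
    (m₀ l₀ : ℕ) (hdim : D * ((m₀ + D) * p ^ e₁ + (l₀ + D)) + 1 < D ^ 2 * (m₀ + 1) * (l₀ + 1))
    (hP : D * (m₀ + D) < p ^ e₂) :
    M * T.card ≤ 2 * (D * ((m₀ + D) + (l₀ + D) * p ^ e₂)) := by
  have hd := H.hd
  rcases T.eq_empty_or_nonempty with rfl | ⟨τ₀, hτ₀⟩
  · simp
  have hinjΛ := IsFractionRing.injective (PowerSeries k) (FractionRing (PowerSeries k))
  obtain ⟨Fr, hFr⟩ := exists_Fr (φ : k →+* k)
  have hex : ∀ τ : k, ∃ (ι : K →+* FractionRing (PowerSeries k)) (ev : AA K d f g N →ₐ[k] PowerSeries k), τ ∈ T →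
      (∀ c, ι (algebraMap k K c) = cL k c) ∧ ι (TT k K) = algebraMap _ _ (PowerSeries.C τ + PowerSeries.X) ∧
      ∀ a, algebraMap (PowerSeries k) (FractionRing (PowerSeries k)) (ev a) = ι a := by
    intro τ
    by_cases hτ : τ ∈ T
    · obtain ⟨ι, ev, h⟩ := H.exists_ev (K := K) N τ (hT τ hτ).1
      exact ⟨ι, ev, fun _ => h⟩
    · obtain ⟨ι, ev, h⟩ := H.exists_ev (K := K) N τ₀ (hT τ₀ hτ₀).1
      exact ⟨ι, ev, fun h => absurd h hτ⟩
  choose ι ev hιev using hex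
  obtain ⟨y0, hy0c, hy0T, -⟩ := H.exists_frob N φ hf hg Fr hFr τ₀ (hT τ₀ hτ₀).2.1 (ι τ₀) (hιev τ₀ hτ₀).1 (hιev τ₀ hτ₀).2.1 1
  have hfrob : ∀ (τ : k) (ω : K ≃ₐ[RatFunc k] K), ∃ s : K ≃ₐ[RatFunc k] K, τ ∈ T → ∀ x, ι τ (ω (s (y0 x))) = Fr (ι τ (ω x)) := by
    intro τ ω
    by_cases hτ : τ ∈ T
    · obtain ⟨y, hyc, hyT, hy⟩ := H.exists_frob N φ hf hg Fr hFr τ (hT τ hτ).2.1 (ι τ) (hιev τ hτ).1 (hιev τ hτ).2.1 ω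
      obtain ⟨s, hs⟩ := algEquiv_of (k := k) (y0.symm.trans y) (fun c => by
        have : y0.symm (algebraMap k K c) = algebraMap k K (φ.symm c) := by
          rw [RingEquiv.symm_apply_eq, hy0c, RingEquiv.apply_symm_apply]
        rw [RingEquiv.trans_apply, this, hyc, RingEquiv.apply_symm_apply]) (by
        have : y0.symm (TT k K) = TT k K := by rw [RingEquiv.symm_apply_eq, hy0T]
        rw [RingEquiv.trans_apply, this, hyT])
      refine ⟨s, fun _ x => ?_⟩
      rw [hs, RingEquiv.trans_apply, RingEquiv.symm_apply_apply, hy]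
    · exact ⟨1, fun h => absurd h hτ⟩
  choose s hs using hfrob
  let B := Finset.univ.filter (fun s : K ≃ₐ[RatFunc k] K => ∃ x ∈ Om K f g N, s (y0 x) = x)
  have hcnt : M * B.card ≤ 2 * Fintype.card (K ≃ₐ[RatFunc k] K) :=
    H.cnt_bound N M h2 hN hSw y0 (fun i x hx => H.twist_Om (φ : k →+* k) hf hg (y0 : K →+* K) hy0c hy0T i x hx)
      (fun x => twist_psi (φ : k →+* k) hf hg (y0 : K →+* K) hy0c x)
  have hmaps : ∀ x ∈ T ×ˢ (Finset.univ : Finset (K ≃ₐ[RatFunc k] K)), s x.1 x.2 ∈ B := by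
    rintro ⟨τ, ω⟩ hx
    have hτ : τ ∈ T := (Finset.mem_product.mp hx).1
    obtain ⟨hgood, hφτ, x, hx1, hx2⟩ := hT τ hτ
    -- lift the rational point
    let P := PP (PowerSeries.C : k →+* PowerSeries k) (PowerSeries.C τ + PowerSeries.X) (itP d f g N).1 (itP d f g N).2
    have hcc : PowerSeries.constantCoeff (PowerSeries.C τ + PowerSeries.X : PowerSeries k) = τ := by simp
    have hPm : P.map PowerSeries.constantCoeff = PP (RingHom.id k) τ (itP d f g N).1 (itP d f g N).2 := by
      rw [PP_ser_const, hcc]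
    have hder : eval x (derivative (P.map PowerSeries.constantCoeff)) ≠ 0 := by
      rw [hPm]
      have := hgood.2.eval₂_derivative_ne_zero (RingHom.id k) (x := x) (by simpa [eval₂_id] using! hx2)
      simpa using! this
    obtain ⟨r, hr1, hr2⟩ := hensel_exists P x (by rw [hPm]; exact hx2) hder
    obtain ⟨h1, h2'⟩ := itP_twist (φ : k →+* k) hf hg d N
    have hr3 : eval (PowerSeries.map (φ : k →+* k) r) P = 0 := by
      have h3 := congrArg (PowerSeries.map (φ : k →+* k)) hr2
      rw [map_zero, PP_eval, map_sub, map_mul, hom_eval₂, hom_eval₂, map_add, PowerSeries.map_C, PowerSeries.map_X,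
        show (φ : k →+* k) τ = τ from hφτ] at h3
      have e : (PowerSeries.map (φ : k →+* k)).comp (PowerSeries.C : k →+* PowerSeries k) = (PowerSeries.C : k →+* PowerSeries k).comp (φ : k →+* k) := by
        ext c : 1
        simp
      rw [e, ← eval₂_map, ← eval₂_map, h1, h2'] at h3
      rw [PP_eval]; exact h3
    have hfix : PowerSeries.map (φ : k →+* k) r = r := by
      have hc : PowerSeries.constantCoeff (PowerSeries.map (φ : k →+* k) r) = x := by
        rw [← PowerSeries.coeff_zero_eq_constantCoeff_apply, PowerSeries.coeff_map, PowerSeries.coeff_zero_eq_constantCoeff_apply, hr1]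
        exact hx1
      exact hensel_unique P _ _ hr3 hr2 (by rw [hc, hr1]) (by rw [hc]; exact hder)
    let j : K →+* FractionRing (PowerSeries k) := (ι τ).comp (ω : K →+* K)
    have hj : j.comp (algebraMap k K) = cL k := by
      ext c
      show ι τ (ω _) = _
      rw [gal_alg, (hιev τ hτ).1]
    have hjT : j (TT k K) = algebraMap _ _ (PowerSeries.C τ + PowerSeries.X) := by
      show ι τ (ω _) = _
      rw [ω.commutes]; exact (hιev τ hτ).2.1
    obtain ⟨ρ, hρ1, hρ2⟩ := H.Om_emb N N le_rfl (H.Om_nonempty N) j (algebraMap _ _ r) (by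
      rw [hj, hjT]
      have h3 : PP (cL k) (algebraMap (PowerSeries k) (FractionRing (PowerSeries k)) (PowerSeries.C τ + PowerSeries.X)) (itP d f g N).1 (itP d f g N).2
        = P.map (algebraMap _ _) := by rw [PP_map]
      rw [h3, eval_map, eval₂_at_apply, hr2, map_zero])
    refine Finset.mem_filter.mpr ⟨Finset.mem_univ _, ρ, hρ1, ?_⟩
    apply j.injective
    have h4 := hs τ ω hτ ρ
    have h5 : Fr (j ρ) = j ρ := by rw [hρ2, hFr, hfix]
    exact h4.trans h5
  have hcard := Finset.card_le_mul_card_image_of_maps_to (f := fun x : k × (K ≃ₐ[RatFunc k] K) => s x.1 x.2) hmaps (D * ((m₀ + D) + (l₀ + D) * p ^ e₂)) (by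
    intro b hb
    refine H.step_bound N p e₁ e₂ φ hφ hf hg Fr hFr ι ev T (fun τ hτ => (hιev τ hτ).2.1) (fun τ hτ => (hιev τ hτ).2.2)
      (y0.trans b.toRingEquiv) ?_ ?_ _ ?_ ?_ D hD m₀ l₀ hdim hP
    · intro c
      show b (y0 _) = _
      rw [hy0c, gal_alg]
    · show b (y0 _) = _
      rw [hy0T, b.commutes]
    · intro x hx
      exact (Finset.mem_product.mp (Finset.mem_filter.mp hx).1).1
    · intro x hx a
      obtain ⟨hx1, hx2⟩ := Finset.mem_filter.mp hx
      have := hs x.1 x.2 (Finset.mem_product.mp hx1).1 a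
      rw [hx2] at this
      exact this)
  rw [Finset.card_product, Finset.card_univ, hD] at hcard
  rw [hD] at hcnt
  have hD0 : 0 < D := by rw [← hD]; exact Fintype.card_pos
  set E := D * ((m₀ + D) + (l₀ + D) * p ^ e₂)
  have : D * (M * T.card) ≤ D * (2 * E) := by nlinarith
  exact Nat.le_of_mul_le_mul_left this hD0

end Core
end APP


namespace APP
section Bnd
variable {k : Type*} [Field k] [IsAlgClosed k]
variable {d : ℕ} {f g : k[X]}

lemma GoodPair.bad_tau (H : GoodPair d f g) (N : ℕ) (T : Finset k) (hT : ∀ τ ∈ T, ¬ GoodTau d f g N τ) :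
    T.card ≤ 2 * d ^ N + 1 := by
  classical
  have hd := H.hd
  obtain ⟨ha, hb⟩ := natDegree_itP_le d f g N (by omega)
  have htop := itP_top d (by omega) f g H.hf H.hg H.cop (Or.inr H.hgd) N
  have hcop := itP_coprime d f g H.hf H.hg H.cop (Or.inr H.hgd) N
  have hirr := H.PT_irred N
  have hsep := H.PT_sep N
  set a := (itP d f g N).1 with hadef
  set b := (itP d f g N).2 with hbdef
  let W := derivative a * b - a * derivative b
  have hW : W ≠ 0 := by
    intro hW
    have h1 : derivative a * b = a * derivative b := sub_eq_zero.mp hW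
    have key : ∀ u v : k[X], IsCoprime u v → derivative u * v = u * derivative v → derivative u = 0 := by
      intro u v huv h
      have hdvd : u ∣ derivative u := huv.dvd_of_dvd_mul_right (Dvd.intro _ h.symm)
      by_contra h0
      have hu : u.natDegree ≠ 0 := by
        intro h
        rw [natDegree_eq_zero] at h
        obtain ⟨c, rfl⟩ := h
        simp at h0
      have := natDegree_le_of_dvd hdvd h0
      have := natDegree_derivative_lt hu
      omega
    have ha' := key a b hcop h1
    have hb' := key b a hcop.symm (by rw [mul_comm, ← h1, mul_comm])
    have : derivative (PT d f g N) = 0 := by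
      rw [PT, PP, derivative_sub, derivative_C_mul, derivative_map, derivative_map, ← hadef, ← hbdef, ha', hb']
      simp
    rw [Separable, this, isCoprime_zero_right] at hsep
    exact hirr.not_isUnit hsep
  have hWdeg : W.natDegree ≤ 2 * d ^ N := by
    have h1 := natDegree_derivative_le a
    have h2 := natDegree_derivative_le b
    refine (natDegree_sub_le_of_le natDegree_mul_le natDegree_mul_le).trans ?_
    rw [max_le_iff]
    constructor <;> omega
  have hsub : T ⊆ insert (a.coeff (d ^ N) / b.coeff (d ^ N)) (W.roots.toFinset.image (fun x => eval x a / eval x b)) := by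
    intro τ hτ
    have hbad := hT τ hτ
    rw [GoodTau, not_and_or] at hbad
    rw [Finset.mem_insert]
    rcases hbad with hbad | hbad
    · left
      have hle := PP_natDegree_le (RingHom.id k) τ a b _ ha hb
      have h0 : (PP (RingHom.id k) τ a b).coeff (d ^ N) = 0 :=
        coeff_eq_zero_of_natDegree_lt (lt_of_le_of_ne hle hbad)
      rw [PP_coeff] at h0
      simp only [RingHom.id_apply] at h0
      have hb0 : b.coeff (d ^ N) ≠ 0 := by
        intro hb0
        rw [hb0, mul_zero, sub_zero] at h0
        exact htop ⟨h0, hb0⟩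
      field_simp
      linear_combination -h0
    · right
      have : ∃ x, eval x (PP (RingHom.id k) τ a b) = 0 ∧ eval x (derivative (PP (RingHom.id k) τ a b)) = 0 := by
        by_contra hcon
        push Not at hcon
        apply hbad
        rw [Separable]
        rw [Polynomial.isCoprime_iff_aeval_ne_zero_of_isAlgClosed k k]
        intro x
        by_contra h
        push Not at h
        exact hcon x (by simpa using h.1) (by simpa using h.2)
      obtain ⟨x, h1, h2⟩ := this
      simp only [PP, Polynomial.map_id, eval_sub, eval_mul, eval_C, derivative_sub, derivative_C_mul] at h1 h2
      have hbx : eval x b ≠ 0 := by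
        intro hbx
        obtain ⟨u, v, huv⟩ := hcop
        have := congrArg (eval x) huv
        rw [hbx, mul_zero, sub_zero] at h1
        simp [h1, hbx] at this
      rw [Finset.mem_image]
      refine ⟨x, ?_, ?_⟩
      · rw [Multiset.mem_toFinset, mem_roots hW]
        simp only [W, IsRoot.def, eval_sub, eval_mul]
        linear_combination eval x b * h2 - eval x (derivative b) * h1
      · field_simp
        linear_combination h1
  refine (Finset.card_le_card hsub).trans ((Finset.card_insert_le _ _).trans ?_)
  have := (Finset.card_image_le (s := W.roots.toFinset) (f := fun x => eval x a / eval x b)).trans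
    ((Multiset.toFinset_card_le _).trans (card_roots' W))
  omega

lemma GoodPair.card_gal {K : Type*} [Field K] [Algebra k K] [Algebra (RatFunc k) K] [IsScalarTower k (RatFunc k) K]
    (H : GoodPair d f g) (N : ℕ) [IsSplittingField (RatFunc k) K (PT d f g N)]
    [Fintype (K ≃ₐ[RatFunc k] K)] : Fintype.card (K ≃ₐ[RatFunc k] K) ≤ (d ^ N).factorial := by
  classical
  haveI := (H.Om_finite (K := K) N).fintype
  haveI : Normal (RatFunc k) K := Normal.of_isSplittingField (PT d f g N)
  have h1 := H.ncard_Om (K := K) N (H.Om_nonempty N) N le_rfl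
  rw [← Nat.card_coe_set_eq, Nat.card_eq_fintype_card] at h1
  rw [← h1, ← Fintype.card_perm]
  apply Fintype.card_le_of_injective (MulAction.toPermHom (K ≃ₐ[RatFunc k] K) (Om K f g N))
  rw [injective_iff_map_eq_one]
  intro s hs
  apply H.gal_ext N s
  intro x hx
  have := congrArg (fun e : Equiv.Perm (Om K f g N) => ((e ⟨x, hx⟩ : Om K f g N) : K)) hs
  exact this

lemma param (D P1 P2 : ℕ) (hD : 0 < D) (h1 : 2 * D ^ 2 < P1) (h2 : 2 * D ^ 2 < P2) :
    ∃ l0, D * ((D + D) * P1 + (l0 + D)) + 1 < D ^ 2 * (D + 1) * (l0 + 1) ∧ D * (D + D) < P2 ∧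
      D * ((D + D) + (l0 + D) * P2) ≤ 4 * (P1 * P2) := by
  refine ⟨2 * P1 / D + 1, ?_, by nlinarith, ?_⟩
  · have h3 : 2 * P1 + 1 ≤ D * (2 * P1 / D + 1) := Nat.lt_mul_div_succ (2 * P1) hD
    set l := 2 * P1 / D + 1
    have h4 : D * (2 * P1 + 1) ≤ D * (D * l) := Nat.mul_le_mul_left _ h3
    have h5 : D * (D * (2 * P1 + 1)) ≤ D * (D * (D * l)) := Nat.mul_le_mul_left _ h4
    have h6 : D * l ≤ D * (D * l) := Nat.le_mul_of_pos_left _ hD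
    have h7 : 0 < D * (D * D) := by positivity
    nlinarith
  · have h3 : D * (2 * P1 / D) ≤ 2 * P1 := Nat.mul_div_le _ _
    set l := 2 * P1 / D
    have h4 : D * l * P2 ≤ 2 * P1 * P2 := Nat.mul_le_mul_right _ h3
    have h5 : (2 * D ^ 2 + 1) * P2 ≤ P1 * P2 := Nat.mul_le_mul_right _ h1
    have h6 : D * P2 ≤ D ^ 2 * P2 := Nat.mul_le_mul_right _ (by nlinarith)
    nlinarith

end Bnd

lemma exists_split {k : Type} [Field k] (P : (RatFunc k)[X]) :
    ∃ (K : Type) (_ : Field K) (_ : Algebra k K) (_ : Algebra (RatFunc k) K) (_ : IsScalarTower k (RatFunc k) K),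
      IsSplittingField (RatFunc k) K P := by
  let A : Algebra k P.SplittingField :=
    ((algebraMap (RatFunc k) P.SplittingField).comp (algebraMap k (RatFunc k))).toAlgebra
  refine ⟨P.SplittingField, inferInstance, A, inferInstance, ?_, inferInstance⟩
  letI := A
  exact @IsScalarTower.of_algebraMap_eq k (RatFunc k) P.SplittingField _ _ _ _ _ A (fun c => rfl)

theorem image_bound (p n d N M : ℕ) [Fact p.Prime] (hp2 : p ≠ 2) (F : Type) [Field F] [Fintype F]
    (hF : Fintype.card F = p ^ n) (hn : 4 * ((d ^ N).factorial) ^ 2 + 2 ≤ n) (f g : F[X])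
    (H : GoodPair d (f.map (algebraMap F (AlgebraicClosure F))) (g.map (algebraMap F (AlgebraicClosure F))))
    (hN : M * (d * M).factorial < N)
    (hSw : ∀ i < N, SwapData d (f.map (algebraMap F (AlgebraicClosure F))) (g.map (algebraMap F (AlgebraicClosure F))) (i + 1))
    (T : Finset F) (hT : ∀ τ ∈ T, ∃ x : F, eval x (itP d f g N).1 = τ * eval x (itP d f g N).2) :
    M * T.card ≤ 8 * p ^ n + M * (2 * d ^ N + 1) := by
  classical
  let k := AlgebraicClosure F
  haveI : CharP F p := by
    have hn0 : n ≠ 0 := by omega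
    obtain ⟨p', hp'⟩ := CharP.exists F
    haveI := hp'
    obtain ⟨m, hp'', hm⟩ := FiniteField.card F p'
    have : p' ∣ p ^ n := by rw [← hF, hm]; exact dvd_pow_self _ m.ne_zero
    have := (Nat.prime_dvd_prime_iff_eq hp'' Fact.out).mp (hp''.dvd_of_dvd_pow this)
    rwa [← this]
  haveI : CharP k p := charP_of_injective_algebraMap (algebraMap F k).injective p
  haveI : ExpChar k p := ExpChar.prime Fact.out
  have h2 : (2 : k) ≠ 0 := by
    intro h
    have : ((2 : ℕ) : k) = 0 := by exact_mod_cast h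
    rw [CharP.cast_eq_zero_iff k p] at this
    exact hp2 ((Nat.prime_dvd_prime_iff_eq Fact.out Nat.prime_two).mp this)
  haveI : PerfectRing k p := PerfectField.toPerfectRing p
  let φ : k ≃+* k := iterateFrobeniusEquiv k p n
  have hφ : ∀ c, φ c = c ^ (p ^ n) := fun c => iterateFrobeniusEquiv_def k p n c
  have hφF : ∀ c : F, φ (algebraMap F k c) = algebraMap F k c := by
    intro c
    rw [hφ, ← map_pow, ← hF, FiniteField.pow_card]
  have hmap : ∀ q : F[X], (q.map (algebraMap F k)).map (φ : k →+* k) = q.map (algebraMap F k) := by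
    intro q
    rw [Polynomial.map_map]
    congr 1
    ext c
    exact hφF c
  obtain ⟨K, _, _, _, _, _⟩ := exists_split (PT d (f.map (algebraMap F k)) (g.map (algebraMap F k)) N)
  haveI : FiniteDimensional (RatFunc k) K := IsSplittingField.finiteDimensional K (PT d (f.map (algebraMap F k)) (g.map (algebraMap F k)) N)
  letI : Fintype (K ≃ₐ[RatFunc k] K) := Fintype.ofFinite _
  set B := (d ^ N).factorial
  obtain ⟨D, hD⟩ : ∃ D, Fintype.card (K ≃ₐ[RatFunc k] K) = D := ⟨_, rfl⟩
  have hDB : D ≤ B := hD ▸ H.card_gal (K := K) N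
  have hD0 : 0 < D := by rw [← hD]; exact Fintype.card_pos
  have hDB2 : D ^ 2 ≤ B ^ 2 := Nat.pow_le_pow_left hDB 2
  have hp1 : 1 < p := Nat.Prime.one_lt Fact.out
  have e2 : 2 * D ^ 2 < p ^ (2 * B ^ 2) := lt_of_le_of_lt (by omega) (Nat.lt_pow_self hp1)
  have e1 : 2 * D ^ 2 < p ^ (n - 2 * B ^ 2) := by
    refine lt_of_lt_of_le e2 (Nat.pow_le_pow_right hp1.le ?_)
    omega
  obtain ⟨l0, hl1, hl2, hl3⟩ := param D _ _ hD0 e1 e2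
  have hn2 : p ^ (n - 2 * B ^ 2) * p ^ (2 * B ^ 2) = p ^ n := by rw [← pow_add]; congr 1; omega
  let j : F ↪ k := ⟨algebraMap F k, (algebraMap F k).injective⟩
  let Tk := T.map j
  let Tg := Tk.filter (fun τ => GoodTau d (f.map (algebraMap F k)) (g.map (algebraMap F k)) N τ)
  let Tb := Tk.filter (fun τ => ¬ GoodTau d (f.map (algebraMap F k)) (g.map (algebraMap F k)) N τ)
  have hb : Tb.card ≤ 2 * d ^ N + 1 := H.bad_tau N Tb (fun τ hτ => (Finset.mem_filter.mp hτ).2)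
  have hg := H.core (K := K) N M h2 hN hSw p (n - 2 * B ^ 2) (2 * B ^ 2) φ (by rw [hn2]; exact hφ) (hmap f) (hmap g) Tg (by
    intro τ hτ
    obtain ⟨h1, h3⟩ := Finset.mem_filter.mp hτ
    obtain ⟨τ', hτ', rfl⟩ := Finset.mem_map.mp h1
    refine ⟨h3, hφF τ', ?_⟩
    obtain ⟨x, hx⟩ := hT τ' hτ'
    refine ⟨algebraMap F k x, hφF x, ?_⟩
    rw [itP_map, PP_eval, eval₂_id, eval₂_id, eval_map, eval_map, eval₂_at_apply, eval₂_at_apply, hx, map_mul]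
    exact sub_self _) D hD D l0 hl1 hl2
  rw [hn2] at hl3
  have hcard : T.card = Tg.card + Tb.card := by
    rw [← Finset.card_map j]
    exact (Finset.card_filter_add_card_filter_not _).symm
  rw [hcard]
  nlinarith

end APP


namespace APP
section Suff
variable {R S : Type*} [CommRing R] [CommRing S]

lemma homE_sub_C_mul (d : ℕ) (φ : R →+* S) (f g : R[X]) (z : R) (a b : S) :
    homE d φ (f - C z * g) a b = homE d φ f a b - φ z * homE d φ g a b := by
  rw [homE, homE, homE, Finset.mul_sum, ← Finset.sum_sub_distrib]
  refine Finset.sum_congr rfl fun j hj => ?_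
  simp only [coeff_sub, coeff_C_mul, map_sub, map_mul]
  ring

lemma homE_X_sub_C_mul (d : ℕ) (φ : R →+* S) (P : R[X]) (hP : P.natDegree ≤ d) (w : R) (a b : S) :
    homE (d + 1) φ ((X - C w) * P) a b = (a - φ w * b) * homE d φ P a b := by
  have h1 : homE (d + 1) φ (X * P) a b = a * homE d φ P a b := by
    rw [homE, Finset.sum_range_succ', homE, Finset.mul_sum]
    simp only [coeff_X_mul, mul_coeff_zero, coeff_X_zero, zero_mul, map_zero, add_zero]
    refine Finset.sum_congr rfl fun j hj => ?_
    rw [Nat.add_sub_add_right]; ring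
  have h2 : homE (d + 1) φ P a b = b * homE d φ P a b := by
    rw [homE, Finset.sum_range_succ, coeff_eq_zero_of_natDegree_lt (by omega), homE, Finset.mul_sum]
    simp only [map_zero, zero_mul, add_zero]
    refine Finset.sum_congr rfl fun j hj => ?_
    have := Finset.mem_range.mp hj
    rw [show d + 1 - j = (d - j) + 1 by omega]; ring
  rw [sub_mul, homE_sub_C_mul, h1, h2]; ring

lemma homE_prod {k : Type*} [Field k] (φ : k →+* S) (l : k) (s : Finset k) (a b : S) :
    homE s.card φ (C l * ∏ w ∈ s, (X - C w)) a b = φ l * ∏ w ∈ s, (a - φ w * b) := by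
  classical
  induction s using Finset.induction_on with
  | empty => simp [homE]
  | insert w s hw ih =>
    rw [Finset.card_insert_of_notMem hw, Finset.prod_insert hw, mul_left_comm, homE_X_sub_C_mul, ih,
      Finset.prod_insert hw]
    · ring
    · refine (natDegree_C_mul_le _ _).trans ?_
      rw [natDegree_prod_of_monic _ _ (fun w _ => monic_X_sub_C w)]
      simp

variable {k : Type*} [Field k] [IsAlgClosed k] {d : ℕ} {f g : k[X]}

lemma fact (z : k) (hdeg : (f - C z * g).natDegree = d) (hsep : (f - C z * g).Separable) :
    ∃ (l : k) (s : Finset k), l ≠ 0 ∧ s.card = d ∧ ∀ a b : k[X],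
      homE d C f a b - C z * homE d C g a b = C l * ∏ w ∈ s, (a - C w * b) := by
  classical
  set P := f - C z * g with hP
  have hP0 : P ≠ 0 := hsep.ne_zero
  have hspl : P.Splits := IsAlgClosed.splits P
  have hnd : P.roots.Nodup := nodup_roots hsep
  have hcard : P.roots.toFinset.card = d := by
    rw [Multiset.toFinset_card_of_nodup hnd, ← hdeg]
    exact (hspl.natDegree_eq_card_roots).symm
  refine ⟨P.leadingCoeff, P.roots.toFinset, leadingCoeff_ne_zero.mpr hP0, hcard, ?_⟩
  intro a b
  rw [← homE_sub_C_mul, ← hP]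
  have := hspl.eq_prod_roots
  have h2 : P = C P.leadingCoeff * ∏ w ∈ P.roots.toFinset, (X - C w) := by
    conv_lhs => rw [this]
    rw [Finset.prod_eq_multiset_prod, Multiset.toFinset_val, Multiset.dedup_eq_self.mpr hnd]
  have h3 := homE_prod C P.leadingCoeff P.roots.toFinset a b
  rw [hcard, ← h2] at h3
  exact h3

lemma GoodPair.no_common (H : GoodPair d f g) (x : k) (n : ℕ) :
    ¬ (eval x (itP d f g n).1 = 0 ∧ eval x (itP d f g n).2 = 0) := by
  have := itP_no_common_root (RingHom.id k) d f g H.hf H.hg H.cop (Or.inr H.hgd) x n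
  simpa [eval₂_id] using this

lemma itP_fact (z : k) (l : k) (s : Finset k)
    (h : ∀ a b : k[X],
      homE d C f a b - C z * homE d C g a b = C l * ∏ w ∈ s, (a - C w * b)) (m : ℕ) :
    PP (RingHom.id k) z (itP d f g (m+1)).1 (itP d f g (m+1)).2 =
      C l * ∏ w ∈ s, PP (RingHom.id k) w (itP d f g m).1 (itP d f g m).2 := by
  have := h (itP d f g m).1 (itP d f g m).2
  simpa [PP, itP] using this

lemma itP_fact_eval (z : k) (l : k) (s : Finset k)
    (h : ∀ a b : k[X],
      homE d C f a b - C z * homE d C g a b = C l * ∏ w ∈ s, (a - C w * b)) (m : ℕ) (x w : k) (hw : w ∈ s)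
    (hx : eval x (itP d f g m).1 = w * eval x (itP d f g m).2) :
    eval x (itP d f g (m+1)).1 = z * eval x (itP d f g (m+1)).2 := by
  have := congrArg (eval x) (itP_fact z l s h m)
  simp only [PP, Polynomial.map_id, eval_sub, eval_mul, eval_C, RingHom.id_apply, eval_prod] at this
  rw [Finset.prod_eq_zero hw (by rw [hx, sub_self]), mul_zero] at this
  exact sub_eq_zero.mp this

lemma GoodPair.PP_coprime (H : GoodPair d f g) (m : ℕ) (w w' : k) (h : w ≠ w') :
    IsCoprime (PP (RingHom.id k) w (itP d f g m).1 (itP d f g m).2)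
      (PP (RingHom.id k) w' (itP d f g m).1 (itP d f g m).2) := by
  rw [Polynomial.isCoprime_iff_aeval_ne_zero_of_isAlgClosed k k]
  intro x
  by_contra hc
  push Not at hc
  simp only [coe_aeval_eq_eval, PP_eval, eval₂_id] at hc
  obtain ⟨h1, h2⟩ := hc
  have h3 : (w - w') * eval x (itP d f g m).2 = 0 := by linear_combination h2 - h1
  have h4 := (mul_eq_zero.mp h3).resolve_left (sub_ne_zero.mpr h)
  rw [h4, mul_zero, sub_zero] at h1
  exact H.no_common x m ⟨h1, h4⟩

lemma goodTau_one (hd : 1 ≤ d) (hf : f.natDegree ≤ d) (hg : g.natDegree ≤ d) (z : k) (h : GoodTau d f g 1 z) :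
    (f - C z * g).natDegree = d ∧ (f - C z * g).Separable := by
  have e : ∀ q : k[X], q.natDegree ≤ d → homE d C q X 1 = q := by
    intro q hq
    rw [homE_one d C q hq, eval₂_C_X]
  have e2 : PP (RingHom.id k) z (itP d f g 1).1 (itP d f g 1).2 = f - C z * g := by
    simp [PP, itP, e f hf, e g hg]
  rw [GoodTau, e2, pow_one] at h
  exact h

lemma GoodPair.sep_crit (H : GoodPair d f g) (m : ℕ) (z : k)
    (h : ∀ u, ¬ GoodTau d f g 1 u → ∀ l < m, eval u (itP d f g l).1 ≠ z * eval u (itP d f g l).2) :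
    GoodTau d f g m z := by
  have hd := H.hd
  induction m generalizing z with
  | zero =>
    simp only [GoodTau, itP, PP, Polynomial.map_X, Polynomial.map_one, mul_one, pow_zero]
    exact ⟨natDegree_X_sub_C z, separable_X_sub_C⟩
  | succ m ih =>
    have hz : GoodTau d f g 1 z := by
      by_contra hz
      exact h z hz 0 (by omega) (by simp [itP])
    obtain ⟨h1, h2⟩ := goodTau_one (by omega) H.hf H.hg z hz
    obtain ⟨l, s, hl, hs, hfac⟩ := fact z h1 h2
    have hw : ∀ w ∈ s, GoodTau d f g m w := by
      intro w hw
      apply ih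
      intro u hu i hi hcon
      exact h u hu (i+1) (by omega) (itP_fact_eval z l s hfac i u w hw hcon)
    have key := itP_fact z l s hfac m
    rw [GoodTau, key]
    constructor
    · rw [natDegree_C_mul hl, natDegree_prod _ _ (fun w h => (hw w h).2.ne_zero),
        Finset.sum_congr rfl (fun w h => (hw w h).1)]
      simp [hs, pow_succ']
    · refine Separable.unit_mul (isUnit_C.mpr hl.isUnit) ?_
      refine separable_prod' ?_ (fun w h => (hw w h).2)
      intro w _ w' _ hne
      exact H.PP_coprime m w w' hne

lemma GoodPair.swap_crit (H : GoodPair d f g) (N : ℕ) (v c : k) (V : k[X])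
    (hV : f - C v * g = (X - C c) ^ 2 * V) (hdeg : (f - C v * g).natDegree = d) (hsep : V.Separable)
    (hc : eval c V ≠ 0) (hfin : ∀ i < N, eval v (itP d f g i).2 ≠ 0)
    (h : ∀ i < N, ∀ u, ¬ GoodTau d f g 1 u → ∀ l ≤ i, (l = i → u ≠ v) →
      eval v (itP d f g i).1 * eval u (itP d f g l).2 ≠ eval u (itP d f g l).1 * eval v (itP d f g i).2) :
    ∀ i < N, SwapData d f g (i + 1) := by
  classical
  have hd := H.hd
  have e : ∀ q : k[X], q.natDegree ≤ d → homE d C q X 1 = q := by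
    intro q hq
    rw [homE_one d C q hq, eval₂_C_X]
  have main : ∀ i < N, ∃ V,
    APP.PP (RingHom.id k) (eval v (itP d f g i).1 / eval v (itP d f g i).2) (APP.itP d f g (i+1)).1 (APP.itP d f g (i+1)).2 = (Polynomial.X - Polynomial.C c) ^ 2 * V ∧
      (APP.PP (RingHom.id k) (eval v (itP d f g i).1 / eval v (itP d f g i).2) (APP.itP d f g (i+1)).1 (APP.itP d f g (i+1)).2).natDegree = d ^ (i+1) ∧
        V.Separable ∧ Polynomial.eval c V ≠ 0 := by
    intro i
    induction i with
    | zero =>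
      intro _
      have e2 : PP (RingHom.id k) (eval v (itP d f g 0).1 / eval v (itP d f g 0).2) (itP d f g (0+1)).1 (itP d f g (0+1)).2 = f - C v * g := by
        simp [PP, itP, e f H.hf, e g H.hg]
      refine ⟨V, ?_, ?_, hsep, hc⟩
      · rw [e2, hV]
      · rw [e2, hdeg]; simp
    | succ i ih =>
      intro hi
      obtain ⟨V', hV', hdeg', hsep', hc'⟩ := ih (by omega)
      set y := eval v (itP d f g i).1 / eval v (itP d f g i).2 with hy
      set z := eval v (itP d f g (i+1)).1 / eval v (itP d f g (i+1)).2 with hz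
      have hgi := hfin i (by omega)
      have hgi1 := hfin (i+1) hi
      have hyi : eval v (itP d f g i).1 = y * eval v (itP d f g i).2 := by rw [hy]; field_simp
      have hzi : eval v (itP d f g (i+1)).1 = z * eval v (itP d f g (i+1)).2 := by rw [hz]; field_simp
      have hgt : GoodTau d f g 1 z := by
        by_contra hgt
        refine h (i+1) hi z hgt 0 (by omega) (by omega) ?_
        rw [hzi, show itP d f g 0 = (X, 1) from rfl]
        simp
      obtain ⟨h1, h2⟩ := goodTau_one (by omega) H.hf H.hg z hgt
      obtain ⟨l, s, hl, hs, hfac⟩ := fact z h1 h2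
      have key := itP_fact z l s hfac (i+1)
      have hys : y ∈ s := by
        have := congrArg (eval v) (itP_fact z l s hfac i)
        simp only [PP, Polynomial.map_id, eval_sub, eval_mul, eval_C, RingHom.id_apply, eval_prod] at this
        rw [hzi, sub_self, eq_comm, mul_eq_zero] at this
        have := this.resolve_left hl
        rw [Finset.prod_eq_zero_iff] at this
        obtain ⟨w, hw, hw2⟩ := this
        have : y = w := by
          rw [hyi, ← sub_mul] at hw2
          exact sub_eq_zero.mp ((mul_eq_zero.mp hw2).resolve_right hgi)
        rwa [this]
      have hw : ∀ w ∈ s.erase y, GoodTau d f g (i+1) w := by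
        intro w hw
        obtain ⟨hwy, hws⟩ := Finset.mem_erase.mp hw
        apply H.sep_crit
        intro u hu j hj hcon
        have h3 := itP_fact_eval z l s hfac j u w hws hcon
        by_cases hex : j = i ∧ u = v
        · obtain ⟨rfl, rfl⟩ := hex
          rw [hyi] at hcon
          exact hwy (mul_right_cancel₀ hgi hcon).symm
        · refine h (i+1) hi u hu (j+1) (by omega) (fun hji hu => hex ⟨by omega, hu⟩) ?_
          rw [hzi, h3]; ring
      rw [← Finset.mul_prod_erase s _ hys, hV'] at key
      set Q := ∏ w ∈ s.erase y, PP (RingHom.id k) w (itP d f g (i+1)).1 (itP d f g (i+1)).2 with hQ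
      have hQcop : IsCoprime ((X - C c) ^ 2 * V') Q := by
        rw [hQ]
        apply IsCoprime.prod_right
        intro w hw
        rw [← hV']
        exact H.PP_coprime (i+1) y w (Finset.mem_erase.mp hw).1.symm
      have hQsep : Q.Separable := by
        refine separable_prod' ?_ (fun w h => (hw w h).2)
        intro w _ w' _ hne
        exact H.PP_coprime _ w w' hne
      refine ⟨C l * (V' * Q), ?_, ?_, ?_, ?_⟩
      · rw [key]; ring
      · rw [key, natDegree_C_mul hl, natDegree_mul ?_ hQsep.ne_zero, ← hV', hdeg', hQ,
          natDegree_prod _ _ (fun w h => (hw w h).2.ne_zero),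
          Finset.sum_congr rfl (fun w h => (hw w h).1), Finset.sum_const, Finset.card_erase_of_mem hys, hs, smul_eq_mul,
          pow_succ' d (i+1)]
        · obtain ⟨d', rfl⟩ : ∃ d', d = d' + 1 := ⟨d - 1, by omega⟩
          simp only [Nat.add_sub_cancel]; ring
        · exact mul_ne_zero (pow_ne_zero _ (X_sub_C_ne_zero c)) hsep'.ne_zero
      · refine Separable.unit_mul (isUnit_C.mpr hl.isUnit) ?_
        exact hsep'.mul hQsep hQcop.of_mul_left_right
      · rw [eval_mul, eval_C, eval_mul]
        refine mul_ne_zero hl (mul_ne_zero hc' ?_)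
        intro hQc
        obtain ⟨a, b, hab⟩ := hQcop
        have := congrArg (eval c) hab
        simp [hQc] at this
  intro i hi
  obtain ⟨V, hV⟩ := main i hi
  exact ⟨_, c, V, hV⟩

end Suff
end APP


namespace APP
section St2
variable {k : Type*} [Field k] {d : ℕ} {f g : k[X]}

lemma homE_add_C_mul {R S : Type*} [CommRing R] [CommRing S] (d : ℕ) (φ : R →+* S) (f g : R[X]) (z : R) (a b : S) :
    homE d φ (f + C z * g) a b = homE d φ f a b + φ z * homE d φ g a b := by
  rw [homE, homE, homE, Finset.mul_sum, ← Finset.sum_add_distrib]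
  refine Finset.sum_congr rfl fun j hj => ?_
  simp only [coeff_add, coeff_C_mul, map_add, map_mul]
  ring

/-- orbit of `u + σ` under `f / g + σ`, as polynomials in `σ` -/
noncomputable def AB (d : ℕ) (f g : k[X]) (u : k) : ℕ → k[X] × k[X]
  | 0 => (C u + X, 1)
  | n + 1 => (homE d C f (AB d f g u n).1 (AB d f g u n).2 + X * homE d C g (AB d f g u n).1 (AB d f g u n).2,
      homE d C g (AB d f g u n).1 (AB d f g u n).2)

lemma AB_eval (u σ : k) (n : ℕ) :
    eval (u + σ) (itP d (f + C σ * g) g n).1 = eval σ (AB d f g u n).1 ∧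
    eval (u + σ) (itP d (f + C σ * g) g n).2 = eval σ (AB d f g u n).2 := by
  induction n with
  | zero => simp [itP, AB]
  | succ n ih =>
    obtain ⟨h1, h2⟩ := eval₂_itP_succ d (f + C σ * g) g (RingHom.id k) (u + σ) n
    simp only [eval₂_id] at h1 h2
    have hc : (evalRingHom σ).comp (C : k →+* k[X]) = RingHom.id k := by ext; simp
    have h3 := fun q : k[X] => map_homE d (C : k →+* k[X]) (evalRingHom σ) q (AB d f g u n).1 (AB d f g u n).2
    simp only [hc, coe_evalRingHom] at h3
    rw [h1, h2, ih.1, ih.2, homE_add_C_mul]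
    simp only [AB, eval_add, eval_mul, eval_X, h3]
    exact ⟨rfl, trivial⟩

lemma AB_deg (u : k) (n : ℕ) : (AB d f g u n).1.natDegree ≤ (d + 1) ^ n ∧ (AB d f g u n).2.natDegree ≤ (d + 1) ^ n := by
  induction n with
  | zero =>
    simp only [AB, pow_zero, natDegree_one]
    exact ⟨natDegree_add_le_of_degree_le (by simp) natDegree_X_le, by simp⟩
  | succ n ih =>
    have h1 := natDegree_homE_le d _ f _ _ ih.1 ih.2
    have h2 := natDegree_homE_le d _ g _ _ ih.1 ih.2
    have h0 : 1 ≤ (d + 1) ^ n := Nat.one_le_pow _ _ (by omega)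
    have h3 : (d + 1) ^ (n + 1) = d * (d + 1) ^ n + (d + 1) ^ n := by ring
    simp only [AB]
    refine ⟨natDegree_add_le_of_degree_le (by omega) (natDegree_mul_le.trans ?_), by omega⟩
    have := natDegree_X_le (R := k)
    omega

lemma pow_div (x x' : PowerSeries k) (hx : PowerSeries.constantCoeff x = 0) (hx' : PowerSeries.constantCoeff x' = 0) (m : ℕ) :
    ∃ R : PowerSeries k, x ^ m - x' ^ m = (x - x') * R ∧ PowerSeries.constantCoeff R = if m = 1 then 1 else 0 := by
  induction m with
  | zero => exact ⟨0, by simp, by simp⟩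
  | succ m ih =>
    obtain ⟨R, h1, h2⟩ := ih
    refine ⟨x * R + x' ^ m, by linear_combination x * h1, ?_⟩
    rcases m with _ | m
    · simp [hx]
    · simp [hx, hx']

lemma homE_div (hd : 1 ≤ d) (f : k[X]) (x x' : PowerSeries k) (hx : PowerSeries.constantCoeff x = 0) (hx' : PowerSeries.constantCoeff x' = 0) :
    ∃ R : PowerSeries k, homE d PowerSeries.C f 1 x - homE d PowerSeries.C f 1 x' = (x - x') * R ∧
      PowerSeries.constantCoeff R = f.coeff (d - 1) := by
  choose R h1 h2 using pow_div x x' hx hx'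
  refine ⟨∑ j ∈ Finset.range (d + 1), PowerSeries.C (f.coeff j) * R (d - j), ?_, ?_⟩
  · rw [homE, homE, ← Finset.sum_sub_distrib, Finset.mul_sum]
    refine Finset.sum_congr rfl fun j hj => ?_
    linear_combination PowerSeries.C (f.coeff j) * h1 (d - j)
  · rw [map_sum, Finset.sum_eq_single (d - 1)]
    · rw [map_mul, h2, if_pos (by omega)]; simp
    · intro j hj hne
      have := Finset.mem_range.mp hj
      rw [map_mul, h2, if_neg (by omega), mul_zero]
    · intro h
      exact absurd (Finset.mem_range.mpr (by omega)) h

lemma homE_const (f : k[X]) (x : PowerSeries k) (hx : PowerSeries.constantCoeff x = 0) :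
    PowerSeries.constantCoeff (homE d PowerSeries.C f 1 x) = f.coeff d := by
  have := map_homE d (PowerSeries.C : k →+* PowerSeries k) PowerSeries.constantCoeff f 1 x
  rw [this, hx, map_one, homE_zero_right]
  simp

lemma homE_inj (hd : 1 ≤ d) (hκ : f.coeff (d - 1) * g.coeff d ≠ f.coeff d * g.coeff (d - 1))
    (x x' : PowerSeries k) (hx : PowerSeries.constantCoeff x = 0) (hx' : PowerSeries.constantCoeff x' = 0)
    (h : homE d PowerSeries.C f 1 x * homE d PowerSeries.C g 1 x' = homE d PowerSeries.C f 1 x' * homE d PowerSeries.C g 1 x) :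
    x = x' := by
  obtain ⟨R, h1, h2⟩ := homE_div hd f x x' hx hx'
  obtain ⟨R', h1', h2'⟩ := homE_div hd g x x' hx hx'
  have h3 : (x - x') * (R * homE d PowerSeries.C g 1 x' - homE d PowerSeries.C f 1 x' * R') = 0 := by
    linear_combination -homE d PowerSeries.C g 1 x' * h1 + homE d PowerSeries.C f 1 x' * h1' + h
  rcases mul_eq_zero.mp h3 with h4 | h4
  · exact sub_eq_zero.mp h4
  · exfalso
    have := congrArg PowerSeries.constantCoeff h4
    rw [map_sub, map_mul, map_mul, h2, h2', homE_const _ _ hx', homE_const _ _ hx', map_zero] at this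
    exact hκ (sub_eq_zero.mp this)

noncomputable def xs (d : ℕ) (f g : k[X]) (u : k) : ℕ → PowerSeries k
  | 0 => PowerSeries.X * (1 + PowerSeries.C u * PowerSeries.X)⁻¹
  | n + 1 => PowerSeries.X * homE d PowerSeries.C g 1 (xs d f g u n) *
      (homE d PowerSeries.C g 1 (xs d f g u n) + PowerSeries.X * homE d PowerSeries.C f 1 (xs d f g u n))⁻¹

lemma xs_const (u : k) (n : ℕ) : PowerSeries.constantCoeff (xs d f g u n) = 0 := by
  cases n <;> simp [xs]

lemma xs_zero (u : k) : xs d f g u 0 * (1 + PowerSeries.C u * PowerSeries.X) = PowerSeries.X := by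
  rw [xs, mul_assoc, PowerSeries.inv_mul_cancel _ (by simp), mul_one]

lemma xs_succ (hg : g.coeff d ≠ 0) (u : k) (n : ℕ) : xs d f g u (n+1) *
    (homE d PowerSeries.C g 1 (xs d f g u n) + PowerSeries.X * homE d PowerSeries.C f 1 (xs d f g u n)) =
      PowerSeries.X * homE d PowerSeries.C g 1 (xs d f g u n) := by
  rw [xs, mul_assoc, PowerSeries.inv_mul_cancel _ ?_, mul_one]
  rw [map_add, homE_const _ _ (xs_const u n), map_mul]
  simpa using hg

lemma xs_den_ne (hg : g.coeff d ≠ 0) (u : k) (n : ℕ) : homE d PowerSeries.C g 1 (xs d f g u n) + PowerSeries.X * homE d PowerSeries.C f 1 (xs d f g u n) ≠ 0 := by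
  intro h
  have := congrArg PowerSeries.constantCoeff h
  rw [map_add, homE_const _ _ (xs_const u n), map_mul] at this
  simp at this
  exact hg this

lemma homE_g_ne (hg : g.coeff d ≠ 0) (u : k) (n : ℕ) : homE d PowerSeries.C g 1 (xs d f g u n) ≠ 0 := by
  intro h
  have := congrArg PowerSeries.constantCoeff h
  rw [homE_const _ _ (xs_const u n)] at this
  simp at this
  exact hg this

lemma xs_ne (hg : g.coeff d ≠ 0) (u : k) (n : ℕ) : xs d f g u n ≠ 0 := by
  intro h
  cases n with
  | zero =>
    have := xs_zero (d := d) (f := f) (g := g) u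
    rw [h, zero_mul] at this
    exact PowerSeries.X_ne_zero this.symm
  | succ n =>
    have := xs_succ (f := f) hg u n
    rw [h, zero_mul] at this
    exact mul_ne_zero PowerSeries.X_ne_zero (homE_g_ne hg u n) this.symm

lemma xs_base (hd : 1 ≤ d) (hg : g.coeff d ≠ 0) (hκ : f.coeff (d - 1) * g.coeff d ≠ f.coeff d * g.coeff (d - 1))
    (u v : k) (n : ℕ) : xs d f g u 0 ≠ xs d f g v (n + 1) := by
  intro h
  have h1 := xs_zero (d := d) (f := f) (g := g) u
  have h2 := xs_succ (f := f) hg v n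
  rw [h] at h1
  have hne := xs_ne (f := f) hg v (n+1)
  have hx := xs_const (d := d) (f := f) (g := g) v n
  have hx0 := xs_ne (f := f) hg v n
  have hX : (PowerSeries.X : PowerSeries k) ≠ 0 := PowerSeries.X_ne_zero
  set x := xs d f g v n
  set F := homE d PowerSeries.C f 1 x
  set G := homE d PowerSeries.C g 1 x
  have h3 : G + PowerSeries.X * F = (1 + PowerSeries.C u * PowerSeries.X) * G := by
    apply mul_left_cancel₀ hne
    linear_combination h2 - G * h1
  have h4 : F = PowerSeries.C u * G := by
    apply mul_left_cancel₀ hX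
    linear_combination h3
  have h5 : f.coeff d = u * g.coeff d := by
    have := congrArg PowerSeries.constantCoeff h4
    rw [map_mul, homE_const _ _ hx, homE_const _ _ hx] at this
    simpa using this
  apply hx0
  apply homE_inj hd hκ x 0 hx (map_zero _)
  rw [homE_zero_right, homE_zero_right]
  change F * _ = _ * G
  rw [h4, h5, map_mul]
  ring

lemma xs_inj (hd : 1 ≤ d) (hg : g.coeff d ≠ 0) (hκ : f.coeff (d - 1) * g.coeff d ≠ f.coeff d * g.coeff (d - 1))
    (u v : k) (i j : ℕ) (h : xs d f g u i = xs d f g v j) : i = j ∧ u = v := by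
  have hX : (PowerSeries.X : PowerSeries k) ≠ 0 := PowerSeries.X_ne_zero
  induction i generalizing j with
  | zero =>
    cases j with
    | zero =>
      refine ⟨rfl, ?_⟩
      have h1 := xs_zero (d := d) (f := f) (g := g) u
      have h2 := xs_zero (d := d) (f := f) (g := g) v
      rw [← h] at h2
      have h3 : PowerSeries.C u * PowerSeries.X = PowerSeries.C v * PowerSeries.X := by
        apply mul_left_cancel₀ (xs_ne (f := f) hg u 0)
        linear_combination h1 - h2
      exact PowerSeries.C_injective (mul_right_cancel₀ hX h3)
    | succ j => exact absurd h (xs_base hd hg hκ u v j)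
  | succ i ih =>
    cases j with
    | zero => exact absurd h.symm (xs_base hd hg hκ v u i)
    | succ j =>
      have h1 := xs_succ (f := f) hg u i
      have h2 := xs_succ (f := f) hg v j
      rw [← h] at h2
      have h3 := homE_inj hd hκ _ _ (xs_const u i) (xs_const v j) (by
        apply mul_left_cancel₀ (mul_ne_zero hX (xs_ne (f := f) hg u (i+1)))
        linear_combination homE d PowerSeries.C g 1 (xs d f g v j) * h1 - homE d PowerSeries.C g 1 (xs d f g u i) * h2)
      obtain ⟨rfl, rfl⟩ := ih j h3
      exact ⟨rfl, rfl⟩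

noncomputable def th (k : Type*) [Field k] : k[X] →+* FractionRing (PowerSeries k) :=
  eval₂RingHom ((algebraMap (PowerSeries k) (FractionRing (PowerSeries k))).comp PowerSeries.C)
    (algebraMap (PowerSeries k) (FractionRing (PowerSeries k)) PowerSeries.X)⁻¹

lemma th_AB (hg : g.coeff d ≠ 0) (u : k) (n : ℕ) :
    th k (AB d f g u n).1 * algebraMap (PowerSeries k) (FractionRing (PowerSeries k)) (xs d f g u n) = th k (AB d f g u n).2 ∧
      th k (AB d f g u n).1 ≠ 0 := by
  set ι := algebraMap (PowerSeries k) (FractionRing (PowerSeries k)) with hι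
  have hinj : Function.Injective ι := IsFractionRing.injective _ _
  have hX : ι PowerSeries.X ≠ 0 := by
    rw [Ne, map_eq_zero_iff ι hinj]
    exact PowerSeries.X_ne_zero
  have hthX : th k X = (ι PowerSeries.X)⁻¹ := by simp [th, hι]
  have hthC : ∀ c, th k (C c) = ι (PowerSeries.C c) := by intro c; simp [th, hι]
  have hthcomp : (th k).comp C = ι.comp PowerSeries.C := by ext c; exact hthC c
  induction n with
  | zero =>
    have h1 := congrArg ι (xs_zero (d := d) (f := f) (g := g) u)
    rw [map_mul, map_add, map_one, map_mul] at h1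
    simp only [AB, map_add, map_one, hthX, hthC]
    refine ⟨?_, ?_⟩
    · field_simp
      linear_combination h1
    · intro h
      have : ι PowerSeries.X * (ι (PowerSeries.C u) + (ι PowerSeries.X)⁻¹) = 0 := by rw [h, mul_zero]
      rw [mul_add, mul_inv_cancel₀ hX] at this
      have h0 : PowerSeries.X * PowerSeries.C u + 1 = (0 : PowerSeries k) := by
        apply hinj
        simpa using this
      have := congrArg PowerSeries.constantCoeff h0
      simp at this
  | succ n ih =>
    obtain ⟨h1, h2⟩ := ih
    have h3 : ∀ q : k[X], th k (homE d C q (AB d f g u n).1 (AB d f g u n).2) =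
        (th k (AB d f g u n).1) ^ d * ι (homE d PowerSeries.C q 1 (xs d f g u n)) := by
      intro q
      rw [map_homE, map_homE, ← homE_smul, map_one, mul_one, h1, hthcomp]
    have h4 := congrArg ι (xs_succ (f := f) hg u n)
    rw [map_mul, map_add, map_mul, map_mul] at h4
    have h5 : ι (homE d PowerSeries.C g 1 (xs d f g u n)) + ι PowerSeries.X * ι (homE d PowerSeries.C f 1 (xs d f g u n)) ≠ 0 := by
      rw [← map_mul, ← map_add, Ne, map_eq_zero_iff ι hinj]
      exact xs_den_ne hg u n
    simp only [AB, map_add, map_mul, h3, hthX]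
    set a := th k (AB d f g u n).1
    set F := ι (homE d PowerSeries.C f 1 (xs d f g u n))
    set G := ι (homE d PowerSeries.C g 1 (xs d f g u n))
    set x := ι PowerSeries.X
    have e : a ^ d * F + x⁻¹ * (a ^ d * G) = a ^ d * x⁻¹ * (G + x * F) := by
      field_simp
      ring
    rw [e]
    refine ⟨?_, mul_ne_zero (mul_ne_zero (pow_ne_zero _ h2) (inv_ne_zero hX)) h5⟩
    field_simp
    linear_combination h4

lemma AB_ne (hd : 1 ≤ d) (hg : g.coeff d ≠ 0) (hκ : f.coeff (d - 1) * g.coeff d ≠ f.coeff d * g.coeff (d - 1))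
    (u v : k) (i j : ℕ) (h : i = j → u ≠ v) :
    (AB d f g u i).1 * (AB d f g v j).2 - (AB d f g v j).1 * (AB d f g u i).2 ≠ 0 := by
  intro h0
  obtain ⟨h1, h2⟩ := th_AB (f := f) hg u i
  obtain ⟨h3, h4⟩ := th_AB (f := f) hg v j
  have h5 := congrArg (th k) h0
  rw [map_sub, map_mul, map_mul, ← h1, ← h3, map_zero] at h5
  have h6 : algebraMap (PowerSeries k) (FractionRing (PowerSeries k)) (xs d f g v j) =
      algebraMap (PowerSeries k) (FractionRing (PowerSeries k)) (xs d f g u i) := by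
    apply mul_left_cancel₀ (mul_ne_zero h2 h4)
    linear_combination h5
  obtain ⟨rfl, rfl⟩ := xs_inj hd hg hκ _ _ _ _ (IsFractionRing.injective _ _ h6)
  exact h rfl rfl

lemma AB_snd_ne (hg : g.coeff d ≠ 0) (u : k) (i : ℕ) : (AB d f g u i).2 ≠ 0 := by
  intro h0
  obtain ⟨h1, h2⟩ := th_AB (f := f) hg u i
  rw [h0, map_zero] at h1
  rcases mul_eq_zero.mp h1 with h | h
  · exact h2 h
  · rw [map_eq_zero_iff _ (IsFractionRing.injective _ _)] at h
    exact xs_ne hg u i h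

end St2
end APP


namespace APP
section St2
variable {k : Type*} [Field k] {d : ℕ} {f g : k[X]}

lemma goodTau_one_iff (hf : f.natDegree ≤ d) (hg : g.natDegree ≤ d) (z : k) : GoodTau d f g 1 z ↔
    (f - C z * g).natDegree = d ∧ (f - C z * g).Separable := by
  have e : ∀ q : k[X], q.natDegree ≤ d → homE d C q X 1 = q := by
    intro q hq
    rw [homE_one d C q hq, eval₂_C_X]
  have e2 : PP (RingHom.id k) z (itP d f g 1).1 (itP d f g 1).2 = f - C z * g := by
    simp [PP, itP, e f hf, e g hg]
  rw [GoodTau, e2, pow_one]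

/-- there is a simple critical point -/
def G1 (d : ℕ) (f g : k[X]) : Prop := ∃ (v c : k) (V : k[X]), f - C v * g = (X - C c) ^ 2 * V ∧
  (f - C v * g).natDegree = d ∧ V.Separable ∧ eval c V ≠ 0

lemma G1_add (σ : k) (h : G1 d f g) : G1 d (f + C σ * g) g := by
  obtain ⟨v, c, V, h1, h2, h3, h4⟩ := h
  have e : f + C σ * g - C (v + σ) * g = f - C v * g := by rw [C_add]; ring
  exact ⟨v + σ, c, V, by rw [e, h1], by rw [e, h2], h3, h4⟩

lemma GoodPair.add (H : GoodPair d f g) (σ : k) : GoodPair d (f + C σ * g) g where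
  hd := H.hd
  hf := natDegree_add_le_of_degree_le H.hf ((natDegree_C_mul_le _ _).trans H.hg)
  hg := H.hg
  hgd := H.hgd
  cop := by
    have := H.cop
    rw [mul_comm]
    exact this.add_mul_left_left _
  hdk := H.hdk

lemma bounded_finset {α : Type*} (P : α → Prop) (B : ℕ) (h : ∀ T : Finset α, (∀ x ∈ T, P x) → T.card ≤ B) :
    ∃ S : Finset α, (∀ x, x ∈ S ↔ P x) ∧ S.card ≤ B := by
  have hfin : {x | P x}.Finite := by
    by_contra hinf
    obtain ⟨T, hT, hc⟩ := Set.Infinite.exists_subset_card_eq (s := {x | P x}) hinf (B + 1)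
    have := h T (fun x hx => hT hx)
    omega
  refine ⟨hfin.toFinset, fun x => by simp, h _ (fun x hx => by simpa using hx)⟩

def B2 (d N : ℕ) : ℕ := N * (d + 1) ^ N + (N * ((2 * d + 1) * N)) * (2 * (d + 1) ^ N)

theorem stage2 [IsAlgClosed k] (H : GoodPair d f g) (N : ℕ)
    (hκ : f.coeff (d - 1) * g.coeff d ≠ f.coeff d * g.coeff (d - 1)) (hG : G1 d f g)
    (T : Finset k) (hT : ∀ σ ∈ T, ¬ ∀ i < N, SwapData d (f + C σ * g) g (i + 1)) : T.card ≤ B2 d N := by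
  classical
  obtain ⟨v, c, V, h1, h2, h3, h4⟩ := hG
  have hd := H.hd
  obtain ⟨S, hS, hScard⟩ := bounded_finset (fun u => ¬ GoodTau d f g 1 u) (2 * d ^ 1 + 1) (fun T hT => H.bad_tau 1 T hT)
  rw [pow_one] at hScard
  let I := (Finset.range N ×ˢ (S ×ˢ Finset.range N)).filter (fun x => x.1 = x.2.2 → v ≠ x.2.1)
  let cr : ℕ × k × ℕ → k[X] := fun x => (AB d f g v x.1).1 * (AB d f g x.2.1 x.2.2).2 - (AB d f g x.2.1 x.2.2).1 * (AB d f g v x.1).2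
  let D1 := ∏ i ∈ Finset.range N, (AB d f g v i).2
  let D2 := ∏ x ∈ I, cr x
  have hD1 : D1 ≠ 0 := Finset.prod_ne_zero_iff.mpr (fun i _ => AB_snd_ne H.hgd v i)
  have hD2 : D2 ≠ 0 := Finset.prod_ne_zero_iff.mpr (fun x hx => AB_ne (by omega) H.hgd hκ _ _ _ _ (Finset.mem_filter.mp hx).2)
  have hpw : ∀ i < N, (d + 1) ^ i ≤ (d + 1) ^ N := fun i hi => Nat.pow_le_pow_right (by omega) hi.le
  have hdeg1 : D1.natDegree ≤ N * (d + 1) ^ N := by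
    refine (natDegree_prod_le _ _).trans ((Finset.sum_le_card_nsmul _ _ ((d+1)^N) ?_).trans ?_)
    · intro i hi
      exact (AB_deg v i).2.trans (hpw i (Finset.mem_range.mp hi))
    · simp
  have hIcard : I.card ≤ N * ((2 * d + 1) * N) := by
    refine (Finset.card_filter_le _ _).trans ?_
    rw [Finset.card_product, Finset.card_product, Finset.card_range]
    gcongr
  have hdeg2 : D2.natDegree ≤ (N * ((2 * d + 1) * N)) * (2 * (d + 1) ^ N) := by
    refine (natDegree_prod_le _ _).trans ((Finset.sum_le_card_nsmul _ _ (2 * (d+1)^N) ?_).trans ?_)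
    · intro x hx
      have hx := (Finset.mem_filter.mp hx).1
      simp only [Finset.mem_product, Finset.mem_range] at hx
      have e1 := hpw _ hx.1
      have e2 := hpw _ hx.2.2
      have e3 := AB_deg (d := d) (f := f) (g := g) v x.1
      have e4 := AB_deg (d := d) (f := f) (g := g) x.2.1 x.2.2
      refine (natDegree_sub_le_of_le natDegree_mul_le natDegree_mul_le).trans ?_
      rw [max_le_iff]
      constructor <;> omega
    · rw [smul_eq_mul]
      exact Nat.mul_le_mul_right _ hIcard
  have hD : D1 * D2 ≠ 0 := mul_ne_zero hD1 hD2
  have hsub : T ⊆ (D1 * D2).roots.toFinset := by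
    intro σ hσ
    rw [Multiset.mem_toFinset, mem_roots hD, IsRoot.def]
    by_contra hne
    rw [eval_mul] at hne
    have hne1 := left_ne_zero_of_mul hne
    have hne2 := right_ne_zero_of_mul hne
    rw [eval_prod, Finset.prod_ne_zero_iff] at hne1 hne2
    apply hT σ hσ
    have e : f + C σ * g - C (v + σ) * g = f - C v * g := by rw [C_add]; ring
    refine (H.add σ).swap_crit N (v + σ) c V (by rw [e, h1]) (by rw [e, h2]) h3 h4 ?_ ?_
    · intro i hi
      rw [(AB_eval v σ i).2]
      exact hne1 i (Finset.mem_range.mpr hi)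
    · intro i hi u hu l hl huv hcon
      obtain ⟨u', rfl⟩ : ∃ u', u = u' + σ := ⟨u - σ, by ring⟩
      have hu' : u' ∈ S := by
        rw [hS, goodTau_one_iff H.hf H.hg]
        rw [goodTau_one_iff (H.add σ).hf H.hg] at hu
        have e' : f + C σ * g - C (u' + σ) * g = f - C u' * g := by rw [C_add]; ring
        rwa [e'] at hu
      have := hne2 (i, u', l) (by
        simp only [I, Finset.mem_filter, Finset.mem_product, Finset.mem_range]
        refine ⟨⟨hi, hu', by omega⟩, ?_⟩
        intro hil hvu
        exact huv hil.symm (by rw [hvu]))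
      apply this
      simp only [cr, eval_sub, eval_mul]
      rw [(AB_eval v σ i).1, (AB_eval v σ i).2, (AB_eval u' σ l).1, (AB_eval u' σ l).2] at hcon
      rw [hcon, sub_self]
  refine (Finset.card_le_card hsub).trans ((Multiset.toFinset_card_le _).trans ((card_roots' _).trans (natDegree_mul_le.trans ?_)))
  rw [B2]
  omega

end St2
end APP


namespace APP
section St1
variable {k : Type*} [Field k]

lemma det_natDegree_le {n : ℕ} (A : Matrix (Fin n) (Fin n) k[X]) (B : ℕ) (h : ∀ i j, (A i j).natDegree ≤ B) :
    A.det.natDegree ≤ n * B := by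
  rw [Matrix.det_apply]
  refine natDegree_sum_le_of_forall_le _ _ fun s _ => ?_
  refine (natDegree_smul_le _ _).trans ((natDegree_prod_le _ _).trans ?_)
  refine (Finset.sum_le_card_nsmul _ _ B (fun i _ => h _ _)).trans ?_
  simp

lemma resultant_natDegree_le (P Q : k[X][X]) (m n B : ℕ) (hP : ∀ i, (P.coeff i).natDegree ≤ B)
    (hQ : ∀ i, (Q.coeff i).natDegree ≤ B) : (resultant P Q m n).natDegree ≤ (m + n) * B := by
  rw [resultant]
  apply det_natDegree_le
  intro i j
  induction j using Fin.addCases with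
  | left j =>
    simp only [sylvester, Matrix.of_apply, Fin.addCases_left]
    split_ifs
    · exact hQ _
    · simp
  | right j =>
    simp only [sylvester, Matrix.of_apply, Fin.addCases_right]
    split_ifs
    · exact hP _
    · simp

lemma disc (m B : ℕ) (hm : 1 ≤ m) (P : k[X][X]) (hPm : P.natDegree ≤ m) (hB : ∀ i, (P.coeff i).natDegree ≤ B)
    (h0 : eval 0 (P.coeff m) ≠ 0) (hs : (P.map (evalRingHom 0)).Separable) :
    ∃ Δ : k[X], eval 0 Δ ≠ 0 ∧ Δ.natDegree ≤ (m + m) * B + B ∧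
      ∀ c, eval c Δ ≠ 0 → eval c (P.coeff m) ≠ 0 ∧ (P.map (evalRingHom c)).Separable := by
  have hder : (derivative P).natDegree ≤ m := (natDegree_derivative_le P).trans (by omega)
  refine ⟨resultant P (derivative P) m m * P.coeff m, ?_, ?_, ?_⟩
  · rw [eval_mul]
    refine mul_ne_zero ?_ h0
    rw [← coe_evalRingHom, ← resultant_map_map, ← derivative_map]
    set Q := P.map (evalRingHom 0) with hQ
    have hQm : Q.natDegree = m := by
      apply le_antisymm (natDegree_map_le.trans hPm)
      apply le_natDegree_of_ne_zero
      simpa [hQ] using h0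
    have hQ' : (derivative Q).natDegree ≤ m := (natDegree_derivative_le Q).trans (by omega)
    have h1 := resultant_add_right_deg Q (derivative Q) Q.natDegree (derivative Q).natDegree (m - (derivative Q).natDegree) le_rfl
    rw [Nat.add_sub_cancel' hQ', hQm] at h1
    rw [h1]
    refine mul_ne_zero (pow_ne_zero _ ?_) ?_
    · simpa [hQ] using h0
    · have := resultant_ne_zero Q (derivative Q) hs
      rwa [hQm] at this
  · refine natDegree_mul_le.trans (Nat.add_le_add (resultant_natDegree_le _ _ _ _ _ hB ?_) (hB m))
    intro i
    rw [coeff_derivative]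
    refine natDegree_mul_le.trans ?_
    have : ((i : k[X]) + 1).natDegree = 0 := by
      have : ((i : k[X]) + 1) = C ((i : k) + 1) := by simp
      rw [this, natDegree_C]
    rw [this, add_zero]
    exact hB _
  · intro c hc
    rw [eval_mul] at hc
    refine ⟨right_ne_zero_of_mul hc, ?_⟩
    have h1 := left_ne_zero_of_mul hc
    rw [← coe_evalRingHom, ← resultant_map_map, ← derivative_map] at h1
    obtain ⟨p, q, -, -, hpq⟩ := exists_mul_add_mul_eq_C_resultant (m := m) (n := m) (P.map (evalRingHom c)) (derivative (P.map (evalRingHom c)))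
      (natDegree_map_le.trans hPm) (by rw [derivative_map]; exact natDegree_map_le.trans hder) (Or.inl (by omega))
    set r := resultant (P.map (evalRingHom c)) (derivative (P.map (evalRingHom c))) m m
    refine ⟨C r⁻¹ * p, C r⁻¹ * q, ?_⟩
    have : C r⁻¹ * C r = 1 := by rw [← C_mul, inv_mul_cancel₀ h1, C_1]
    linear_combination C r⁻¹ * hpq + this

lemma taylor_sep (p : k[X]) (r : k) (h : p.Separable) : (taylor r p).Separable := by
  obtain ⟨a, b, hab⟩ := h
  refine ⟨taylor r a, taylor r b, ?_⟩
  have h1 : derivative (taylor r p) = taylor r (derivative p) := by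
    rw [taylor_apply, taylor_apply, derivative_comp]
    simp
  rw [h1, ← taylor_mul, ← taylor_mul, ← map_add, hab, taylor_one, C_1]

/-- `f' g - f g'` -/
noncomputable def Wr (f g : k[X]) : k[X] := derivative f * g - f * derivative g

noncomputable def Hk (f g : k[X]) (j : ℕ) : k[X] :=
  g * (Wr X g * hasseDeriv j f) - (Wr X g * f - Wr f g * X) * hasseDeriv j g

noncomputable def HP (d : ℕ) (f g : k[X]) : k[X][X] :=
  ∑ j ∈ Finset.range (d - 1), monomial (j + 1) (Hk f g (j + 2))

lemma HP_coeff_zero (d : ℕ) (f g : k[X]) : (HP d f g).coeff 0 = 0 := by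
  simp [HP, finsetSum_coeff, coeff_monomial]

lemma HP_coeff_succ (d : ℕ) (f g : k[X]) (j : ℕ) : (HP d f g).coeff (j + 1) = if j < d - 1 then Hk f g (j + 2) else 0 := by
  simp only [HP, finsetSum_coeff, coeff_monomial]
  simp

lemma Wr_deg (d : ℕ) (f g : k[X]) (hf : f.natDegree ≤ d) (hg : g.natDegree ≤ d) : (Wr f g).natDegree ≤ 2 * d := by
  have h1 := natDegree_derivative_le f
  have h2 := natDegree_derivative_le g
  refine (natDegree_sub_le_of_le natDegree_mul_le natDegree_mul_le).trans ?_
  rw [max_le_iff]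
  constructor <;> omega

lemma WrX_deg (d : ℕ) (g : k[X]) (hg : g.natDegree ≤ d) : (Wr X g).natDegree ≤ d := by
  rw [Wr, derivative_X, one_mul]
  refine (natDegree_sub_le_of_le (n := d) hg ?_).trans (by simp)
  by_cases h0 : g.natDegree = 0
  · rw [natDegree_eq_zero] at h0
    obtain ⟨c, rfl⟩ := h0
    simp
  · have h2 := natDegree_derivative_lt h0
    have := natDegree_X_le (R := k)
    refine natDegree_mul_le.trans (by omega)

lemma Hk_deg (d : ℕ) (f g : k[X]) (j : ℕ) (hd : 1 ≤ d) (hf : f.natDegree ≤ d) (hg : g.natDegree ≤ d) :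
    (Hk f g j).natDegree ≤ 4 * d := by
  have h1 := (natDegree_hasseDeriv_le f j).trans (Nat.sub_le _ _)
  have h2 := (natDegree_hasseDeriv_le g j).trans (Nat.sub_le _ _)
  have h3 := WrX_deg d g hg
  have h4 := Wr_deg d f g hf hg
  have h5 := natDegree_X_le (R := k)
  refine (natDegree_sub_le_of_le (m := 4 * d) (n := 4 * d) ?_ ?_).trans (by simp)
  · refine natDegree_mul_le.trans ?_
    have := natDegree_mul_le (p := Wr X g) (q := hasseDeriv j f)
    omega
  · refine natDegree_mul_le.trans ?_
    have : (Wr X g * f - Wr f g * X).natDegree ≤ 3 * d := by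
      refine (natDegree_sub_le_of_le natDegree_mul_le natDegree_mul_le).trans ?_
      rw [max_le_iff]
      constructor <;> omega
    omega

lemma good_c (d : ℕ) (hd : 2 ≤ d) (f g : k[X]) (hf : f.natDegree ≤ d) (hg : g.natDegree ≤ d) (c s : k)
    (hgc : eval c g ≠ 0) (hVc : eval c (Wr X g) ≠ 0) (hW : eval c (Wr f g) + s * eval c (Wr X g) = 0)
    (hlc : eval c ((HP d f g).coeff (d - 1)) ≠ 0) (hsep : ((HP d f g).map (evalRingHom c)).Separable) :
    G1 d (f + C s * X) g := by
  set v := (eval c f + s * c) / eval c g with hv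
  set E := f + C s * X - C v * g with hE
  set P := (HP d f g).map (evalRingHom c) with hP
  set γ := eval c g * eval c (Wr X g) with hγ
  have hγ0 : γ ≠ 0 := mul_ne_zero hgc hVc
  have hvg : v * eval c g = eval c f + s * c := by rw [hv]; field_simp
  have hEdeg : E.natDegree ≤ d := by
    have h1 : (C s * X : k[X]).natDegree ≤ d := (natDegree_C_mul_le _ _).trans (natDegree_X_le.trans (by omega))
    exact natDegree_sub_le_of_le (natDegree_add_le_of_degree_le hf h1) ((natDegree_C_mul_le _ _).trans hg) |>.trans (by simp)
  have key : C γ * taylor c E = X * P := by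
    ext n
    rw [coeff_C_mul]
    rcases n with _ | n
    · simp only [taylor_coeff_zero, mul_coeff_zero, coeff_X_zero, zero_mul]
      simp only [hE, eval_sub, eval_add, eval_mul, eval_C, eval_X]
      rw [hvg]; ring
    rw [coeff_X_mul, hP, coeff_map]
    rcases n with _ | n
    · simp only [zero_add, taylor_coeff_one, HP_coeff_zero, map_zero]
      simp only [hE, derivative_sub, derivative_add, derivative_C_mul, derivative_X, eval_sub, eval_add, eval_mul, eval_C, mul_one]
      simp only [Wr, derivative_X, one_mul, eval_sub, eval_mul, eval_X] at hW
      rw [hγ]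
      linear_combination eval c (Wr X g) * hW - eval c (Wr X g) * eval c (derivative g) * hvg
    · rw [HP_coeff_succ]
      split_ifs with hn
      · have hX : hasseDeriv (n + 1 + 1) (C s * X : k[X]) = 0 := by
          rw [C_mul_X_eq_monomial]
          rw [hasseDeriv_monomial, Nat.choose_eq_zero_of_lt (by omega)]
          simp
        have hC : hasseDeriv (n + 1 + 1) (C v * g) = C v * hasseDeriv (n + 1 + 1) g := by
          rw [← smul_eq_C_mul, ← smul_eq_C_mul, map_smul]
        rw [taylor_coeff, hE, map_sub, map_add, hX, add_zero, hC, Hk, hγ]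
        simp only [coe_evalRingHom, eval_sub, eval_mul, eval_C, eval_X]
        linear_combination -eval c (Wr X g) * eval c (hasseDeriv (n+1+1) g) * hvg - c * eval c (hasseDeriv (n+1+1) g) * hW
      · rw [coeff_eq_zero_of_natDegree_lt (by rw [natDegree_taylor]; omega)]
        simp
  have hP0 : P.coeff 0 = 0 := by rw [hP, coeff_map, HP_coeff_zero, map_zero]
  obtain ⟨S, hS⟩ : X ∣ P := X_dvd_iff.mpr hP0
  rw [hS] at hsep
  have hSsep : S.Separable := hsep.of_mul_right
  have hS0 : eval 0 S ≠ 0 := by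
    intro h0
    obtain ⟨a, b, hab⟩ := hsep.isCoprime
    have := congrArg (eval 0) hab
    simp [h0] at this
  have hu : C γ⁻¹ * C γ = 1 := by rw [← C_mul, inv_mul_cancel₀ hγ0, C_1]
  have hE2 : taylor c E = X ^ 2 * (C γ⁻¹ * S) := by
    rw [hS] at key
    linear_combination C γ⁻¹ * key - taylor c E * hu
  refine ⟨v, c, taylor (-c) (C γ⁻¹ * S), ?_, ?_, ?_, ?_⟩
  · rw [← hE]
    have h1 := congrArg (taylor (-c)) hE2
    rw [taylor_taylor, neg_add_cancel, taylor_zero, taylor_mul, taylor_pow, taylor_X] at h1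
    rw [h1]
    simp [sub_eq_add_neg]
  · rw [← hE]
    apply le_antisymm hEdeg
    rw [← natDegree_taylor E c]
    apply le_natDegree_of_ne_zero
    intro h0
    have := congrArg (fun q => coeff q (d - 1 + 1)) key
    simp only [coeff_C_mul, coeff_X_mul] at this
    rw [show d - 1 + 1 = d by omega, h0, mul_zero, hP, coeff_map] at this
    exact hlc this.symm
  · apply taylor_sep
    exact Separable.unit_mul (isUnit_C.mpr (inv_ne_zero hγ0).isUnit) hSsep
  · rw [taylor_eval, add_neg_cancel, eval_mul, eval_C]
    exact mul_ne_zero (inv_ne_zero hγ0) hS0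

end St1
end APP


namespace APP
section St1b
variable {k : Type*} [Field k]

def B1 (d : ℕ) : ℕ := d + d + (((d - 1) + (d - 1)) * (4 * d) + 4 * d) + 1

lemma two_gcd (a b : k[X]) (hb : b ≠ 0) : ∃ D a' b' : k[X], D ≠ 0 ∧ a = D * a' ∧ b = D * b' ∧ IsCoprime a' b' := by
  classical
  have hD : EuclideanDomain.gcd a b ≠ 0 := by
    intro h
    exact hb (EuclideanDomain.gcd_eq_zero_iff.mp h).2
  obtain ⟨a', ha⟩ := EuclideanDomain.gcd_dvd_left a b
  obtain ⟨b', hb'⟩ := EuclideanDomain.gcd_dvd_right a b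
  have h := EuclideanDomain.gcd_eq_gcd_ab a b
  refine ⟨_, a', b', hD, ha, hb', ⟨EuclideanDomain.gcdA a b, EuclideanDomain.gcdB a b, ?_⟩⟩
  apply mul_left_cancel₀ hD
  linear_combination -h - EuclideanDomain.gcdA a b * ha - EuclideanDomain.gcdB a b * hb'

theorem stage1 [IsAlgClosed k] (h2 : (2 : k) ≠ 0) (d : ℕ) (hd : 2 ≤ d) (g V1 : k[X]) (v0 : k) (hg : g.natDegree ≤ d)
    (hg0 : eval 0 g ≠ 0) (hVd : V1.natDegree ≤ d - 2) (hVl : V1.coeff (d - 2) ≠ 0) (hVs : V1.Separable)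
    (hV0 : eval 0 V1 ≠ 0) (T : Finset k)
    (hT : ∀ s ∈ T, ¬ G1 d (C v0 * g + X ^ 2 * V1 + C s * X) g) : T.card ≤ B1 d := by
  classical
  set fs := C v0 * g + X ^ 2 * V1 with hfs
  have hfsd : fs.natDegree ≤ d := by
    refine natDegree_add_le_of_degree_le ((natDegree_C_mul_le _ _).trans hg) (natDegree_mul_le.trans ?_)
    rw [natDegree_X_pow]; omega
  have hW0 : eval 0 (Wr fs g) = 0 := by
    simp [Wr, hfs, derivative_mul]
    ring
  have hX0 : eval 0 (Wr X g) = eval 0 g := by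
    simp [Wr]
  have hW1 : eval 0 (derivative (Wr fs g)) ≠ 0 := by
    have : eval 0 (derivative (Wr fs g)) = 2 * eval 0 V1 * eval 0 g := by
      simp [Wr, hfs, derivative_mul]
      ring
    rw [this]
    exact mul_ne_zero (mul_ne_zero h2 hV0) hg0
  have hcoef : ∀ j, eval 0 (Hk fs g (j + 2)) = eval 0 g ^ 2 * V1.coeff j := by
    intro j
    have h3 : ∀ p : k[X], eval 0 (hasseDeriv (j + 2) p) = p.coeff (j + 2) := by
      intro p
      rw [← taylor_coeff, taylor_zero]
    have h4 : fs.coeff (j + 2) = v0 * g.coeff (j + 2) + V1.coeff j := by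
      rw [hfs, coeff_add, coeff_C_mul, mul_comm (X ^ 2), coeff_mul_X_pow]
    have h5 : eval 0 fs = v0 * eval 0 g := by simp [hfs]
    simp only [Hk, eval_sub, eval_mul, h3, hX0, hW0, h4, h5, eval_X]
    ring
  have hmap : (HP d fs g).map (evalRingHom 0) = C (eval 0 g ^ 2) * (X * V1) := by
    ext n
    rw [coeff_map, coeff_C_mul]
    rcases n with _ | n
    · simp [HP_coeff_zero]
    · rw [HP_coeff_succ, coeff_X_mul]
      split_ifs with hn
      · rw [coe_evalRingHom, hcoef]
      · rw [coeff_eq_zero_of_natDegree_lt (by omega)]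
        simp
  have hHd : (HP d fs g).natDegree ≤ d - 1 := by
    rw [natDegree_le_iff_coeff_eq_zero]
    intro n hn
    obtain ⟨m, rfl⟩ : ∃ m, n = m + 1 := ⟨n - 1, by omega⟩
    rw [HP_coeff_succ, if_neg (by omega)]
  have hHB : ∀ i, ((HP d fs g).coeff i).natDegree ≤ 4 * d := by
    intro i
    rcases i with _ | i
    · simp [HP_coeff_zero]
    · rw [HP_coeff_succ]
      split_ifs
      · exact Hk_deg d _ _ _ (by omega) hfsd hg
      · simp
  obtain ⟨Δ, hΔ0, hΔd, hΔ⟩ := disc (d - 1) (4 * d) (by omega) (HP d fs g) hHd hHB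
    (by
      have := congrArg (fun q => coeff q (d - 1)) hmap
      simp only [coeff_map, coe_evalRingHom] at this
      rw [this, coeff_C_mul, show d - 1 = (d - 2) + 1 by omega, coeff_X_mul]
      exact mul_ne_zero (pow_ne_zero _ hg0) hVl)
    (by
      rw [hmap]
      refine Separable.unit_mul (isUnit_C.mpr (pow_ne_zero 2 hg0).isUnit) ?_
      refine Separable.mul separable_X hVs ?_
      have hq : V1 = V1.divX * X + C (eval 0 V1) := by
        rw [← coeff_zero_eq_eval_zero]; exact (divX_mul_X_add V1).symm
      have hu : C (eval 0 V1)⁻¹ * C (eval 0 V1) = 1 := by rw [← C_mul, inv_mul_cancel₀ hV0, C_1]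
      refine ⟨-C (eval 0 V1)⁻¹ * V1.divX, C (eval 0 V1)⁻¹, ?_⟩
      linear_combination C (eval 0 V1)⁻¹ * hq + hu)
  set Ξ := g * Wr X g * Δ with hΞ
  have hΞ0 : Ξ ≠ 0 := by
    intro h
    have := congrArg (eval 0) h
    rw [hΞ, eval_mul, eval_mul, hX0, eval_zero] at this
    exact mul_ne_zero (mul_ne_zero hg0 hg0) hΔ0 this
  have hΞd : Ξ.natDegree ≤ d + d + (((d - 1) + (d - 1)) * (4 * d) + 4 * d) := by
    refine natDegree_mul_le.trans (add_le_add (natDegree_mul_le.trans (add_le_add hg (WrX_deg d g hg))) hΔd)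
  have hWX : Wr X g ≠ 0 := by
    intro h; rw [h, eval_zero] at hX0; exact hg0 hX0.symm
  obtain ⟨D, w, v, hD, hw, hv, hcop⟩ := two_gcd (Wr fs g) (Wr X g) hWX
  have hD0v : eval 0 D ≠ 0 ∧ eval 0 v ≠ 0 := by
    rw [hv, eval_mul] at hX0
    rw [← hX0] at hg0
    exact ⟨left_ne_zero_of_mul hg0, right_ne_zero_of_mul hg0⟩
  have hw0 : eval 0 w = 0 := by
    rw [hw, eval_mul] at hW0
    exact (mul_eq_zero.mp hW0).resolve_left hD0v.1
  have hwne : w ≠ 0 := by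
    rintro rfl
    rw [hw] at hW1
    simp at hW1
  set n := w.natDegree with hn
  have hn1 : n ≠ 0 := by
    intro h
    obtain ⟨c, hc⟩ := natDegree_eq_zero.mp h
    rw [← hc, eval_C] at hw0
    rw [hw0, C_0] at hc
    exact hwne hc.symm
  have hsub : T ⊆ insert (-(w.coeff n / v.coeff n)) (Ξ.roots.toFinset.image fun c => -(eval c w / eval c v)) := by
    intro s hs
    by_cases hdeg : (w + C s * v).degree = 0 ∨ (w + C s * v) = 0
    · have hc : (w + C s * v).coeff n = 0 := by
        apply coeff_eq_zero_of_natDegree_lt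
        rcases hdeg with h | h
        · rw [natDegree_eq_zero_iff_degree_le_zero.mpr h.le]; omega
        · rw [h, natDegree_zero]; omega
      rw [coeff_add, coeff_C_mul] at hc
      have hl : w.coeff n ≠ 0 := by rw [hn]; simpa using hwne
      have hvn : v.coeff n ≠ 0 := by
        intro h; rw [h, mul_zero, add_zero] at hc; exact hl hc
      rw [Finset.mem_insert]
      left
      field_simp
      linear_combination hc
    · push Not at hdeg
      obtain ⟨c, hc⟩ := IsAlgClosed.exists_root _ hdeg.1
      rw [IsRoot.def, eval_add, eval_mul, eval_C] at hc
      have hvc : eval c v ≠ 0 := by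
        intro h
        rw [h, mul_zero, add_zero] at hc
        obtain ⟨a, b, hab⟩ := hcop
        have := congrArg (eval c) hab
        simp [h, hc] at this
      rw [Finset.mem_insert]
      right
      rw [Finset.mem_image]
      refine ⟨c, ?_, ?_⟩
      · rw [Multiset.mem_toFinset, mem_roots hΞ0, IsRoot.def]
        by_contra hne
        rw [hΞ, eval_mul, eval_mul] at hne
        obtain ⟨h3, h4⟩ := hΔ c (right_ne_zero_of_mul hne)
        refine hT s hs (good_c d hd fs g hfsd hg c s (left_ne_zero_of_mul (left_ne_zero_of_mul hne))
          (right_ne_zero_of_mul (left_ne_zero_of_mul hne)) ?_ h3 h4)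
        rw [hw, hv, eval_mul, eval_mul]
        linear_combination eval c D * hc
      · field_simp
        linear_combination -hc
  refine (Finset.card_le_card hsub).trans ((Finset.card_insert_le _ _).trans ?_)
  rw [B1]
  gcongr
  exact Finset.card_image_le.trans ((Multiset.toFinset_card_le _).trans ((card_roots' _).trans hΞd))

end St1b
end APP


namespace APP

lemma line_count {F V : Type*} [Field F] [Fintype F] [AddCommGroup V] [Module F V] [Fintype V] (h : V) (S : Set V) (B : ℕ)
    (hB : ∀ f : V, ∀ T : Finset F, (∀ σ ∈ T, f + σ • h ∈ S) → T.card ≤ B) :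
    S.ncard * Fintype.card F ≤ B * Fintype.card V := by
  classical
  have h1 : ∑ f : V, (Finset.univ.filter fun σ : F => f + σ • h ∈ S).card ≤ B * Fintype.card V := by
    rw [mul_comm, ← smul_eq_mul, ← Finset.card_univ]
    refine Finset.sum_le_card_nsmul _ _ _ fun f _ => hB f _ ?_
    intro σ hσ
    exact (Finset.mem_filter.mp hσ).2
  refine le_trans (le_of_eq ?_) h1
  simp only [Finset.card_filter]
  rw [Finset.sum_comm]
  have : ∀ σ : F, ∑ f : V, (if f + σ • h ∈ S then 1 else 0) = S.ncard := by
    intro σ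
    refine (Fintype.sum_equiv (Equiv.addRight (σ • h)) (fun f => if f + σ • h ∈ S then 1 else 0)
      (fun f => if f ∈ S then 1 else 0) (fun f => rfl)).trans ?_
    rw [← Finset.card_filter, ← Set.ncard_coe_finset]
    congr 1
    ext x; simp
  simp only [this]
  simp [mul_comm]

noncomputable instance degLTFin {F : Type*} [Field F] [Fintype F] (n : ℕ) : Fintype (degreeLT F n) := by
  classical
  exact Fintype.ofEquiv _ (degreeLTEquiv F n).toEquiv.symm

lemma card_degLT {F : Type*} [Field F] [Fintype F] (n : ℕ) : Fintype.card (degreeLT F n) = Fintype.card F ^ n := by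
  classical
  rw [Fintype.card_congr (degreeLTEquiv F n).toEquiv]
  simp

lemma mem_degLT_succ {F : Type*} [Field F] {n : ℕ} {f : F[X]} : f ∈ degreeLT F (n + 1) ↔ f.natDegree ≤ n := by
  rw [mem_degreeLT, degree_lt_iff_coeff_zero, natDegree_le_iff_coeff_eq_zero]
  exact Iff.rfl

section
variable {F k : Type*} [Field F] [Fintype F] [Field k] [Algebra F k]

lemma line_poly (d : ℕ) (h : F[X]) (hh : h.natDegree ≤ d) (P : k[X] → Prop) (B : ℕ)
    (hB : ∀ f : k[X], f.natDegree ≤ d → ∀ T : Finset k, (∀ σ ∈ T, P (f + C σ * h.map (algebraMap F k))) → T.card ≤ B) :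
    {f : degreeLT F (d + 1) | P ((f : F[X]).map (algebraMap F k))}.ncard * Fintype.card F ≤ B * Fintype.card F ^ (d + 1) := by
  classical
  rw [← card_degLT]
  refine line_count (⟨h, mem_degLT_succ.mpr hh⟩ : degreeLT F (d + 1)) _ B ?_
  intro f T hT
  rw [← Finset.card_image_of_injective T (algebraMap F k).injective]
  refine hB ((f : F[X]).map (algebraMap F k)) (natDegree_map_le.trans (mem_degLT_succ.mp f.2)) _ ?_
  intro σ hσ
  obtain ⟨s, hs, rfl⟩ := Finset.mem_image.mp hσ
  have := hT s hs
  simp only [Set.mem_setOf_eq, Submodule.coe_add, Submodule.coe_smul, Polynomial.map_add, Polynomial.map_smul, smul_eq_C_mul, Polynomial.map_mul, map_C] at this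
  exact this
end

section
variable {k : Type*} [Field k]

lemma cop_count [IsAlgClosed k] (A B : k[X]) (hB : B ≠ 0) (T : Finset k) (hT : ∀ σ ∈ T, ¬ IsCoprime (A + C σ) B) :
    T.card ≤ B.natDegree := by
  classical
  have hsub : T ⊆ B.roots.toFinset.image fun c => - eval c A := by
    intro σ hσ
    have h1 := hT σ hσ
    rw [Polynomial.isCoprime_iff_aeval_ne_zero_of_isAlgClosed k k] at h1
    push Not at h1
    obtain ⟨c, h2, h3⟩ := h1
    rw [Finset.mem_image]
    refine ⟨c, ?_, ?_⟩
    · rw [Multiset.mem_toFinset, mem_roots hB, IsRoot.def]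
      simpa using! h3
    · have : eval c (A + C σ) = 0 := by simpa using! h2
      rw [eval_add, eval_C] at this
      linear_combination -this
  exact (Finset.card_le_card hsub).trans (Finset.card_image_le.trans ((Multiset.toFinset_card_le _).trans (card_roots' _)))

noncomputable def v0 (f g : k[X]) : k := f.coeff 0 / g.coeff 0

noncomputable def V1 (f g : k[X]) : k[X] := divX (divX (f - C (v0 f g) * g))

lemma V1_coeff (f g : k[X]) (n : ℕ) : (V1 f g).coeff n = f.coeff (n + 2) - v0 f g * g.coeff (n + 2) := by
  simp [V1, coeff_divX]

lemma V1_deg (d : ℕ) (hd : 2 ≤ d) (f g : k[X]) (hf : f.natDegree ≤ d) (hg : g.natDegree ≤ d) : (V1 f g).natDegree ≤ d - 2 := by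
  rw [natDegree_le_iff_coeff_eq_zero]
  intro n hn
  rw [V1_coeff, coeff_eq_zero_of_natDegree_lt (by omega), coeff_eq_zero_of_natDegree_lt (by omega)]
  simp

lemma f_eq (f g : k[X]) (hg : g.coeff 0 ≠ 0) : ∃ s, f = C (v0 f g) * g + X ^ 2 * V1 f g + C s * X := by
  refine ⟨(divX (f - C (v0 f g) * g)).coeff 0, ?_⟩
  have h1 := divX_mul_X_add (f - C (v0 f g) * g)
  have h2 := divX_mul_X_add (divX (f - C (v0 f g) * g))
  have h3 : (f - C (v0 f g) * g).coeff 0 = 0 := by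
    simp only [coeff_sub, coeff_C_mul, v0]
    field_simp
    ring
  rw [h3, C_0, add_zero] at h1
  rw [V1]
  linear_combination -h1 - X * h2

lemma le_one_of {T : Finset k} (a b : k) (hb : b ≠ 0) (h : ∀ σ ∈ T, a + σ * b = 0) : T.card ≤ 1 := by
  rw [Finset.card_le_one]
  intro x hx y hy
  apply mul_right_cancel₀ hb
  linear_combination h x hx - h y hy

lemma v0_add (f h g : k[X]) (σ : k) (hh : h.coeff 0 = 0) : v0 (f + C σ * h) g = v0 f g := by
  simp [v0, hh]

def Good (d N : ℕ) (f g : k[X]) : Prop := GoodPair d f g ∧ ∀ i < N, SwapData d f g (i + 1)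

def Pκ (d : ℕ) (g f : k[X]) : Prop := f.coeff (d - 1) * g.coeff d = f.coeff d * g.coeff (d - 1)
def PVl (d : ℕ) (g f : k[X]) : Prop := (V1 f g).coeff (d - 2) = 0
def PV0 (g f : k[X]) : Prop := (V1 f g).coeff 0 = 0
def PVs (d : ℕ) (g f : k[X]) : Prop := (V1 f g).coeff (d - 2) ≠ 0 ∧ ¬ (V1 f g).Separable
def PG (d : ℕ) (g f : k[X]) : Prop := (V1 f g).coeff (d - 2) ≠ 0 ∧ (V1 f g).coeff 0 ≠ 0 ∧ (V1 f g).Separable ∧ ¬ G1 d f g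
def PS (d N : ℕ) (g f : k[X]) : Prop := IsCoprime f g ∧ ¬ Pκ d g f ∧ G1 d f g ∧ ¬ ∀ i < N, SwapData d f g (i + 1)

lemma cntκ (d : ℕ) (hd : 2 ≤ d) (g : k[X]) (hg : g.coeff d ≠ 0) (f : k[X]) (T : Finset k)
    (hT : ∀ σ ∈ T, Pκ d g (f + C σ * X ^ (d - 1))) : T.card ≤ 1 := by
  refine le_one_of (f.coeff (d - 1) * g.coeff d - f.coeff d * g.coeff (d - 1)) (g.coeff d) hg ?_
  intro σ hσ
  have := hT σ hσ
  rw [Pκ] at this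
  simp only [coeff_add, coeff_C_mul, coeff_X_pow, if_true, if_neg (show ¬ d = d - 1 by omega)] at this
  linear_combination this

lemma cntVl (d : ℕ) (hd : 2 ≤ d) (g : k[X]) (f : k[X]) (T : Finset k)
    (hT : ∀ σ ∈ T, PVl d g (f + C σ * X ^ d)) : T.card ≤ 1 := by
  refine le_one_of ((V1 f g).coeff (d - 2)) 1 one_ne_zero ?_
  intro σ hσ
  have := hT σ hσ
  rw [PVl, V1_coeff, v0_add _ _ _ _ (by simp; omega)] at this
  simp only [coeff_add, coeff_C_mul, coeff_X_pow, if_pos (show d - 2 + 2 = d by omega)] at this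
  rw [V1_coeff]
  linear_combination this

lemma V1_X2 (f g : k[X]) (σ : k) : V1 (f + C σ * X ^ 2) g = V1 f g + C σ := by
  ext n
  rw [coeff_add, V1_coeff, V1_coeff, v0_add _ _ _ _ (by simp)]
  simp only [coeff_add, coeff_C_mul, coeff_X_pow, coeff_C]
  by_cases hn : n = 0
  · subst hn; simp; ring
  · simp [hn]

lemma V1_X (f g : k[X]) (σ : k) : V1 (f + C σ * X) g = V1 f g := by
  ext n
  rw [V1_coeff, V1_coeff, v0_add _ _ _ _ (by simp)]
  simp [coeff_X]

lemma cntV0 (g : k[X]) (f : k[X]) (T : Finset k)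
    (hT : ∀ σ ∈ T, PV0 g (f + C σ * X ^ 2)) : T.card ≤ 1 := by
  refine le_one_of ((V1 f g).coeff 0) 1 one_ne_zero ?_
  intro σ hσ
  have := hT σ hσ
  rw [PV0, V1_X2, coeff_add, coeff_C_zero] at this
  linear_combination this

lemma cntVs [IsAlgClosed k] (d : ℕ) (hd : 2 ≤ d) (hk : d ≠ 2 → ((d - 2 : ℕ) : k) ≠ 0) (g : k[X]) (hg : g.natDegree ≤ d) (f : k[X])
    (hf : f.natDegree ≤ d) (T : Finset k)
    (hT : ∀ σ ∈ T, PVs d g (f + C σ * X ^ 2)) : T.card ≤ d := by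
  have hV := V1_deg d hd f g hf hg
  rcases T.eq_empty_or_nonempty with rfl | ⟨σ₀, hσ₀⟩
  · simp
  have h0 := hT σ₀ hσ₀
  rw [PVs, V1_X2] at h0
  by_cases h2 : d = 2
  · subst h2
    exfalso
    apply h0.2
    have h3 : (V1 f g + C σ₀).natDegree = 0 := by
      rw [natDegree_add_C]; omega
    obtain ⟨c, hc⟩ := natDegree_eq_zero.mp h3
    rw [← hc] at h0 ⊢
    have : c ≠ 0 := by simpa using h0.1
    rw [separable_C]
    exact this.isUnit
  · have hl : (V1 f g).coeff (d - 2) ≠ 0 := by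
      have := h0.1
      rwa [coeff_add, coeff_C, if_neg (by omega), add_zero] at this
    have hder : derivative (V1 f g) ≠ 0 := by
      intro h
      have := congrArg (fun q => coeff q (d - 3)) h
      simp only [coeff_derivative, coeff_zero] at this
      rw [show d - 3 + 1 = d - 2 by omega] at this
      refine mul_ne_zero hl ?_ this
      have h4 := hk h2
      rw [show d - 2 = (d - 3) + 1 by omega] at h4
      exact_mod_cast h4
    refine (cop_count (V1 f g) _ hder T ?_).trans ?_
    · intro σ hσ h
      have := (hT σ hσ).2
      rw [V1_X2] at this
      apply this
      rw [Separable, derivative_add, derivative_C, add_zero]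
      exact h
    · have := natDegree_derivative_le (V1 f g)
      omega

lemma cntG [IsAlgClosed k] (h2 : (2 : k) ≠ 0) (d : ℕ) (hd : 2 ≤ d) (g : k[X]) (hg : g.natDegree ≤ d) (hg0 : g.coeff 0 ≠ 0) (f : k[X])
    (hf : f.natDegree ≤ d) (T : Finset k)
    (hT : ∀ σ ∈ T, PG d g (f + C σ * X)) : T.card ≤ B1 d := by
  classical
  rcases T.eq_empty_or_nonempty with rfl | ⟨σ₀, hσ₀⟩
  · simp
  obtain ⟨h3, h4, h5, -⟩ := hT σ₀ hσ₀
  rw [V1_X] at h3 h4 h5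
  obtain ⟨s, hs⟩ := f_eq f g hg0
  rw [← Finset.card_image_of_injective T (add_right_injective s)]
  refine stage1 h2 d hd g (V1 f g) (v0 f g) hg (by rwa [← coeff_zero_eq_eval_zero]) (V1_deg d hd f g hf hg) h3 h5
    (by rwa [← coeff_zero_eq_eval_zero]) _ ?_
  intro t ht
  obtain ⟨σ, hσ, rfl⟩ := Finset.mem_image.mp ht
  obtain ⟨-, -, -, h6⟩ := hT σ hσ
  have : C (v0 f g) * g + X ^ 2 * V1 f g + C (s + σ) * X = f + C σ * X := by
    rw [C_add]; linear_combination -hs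
  rwa [this]

lemma cntS [IsAlgClosed k] (d N : ℕ) (hd : 2 ≤ d) (hdk : (d : k) ≠ 0) (g : k[X]) (hg : g.natDegree ≤ d) (hgd : g.coeff d ≠ 0) (f : k[X])
    (hf : f.natDegree ≤ d) (T : Finset k)
    (hT : ∀ σ ∈ T, PS d N g (f + C σ * g)) : T.card ≤ B2 d N := by
  rcases T.eq_empty_or_nonempty with rfl | ⟨σ₀, hσ₀⟩
  · simp
  obtain ⟨h3, h4, h5, -⟩ := hT σ₀ hσ₀
  have back : f = f + C σ₀ * g + C (-σ₀) * g := by rw [C_neg]; ring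
  have H : GoodPair d f g := by
    rw [back]
    refine GoodPair.add ⟨hd, ?_, hg, hgd, h3, hdk⟩ _
    exact natDegree_add_le_of_degree_le hf ((natDegree_C_mul_le _ _).trans hg)
  refine stage2 H N ?_ ?_ T fun σ hσ => (hT σ hσ).2.2.2
  · intro h
    apply h4
    rw [Pκ]
    simp only [coeff_add, coeff_C_mul]
    linear_combination h
  · rw [back]; exact G1_add _ h5

lemma bad_cases (d N : ℕ) (hd : 2 ≤ d) (hdk : (d : k) ≠ 0) (g f : k[X]) (hg : g.natDegree ≤ d) (hgd : g.coeff d ≠ 0)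
    (hf : f.natDegree ≤ d) (hbad : ¬ Good d N f g) :
    ¬ IsCoprime f g ∨ Pκ d g f ∨ PVl d g f ∨ PV0 g f ∨ PVs d g f ∨ PG d g f ∨ PS d N g f := by
  by_contra h
  push Not at h
  obtain ⟨h1, h2, h3, h4, h5, h6, h7⟩ := h
  apply hbad
  refine ⟨⟨hd, hf, hg, hgd, h1, hdk⟩, ?_⟩
  have h8 : (V1 f g).Separable := by
    by_contra h; exact h5 ⟨h3, h⟩
  have h9 : G1 d f g := by
    by_contra h; exact h6 ⟨h3, h4, h8, h⟩
  by_contra h; exact h7 ⟨h1, h2, h9, h⟩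

def BC (d N : ℕ) : ℕ := d + 1 + 1 + 1 + d + B1 d + B2 d N

end

section
variable {F k : Type*} [Field F] [Fintype F] [Field k] [Algebra F k] [IsAlgClosed k]

lemma noncop_count (d : ℕ) (g : F[X]) (hgd : g.natDegree = d) (hg0 : g ≠ 0) :
    {f : degreeLT F (d + 1) | ¬ IsCoprime ((f : F[X]).map (algebraMap F k)) (g.map (algebraMap F k))}.ncard * Fintype.card F ≤ d * Fintype.card F ^ (d + 1) := by
  refine line_poly (k := k) d 1 (by simp) (fun f => ¬ IsCoprime f (g.map (algebraMap F k))) d ?_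
  intro f hf T hT
  refine (cop_count f (g.map (algebraMap F k)) ?_ T ?_).trans ?_
  · rwa [Polynomial.map_ne_zero_iff (algebraMap F k).injective]
  · intro σ hσ
    have := hT σ hσ
    rwa [Polynomial.map_one, mul_one] at this
  · rw [natDegree_map, hgd]

theorem bad_count (d N : ℕ) (hd : 2 ≤ d) (hdk : ∀ i, 1 ≤ i → i ≤ d → (i : k) ≠ 0) (g : F[X]) (hgd : g.natDegree = d) (hgm : g.Monic)
    (hg0 : g.coeff 0 ≠ 0) :
    {f : degreeLT F (d + 1) | ¬ Good d N ((f : F[X]).map (algebraMap F k)) (g.map (algebraMap F k))}.ncard * Fintype.card F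
      ≤ BC d N * Fintype.card F ^ (d + 1) := by
  classical
  set ι := algebraMap F k with hι
  set G := g.map ι with hG
  have hGd : G.natDegree ≤ d := by rw [hG, natDegree_map, hgd]
  have hGl : G.coeff d ≠ 0 := by
    rw [hG, coeff_map, ← hgd]
    simp [hgm]
  have hG0 : G.coeff 0 ≠ 0 := by
    rw [hG, coeff_map]
    simpa using hg0
  let S (P : k[X] → Prop) : Set (degreeLT F (d + 1)) := {f | P ((f : F[X]).map ι)}
  have h1 : (S fun f => ¬ IsCoprime f G).ncard * Fintype.card F ≤ d * Fintype.card F ^ (d + 1) :=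
    noncop_count d g hgd hgm.ne_zero
  have h2 : (S (Pκ d G)).ncard * Fintype.card F ≤ 1 * Fintype.card F ^ (d + 1) := by
    refine line_poly (k := k) d (X ^ (d - 1)) (by simp) _ 1 fun f hf T hT => cntκ d hd G hGl f T ?_
    simpa using! hT
  have h3 : (S (PVl d G)).ncard * Fintype.card F ≤ 1 * Fintype.card F ^ (d + 1) := by
    refine line_poly (k := k) d (X ^ d) (by simp) _ 1 fun f hf T hT => cntVl d hd G f T ?_
    simpa using! hT
  have h4 : (S (PV0 G)).ncard * Fintype.card F ≤ 1 * Fintype.card F ^ (d + 1) := by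
    refine line_poly (k := k) d (X ^ 2) (by simpa using! hd) _ 1 fun f hf T hT => cntV0 G f T ?_
    simpa using! hT
  have h5 : (S (PVs d G)).ncard * Fintype.card F ≤ d * Fintype.card F ^ (d + 1) := by
    refine line_poly (k := k) d (X ^ 2) (by simpa using! hd) _ d fun f hf T hT => cntVs d hd (fun h => hdk _ (by omega) (by omega)) G hGd f hf T ?_
    simpa using! hT
  have h6 : (S (PG d G)).ncard * Fintype.card F ≤ B1 d * Fintype.card F ^ (d + 1) := by
    refine line_poly (k := k) d X (natDegree_X_le.trans (by omega)) _ _ fun f hf T hT =>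
      cntG (by exact_mod_cast hdk 2 (by omega) hd) d hd G hGd hG0 f hf T ?_
    simpa using! hT
  have h7 : (S (PS d N G)).ncard * Fintype.card F ≤ B2 d N * Fintype.card F ^ (d + 1) := by
    refine line_poly (k := k) d g (by omega) _ _ fun f hf T hT =>
      cntS d N hd (hdk d (by omega) le_rfl) G hGd hGl f hf T ?_
    exact hT
  have hsub : {f : degreeLT F (d + 1) | ¬ Good d N ((f : F[X]).map ι) G} ⊆
      (S fun f => ¬ IsCoprime f G) ∪ (S (Pκ d G) ∪ (S (PVl d G) ∪ (S (PV0 G) ∪ (S (PVs d G) ∪ (S (PG d G) ∪ S (PS d N G)))))) := by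
    intro f hf
    exact bad_cases d N hd (hdk d (by omega) le_rfl) G _ hGd hGl (natDegree_map_le.trans (mem_degLT_succ.mp f.2)) hf
  have hcard := (Set.ncard_le_ncard hsub (Set.toFinite _)).trans ((Set.ncard_union_le _ _).trans (add_le_add_right ((Set.ncard_union_le _ _).trans (add_le_add_right ((Set.ncard_union_le _ _).trans (add_le_add_right ((Set.ncard_union_le _ _).trans (add_le_add_right ((Set.ncard_union_le _ _).trans (add_le_add_right (Set.ncard_union_le _ _) _)) _)) _)) _)) _))
  refine (Nat.mul_le_mul_right _ hcard).trans ?_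
  rw [BC]
  simp only [add_mul] at *
  omega
end
end APP


namespace APP

lemma prod_count {U V : Type*} [Fintype U] [Fintype V] (S : Set (U × V)) : S.ncard = ∑ u, {v | (u, v) ∈ S}.ncard := by
  classical
  have h : ∀ {W : Type _} [Fintype W] (s : Set W), s.ncard = ∑ w, if w ∈ s then 1 else 0 := by
    intro W _ s
    rw [← Finset.card_filter, ← Set.ncard_coe_finset]
    congr 1
    ext x; simp
  have h' : ∀ {W : Type _} [Fintype W] (s : Set W), s.ncard = ∑ w, if w ∈ s then 1 else 0 := by
    intro W _ s
    rw [← Finset.card_filter, ← Set.ncard_coe_finset]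
    congr 1
    ext x; simp
  rw [h, Fintype.sum_prod_type]
  refine Finset.sum_congr rfl fun u _ => ?_
  rw [h']
  rfl

section
variable {F : Type*} [Field F]

lemma ratfunc_eq {φ ψ : RatFunc F} (h1 : φ.num = ψ.num) (h2 : φ.denom = ψ.denom) : φ = ψ := by
  rw [← RatFunc.num_div_denom φ, ← RatFunc.num_div_denom ψ, h1, h2]

lemma num_denom_of_coprime (f g : F[X]) (hg : g.Monic) (hc : IsCoprime f g) :
    (algebraMap F[X] (RatFunc F) f / algebraMap F[X] (RatFunc F) g).num = f ∧
    (algebraMap F[X] (RatFunc F) f / algebraMap F[X] (RatFunc F) g).denom = g := by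
  set x := (algebraMap F[X] (RatFunc F) f / algebraMap F[X] (RatFunc F) g) with hx
  have h := (RatFunc.num_mul_eq_mul_denom_iff (x := x) (p := f) hg.ne_zero).mpr hx
  have h1 : x.denom = g := by
    refine eq_of_monic_of_associated (RatFunc.monic_denom x) hg (associated_of_dvd_dvd ?_ ?_)
    · exact RatFunc.denom_div_dvd f g
    · exact hc.symm.dvd_of_dvd_mul_left ⟨x.num, by rw [← h, mul_comm]⟩
  refine ⟨?_, h1⟩
  rw [h1] at h
  exact mul_right_cancel₀ hg.ne_zero h

lemma monic_sub_mem (g : F[X]) (hg : g.Monic) (e n : ℕ) (he : g.natDegree = e) (hn : e ≤ n) : g - X ^ e ∈ degreeLT F n := by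
  rw [mem_degreeLT]
  have h1 : (g - X ^ e).degree < g.degree := by
    apply degree_sub_lt_left
    · rw [degree_X_pow, degree_eq_natDegree hg.ne_zero, he]
    · exact hg.ne_zero
    · rw [hg.leadingCoeff]; simp
  rw [degree_eq_natDegree hg.ne_zero, he] at h1
  exact h1.trans_le (by exact_mod_cast hn)

lemma monic_of_mem (d : ℕ) (u : F[X]) (hu : u ∈ degreeLT F d) : (X ^ d + u).Monic ∧ (X ^ d + u).natDegree = d := by
  rw [mem_degreeLT] at hu
  refine ⟨monic_X_pow_add hu, ?_⟩
  rw [natDegree_add_eq_left_of_degree_lt (by rwa [degree_X_pow]), natDegree_X_pow]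

def RR (F : Type*) [Field F] (d : ℕ) : Set (RatFunc F) := {φ | ratDegree φ = d}

lemma RR_num {d : ℕ} {φ : RatFunc F} (h : φ ∈ RR F d) : φ.num.natDegree ≤ d := by
  have : max φ.num.natDegree φ.denom.natDegree = d := h
  omega
lemma RR_denom {d : ℕ} {φ : RatFunc F} (h : φ ∈ RR F d) : φ.denom.natDegree ≤ d := by
  have : max φ.num.natDegree φ.denom.natDegree = d := h
  omega

variable [Fintype F]

lemma RR_finite (d : ℕ) : (RR F d).Finite := by
  rw [← Set.finite_coe_iff]
  refine Finite.of_injective (β := degreeLT F (d + 1) × degreeLT F (d + 1))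
    (fun φ => (⟨φ.1.num, mem_degLT_succ.mpr (RR_num φ.2)⟩, ⟨φ.1.denom, mem_degLT_succ.mpr (RR_denom φ.2)⟩)) ?_
  intro φ ψ h
  simp only [Prod.mk.injEq, Subtype.mk.injEq] at h
  exact Subtype.ext (ratfunc_eq h.1 h.2)

lemma cntA (d : ℕ) (hd : 2 ≤ d) : {φ ∈ RR F d | φ.denom.natDegree < d}.ncard * Fintype.card F ≤ d * Fintype.card F ^ (2 * d + 1) := by
  have h : {φ ∈ RR F d | φ.denom.natDegree < d}.ncard ≤ Nat.card (degreeLT F (d + 1) × degreeLT F (d - 1) × Fin d) := by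
    rw [← Nat.card_coe_set_eq]
    refine Nat.card_le_card_of_injective (fun φ => (⟨φ.1.num, mem_degLT_succ.mpr (RR_num φ.2.1)⟩,
      ⟨φ.1.denom - X ^ φ.1.denom.natDegree, monic_sub_mem _ (RatFunc.monic_denom _) _ _ rfl (by have := φ.2.2; omega)⟩,
      ⟨φ.1.denom.natDegree, φ.2.2⟩)) ?_
    intro φ ψ h
    simp only [Prod.mk.injEq, Subtype.mk.injEq, Fin.mk.injEq] at h
    refine Subtype.ext (ratfunc_eq h.1 ?_)
    have h2 := h.2.1
    rw [h.2.2] at h2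
    exact sub_left_injective h2
  refine (Nat.mul_le_mul_right _ h).trans (le_of_eq ?_)
  rw [Nat.card_prod, Nat.card_prod, Nat.card_eq_fintype_card, Nat.card_eq_fintype_card, card_degLT, card_degLT, Nat.card_fin]
  rw [show 2 * d + 1 = (d + 1) + (d - 1) + 1 by omega, pow_succ, pow_add]
  ring

lemma cnt0 (d : ℕ) (hd : 2 ≤ d) : {u : degreeLT F d | (X ^ d + (u : F[X])).coeff 0 = 0}.ncard * Fintype.card F ≤ Fintype.card F ^ d := by
  rw [← card_degLT, ← one_mul (Fintype.card (degreeLT F d))]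
  have h1 : (1 : F[X]) ∈ degreeLT F d := by
    rw [mem_degreeLT, degree_one]
    exact_mod_cast (show 0 < d by omega)
  refine line_count (F := F) (V := degreeLT F d) ⟨1, h1⟩ _ 1 ?_
  intro f T hT
  refine le_one_of ((f : F[X]).coeff 0) 1 one_ne_zero ?_
  intro σ hσ
  have := hT σ hσ
  simp only [Set.mem_setOf_eq, Submodule.coe_add, Submodule.coe_smul, coeff_add, coeff_smul, coeff_X_pow, coeff_one, if_true,
    if_neg (show ¬ 0 = d by omega), zero_add, smul_eq_mul] at this
  exact this

end

section
variable {F k : Type*} [Field F] [Fintype F] [Field k] [Algebra F k] [IsAlgClosed k]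

variable (k) in
lemma cntBC (d N : ℕ) (hd : 2 ≤ d) (hdk : ∀ i, 1 ≤ i → i ≤ d → (i : k) ≠ 0) :
    {x : degreeLT F d × degreeLT F (d + 1) | ¬ Good d N ((x.2 : F[X]).map (algebraMap F k)) ((X ^ d + (x.1 : F[X])).map (algebraMap F k))}.ncard
     * Fintype.card F ≤ (1 + BC d N) * Fintype.card F ^ (2 * d + 1) := by
  classical
  rw [prod_count, Finset.sum_mul]
  set Q := Fintype.card F with hQ
  have h1 : ∀ u : degreeLT F d, {v : degreeLT F (d + 1) | (u, v) ∈ {x : degreeLT F d × degreeLT F (d + 1) | ¬ Good d N ((x.2 : F[X]).map (algebraMap F k)) ((X ^ d + (x.1 : F[X])).map (algebraMap F k))}}.ncard * Q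
      ≤ (if u ∈ {u : degreeLT F d | (X ^ d + (u : F[X])).coeff 0 = 0} then 1 else 0) * (Q ^ (d + 1) * Q) + BC d N * Q ^ (d + 1) := by
    intro u
    split_ifs with h
    · rw [one_mul]
      refine le_trans ?_ (Nat.le_add_right _ _)
      refine Nat.mul_le_mul_right _ ?_
      rw [hQ, ← card_degLT, ← Nat.card_eq_fintype_card]
      exact Set.ncard_le_card _
    · rw [zero_mul, zero_add]
      obtain ⟨h2, h3⟩ := monic_of_mem d u.1 u.2
      exact bad_count d N hd hdk (X ^ d + (u : F[X])) h3 h2 h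
  refine (Finset.sum_le_sum fun u _ => h1 u).trans ?_
  rw [Finset.sum_add_distrib, ← Finset.sum_mul, ← Finset.card_filter]
  have h2 : (Finset.univ.filter fun u : degreeLT F d => u ∈ {u : degreeLT F d | (X ^ d + (u : F[X])).coeff 0 = 0}).card * Q ≤ Q ^ d := by
    refine le_trans (le_of_eq ?_) (cnt0 (F := F) d hd)
    rw [← Set.ncard_coe_finset]
    congr 2
    ext x; simp
  rw [Finset.sum_const, Finset.card_univ, card_degLT, smul_eq_mul, ← hQ]
  generalize (Finset.univ.filter fun u : degreeLT F d => u ∈ {u : degreeLT F d | (X ^ d + (u : F[X])).coeff 0 = 0}).card = m at h2 ⊢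
  calc _ = (m * Q) * Q ^ (d + 1) + BC d N * (Q ^ d * Q ^ (d + 1)) := by ring
    _ ≤ Q ^ d * Q ^ (d + 1) + BC d N * (Q ^ d * Q ^ (d + 1)) := by gcongr
    _ = _ := by rw [show 2 * d + 1 = d + (d + 1) by ring, pow_add]; ring

variable (k) in
theorem bad_total (d N : ℕ) (hd : 2 ≤ d) (hdk : ∀ i, 1 ≤ i → i ≤ d → (i : k) ≠ 0) :
    {φ ∈ RR F d | ¬ Good d N (φ.num.map (algebraMap F k)) (φ.denom.map (algebraMap F k))}.ncard
     * Fintype.card F ≤ (d + 1 + BC d N) * Fintype.card F ^ (2 * d + 1) := by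
  classical
  set S1 := {φ ∈ RR F d | φ.denom.natDegree < d} with hS1
  set S2 := {φ ∈ RR F d | φ.denom.natDegree = d ∧ ¬ Good d N (φ.num.map (algebraMap F k)) (φ.denom.map (algebraMap F k))} with hS2
  have hsub : {φ ∈ RR F d | ¬ Good d N (φ.num.map (algebraMap F k)) (φ.denom.map (algebraMap F k))} ⊆ S1 ∪ S2 := by
    rintro φ ⟨h1, h2⟩
    rcases (RR_denom h1).lt_or_eq with h | h
    · exact Or.inl ⟨h1, h⟩
    · exact Or.inr ⟨h1, h, h2⟩
  have hfin : (S1 ∪ S2).Finite := (RR_finite d).subset (by rintro φ (h | h) <;> exact h.1)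
  have hA := cntA (F := F) d hd
  have hB := cntBC (F := F) k d N hd hdk
  have h2 : S2.ncard ≤ {x : degreeLT F d × degreeLT F (d + 1) | ¬ Good d N ((x.2 : F[X]).map (algebraMap F k)) ((X ^ d + (x.1 : F[X])).map (algebraMap F k))}.ncard := by
    rw [← Nat.card_coe_set_eq, ← Nat.card_coe_set_eq]
    refine Nat.card_le_card_of_injective (fun φ => ⟨(⟨φ.1.denom - X ^ d, monic_sub_mem _ (RatFunc.monic_denom _) _ _ φ.2.2.1 le_rfl⟩,
      ⟨φ.1.num, mem_degLT_succ.mpr (RR_num φ.2.1)⟩), ?_⟩) ?_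
    · have := φ.2.2.2
      simpa using this
    · intro φ ψ h
      simp only [Prod.mk.injEq, Subtype.mk.injEq] at h
      exact Subtype.ext (ratfunc_eq h.2 (sub_left_injective h.1))
  have h3 := (Set.ncard_le_ncard hsub hfin).trans (Set.ncard_union_le _ _)
  calc _ ≤ (S1.ncard + S2.ncard) * Fintype.card F := Nat.mul_le_mul_right _ h3
    _ ≤ d * Fintype.card F ^ (2 * d + 1) + (1 + BC d N) * Fintype.card F ^ (2 * d + 1) := by
      rw [add_mul]
      exact add_le_add hA ((Nat.mul_le_mul_right _ h2).trans hB)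
    _ = _ := by ring

variable (F) in
theorem total_lower (d : ℕ) (hd : 2 ≤ d) (hQ : 2 * d ≤ Fintype.card F) : Fintype.card F ^ (2 * d + 1) ≤ 2 * (RR F d).ncard := by
  classical
  set Q := Fintype.card F with hQdef
  let k := AlgebraicClosure F
  set S : Set (degreeLT F d × degreeLT F (d + 1)) := {x | ¬ IsCoprime ((x.2 : F[X]).map (algebraMap F k)) ((X ^ d + (x.1 : F[X])).map (algebraMap F k))} with hS
  have h1 : S.ncard * Q ≤ Q ^ d * (d * Q ^ (d + 1)) := by
    rw [prod_count, Finset.sum_mul]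
    refine (Finset.sum_le_card_nsmul _ _ (d * Q ^ (d + 1)) fun u _ => ?_).trans ?_
    · obtain ⟨h2, h3⟩ := monic_of_mem d u.1 u.2
      exact noncop_count (k := k) d (X ^ d + (u : F[X])) h3 h2.ne_zero
    · rw [Finset.card_univ, card_degLT, smul_eq_mul]
  have h2 : Sᶜ.ncard ≤ (RR F d).ncard := by
    refine Set.ncard_le_ncard_of_injOn (fun x => algebraMap F[X] (RatFunc F) x.2 / algebraMap F[X] (RatFunc F) (X ^ d + (x.1 : F[X]))) ?_ ?_ (RR_finite d)
    · intro x hx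
      obtain ⟨h2, h3⟩ := monic_of_mem d x.1.1 x.1.2
      have hc : IsCoprime (x.2 : F[X]) (X ^ d + (x.1 : F[X])) := by
        have : ¬ ¬ IsCoprime ((x.2 : F[X]).map (algebraMap F k)) ((X ^ d + (x.1 : F[X])).map (algebraMap F k)) := hx
        rw [not_not] at this
        exact (isCoprime_map _).mp this
      obtain ⟨h4, h5⟩ := num_denom_of_coprime _ _ h2 hc
      show max _ _ = d
      rw [h4, h5, h3]
      exact max_eq_right (mem_degLT_succ.mp x.2.2)
    · intro x hx y hy hxy
      have key : ∀ x ∈ Sᶜ, (algebraMap F[X] (RatFunc F) x.2 / algebraMap F[X] (RatFunc F) (X ^ d + (x.1 : F[X]))).num = x.2 ∧ (algebraMap F[X] (RatFunc F) x.2 / algebraMap F[X] (RatFunc F) (X ^ d + (x.1 : F[X]))).denom = X ^ d + (x.1 : F[X]) := by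
        intro x hx
        obtain ⟨h2, h3⟩ := monic_of_mem d x.1.1 x.1.2
        have hc : IsCoprime (x.2 : F[X]) (X ^ d + (x.1 : F[X])) := by
          have : ¬ ¬ IsCoprime ((x.2 : F[X]).map (algebraMap F k)) ((X ^ d + (x.1 : F[X])).map (algebraMap F k)) := hx
          rw [not_not] at this
          exact (isCoprime_map _).mp this
        exact num_denom_of_coprime _ _ h2 hc
      obtain ⟨a1, a2⟩ := key x hx
      obtain ⟨b1, b2⟩ := key y hy
      simp only at hxy
      rw [hxy] at a1 a2
      refine Prod.ext (Subtype.ext ?_) (Subtype.ext ?_)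
      · exact add_right_injective _ (a2.symm.trans b2)
      · exact a1.symm.trans b1
  have h3 := Set.ncard_add_ncard_compl S
  rw [Nat.card_prod, Nat.card_eq_fintype_card, Nat.card_eq_fintype_card, card_degLT, card_degLT, ← hQdef, ← pow_add,
    show d + (d + 1) = 2 * d + 1 by ring] at h3
  have hQ0 : 0 < Q := by omega
  have h4 : 2 * S.ncard ≤ Q ^ (2 * d + 1) := by
    apply Nat.le_of_mul_le_mul_right _ hQ0
    calc 2 * S.ncard * Q = 2 * (S.ncard * Q) := by ring
      _ ≤ 2 * (Q ^ d * (d * Q ^ (d + 1))) := by gcongr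
      _ = Q ^ (2 * d + 1) * (2 * d) := by ring
      _ ≤ _ := by gcongr
  omega

end
end APP


namespace APP
section
open scoped Classical in
noncomputable def prj {F : Type*} [Field F] (a b : F) : Option F := if b = 0 then none else some (a / b)

variable {F : Type*} [Field F]

lemma projMap_prj (d : ℕ) (f g : F[X]) (hf : f.natDegree ≤ d) (hg : g.natDegree ≤ d) (a b : F) (hab : ¬ (a = 0 ∧ b = 0)) :
    projMap f g d (prj a b) = prj (homE d (RingHom.id F) f a b) (homE d (RingHom.id F) g a b) := by
  by_cases hb : b = 0
  · have ha : a ≠ 0 := fun h => hab ⟨h, hb⟩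
    have hd : a ^ d ≠ 0 := pow_ne_zero _ ha
    subst hb
    rw [homE_zero_right, homE_zero_right]
    simp only [prj, if_true, projMap, RingHom.id_apply]
    by_cases h : g.coeff d = 0
    · simp [h]
    · rw [if_neg h, if_neg (mul_ne_zero h hd), mul_div_mul_right _ _ hd]
  · have hd : b ^ d ≠ 0 := pow_ne_zero _ hb
    rw [homE_field d _ _ hf _ _ hb, homE_field d _ _ hg _ _ hb, eval₂_id, eval₂_id]
    simp only [prj, if_neg hb, projMap]
    by_cases h : eval (a / b) g = 0
    · simp [h]
    · rw [if_neg h, if_neg (mul_ne_zero hd h), mul_div_mul_left _ _ hd]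

lemma iter_prj (d : ℕ) (f g : F[X]) (hf : f.natDegree ≤ d) (hg : g.natDegree ≤ d) (hfg : IsCoprime f g)
    (hgd : g.coeff d ≠ 0) (x : F) (n : ℕ) :
    (projMap f g d)^[n] (some x) = prj (eval x (itP d f g n).1) (eval x (itP d f g n).2) := by
  induction n with
  | zero => simp [itP, prj]
  | succ n ih =>
    rw [Function.iterate_succ_apply', ih]
    have h := eval₂_itP_succ d f g (RingHom.id F) x n
    have h' := itP_no_common_root (RingHom.id F) d f g hf hg hfg (Or.inr hgd) x n
    simp only [eval₂_id] at h h'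
    rw [projMap_prj d f g hf hg _ _ h', h.1, h.2]

lemma per_bound (d N : ℕ) (f g : F[X]) [Fintype F] (hf : f.natDegree ≤ d) (hg : g.natDegree ≤ d) (hfg : IsCoprime f g)
    (hgd : g.coeff d ≠ 0) (B : ℕ)
    (hB : ∀ T : Finset F, (∀ τ ∈ T, ∃ x : F, eval x (itP d f g N).1 = τ * eval x (itP d f g N).2) → T.card ≤ B) :
    {p : Option F | ∃ n : ℕ, 1 ≤ n ∧ (projMap f g d)^[n] p = p}.ncard ≤ B + 2 := by
  classical
  let T : Finset F := Finset.univ.filter fun τ => ∃ x : F, eval x (itP d f g N).1 = τ * eval x (itP d f g N).2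
  have hT : T.card ≤ B := hB T fun τ hτ => (Finset.mem_filter.mp hτ).2
  have hsub : {p : Option F | ∃ n : ℕ, 1 ≤ n ∧ (projMap f g d)^[n] p = p} ⊆
      ((insert none (insert ((projMap f g d)^[N] none) (T.image some)) : Finset (Option F)) : Set (Option F)) := by
    rintro p ⟨n, hn, hp⟩
    have h1 : (projMap f g d)^[n * N] p = p := by
      rw [Function.iterate_mul]
      exact Function.iterate_fixed hp N
    obtain ⟨m, rfl⟩ : ∃ m, n = m + 1 := ⟨n - 1, by omega⟩
    rw [show (m + 1) * N = N + m * N by ring, Function.iterate_add_apply] at h1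
    simp only [Finset.coe_insert, Set.mem_insert_iff, Finset.coe_image, Set.mem_image, Finset.mem_coe]
    rcases hy : (projMap f g d)^[m * N] p with _ | x
    · rw [hy] at h1
      exact Or.inr (Or.inl h1.symm)
    · rw [hy, iter_prj d f g hf hg hfg hgd, prj] at h1
      split_ifs at h1 with h0
      · exact Or.inl h1.symm
      · refine Or.inr (Or.inr ⟨_, ?_, h1⟩)
        refine Finset.mem_filter.mpr ⟨Finset.mem_univ _, x, ?_⟩
        field_simp
  refine (Set.ncard_le_ncard hsub (Set.toFinite _)).trans ?_
  rw [Set.ncard_coe_finset]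
  have h1 := Finset.card_insert_le (none : Option F) (insert ((projMap f g d)^[N] none) (T.image some))
  have h2 := Finset.card_insert_le ((projMap f g d)^[N] none) (T.image some)
  have h3 : (T.image some).card ≤ T.card := Finset.card_image_le
  omega

end

lemma good_per (p n d N M : ℕ) [Fact p.Prime] (hp2 : p ≠ 2) (F : Type) [Field F] [Fintype F]
    (hF : Fintype.card F = p ^ n) (hn : 4 * ((d ^ N).factorial) ^ 2 + 2 ≤ n) (f g : F[X])
    (hN : M * (d * M).factorial < N) (hM : 1 ≤ M)
    (H : Good d N (f.map (algebraMap F (AlgebraicClosure F))) (g.map (algebraMap F (AlgebraicClosure F)))) :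
    M * {p : Option F | ∃ n : ℕ, 1 ≤ n ∧ (projMap f g d)^[n] p = p}.ncard ≤ 8 * p ^ n + M * (2 * d ^ N + 3) := by
  have hf : f.natDegree ≤ d := by simpa using H.1.hf
  have hg : g.natDegree ≤ d := by simpa using H.1.hg
  have hgd : g.coeff d ≠ 0 := by
    have := H.1.hgd
    rw [coeff_map] at this
    exact fun h => this (by rw [h, map_zero])
  have hc : IsCoprime f g := (isCoprime_map _).mp H.1.cop
  have h := per_bound d N f g hf hg hc hgd ((8 * p ^ n + M * (2 * d ^ N + 1)) / M) (by
    intro T hT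
    rw [Nat.le_div_iff_mul_le (by omega), mul_comm]
    exact image_bound p n d N M hp2 F hF hn f g H.1 hN H.2 T hT)
  have h2 := Nat.mul_div_le (8 * p ^ n + M * (2 * d ^ N + 1)) M
  calc _ ≤ M * ((8 * p ^ n + M * (2 * d ^ N + 1)) / M + 2) := Nat.mul_le_mul_left _ h
    _ = M * ((8 * p ^ n + M * (2 * d ^ N + 1)) / M) + M * 2 := by ring
    _ ≤ (8 * p ^ n + M * (2 * d ^ N + 1)) + M * 2 := by gcongr
    _ = _ := by ring

lemma avg_bound {α : Type*} (s b : Set α) (hs : s.Finite) (hb : b ⊆ s) (w : α → ℝ) (a : ℝ) (ha : 0 ≤ a) (h1 : ∀ x ∈ s, w x ≤ 1)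
    (h2 : ∀ x ∈ s, x ∉ b → w x ≤ a) : ∑ᶠ x ∈ s, w x ≤ b.ncard + s.ncard * a := by
  classical
  rw [finsum_mem_eq_finite_toFinset_sum _ hs]
  have h3 : ∀ x ∈ hs.toFinset, w x ≤ (if x ∈ b then 1 else 0) + a := by
    intro x hx
    have hx' : x ∈ s := by simpa using hx
    split_ifs with h
    · linarith [h1 x hx']
    · linarith [h2 x hx' h]
  refine (Finset.sum_le_sum h3).trans ?_
  rw [Finset.sum_add_distrib, Finset.sum_const, nsmul_eq_mul, ← Set.ncard_eq_toFinset_card s hs, Finset.sum_boole]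
  gcongr
  rw [← Set.ncard_coe_finset]
  apply le_of_eq
  congr 1
  ext x
  simp only [Finset.coe_filter, Set.Finite.mem_toFinset, Set.mem_setOf_eq]
  exact ⟨fun h => h.2, fun h => ⟨hb h, h⟩⟩

theorem final_bound (p n d N M : ℕ) [Fact p.Prime] (hd : 2 ≤ d) (hpd : d < p) (F : Type) [Field F] [Fintype F]
    (hF : Fintype.card F = p ^ n) (hn : 4 * ((d ^ N).factorial) ^ 2 + 2 ≤ n) (hQ : 2 * d ≤ p ^ n)
    (hN : M * (d * M).factorial < N) (hM : 1 ≤ M) :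
    (∑ᶠ φ ∈ {φ : RatFunc F | ratDegree φ = d},
            (Set.ncard {p : Option F | ∃ n : ℕ, 1 ≤ n ∧
                (projMap φ.num φ.denom d)^[n] p = p} : ℝ)
              / ((p : ℝ) ^ n + 1))
          / (Set.ncard {φ : RatFunc F | ratDegree φ = d} : ℝ) ≤
      8 / M + (2 * (d + 1 + BC d N) + (2 * d ^ N + 3) : ℕ) / (p : ℝ) ^ n := by
  let k := AlgebraicClosure F
  have hchar : CharP F p := charP_of_card_eq_prime_pow hF
  have hchark : CharP k p := charP_of_injective_algebraMap (algebraMap F k).injective p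
  have hdk : ∀ i, 1 ≤ i → i ≤ d → (i : k) ≠ 0 := by
    intro i h1 h2 h3
    rw [CharP.cast_eq_zero_iff k p] at h3
    have := Nat.le_of_dvd (by omega) h3
    omega
  set b := {φ ∈ RR F d | ¬ Good d N (φ.num.map (algebraMap F k)) (φ.denom.map (algebraMap F k))} with hb
  have hbad := bad_total (F := F) k d N hd hdk
  rw [← hb] at hbad
  have hlow := total_lower F d hd (by rw [hF]; exact hQ)
  rw [hF] at hbad hlow
  have hQ0 : (0 : ℝ) < (p : ℝ) ^ n := by
    have : 0 < p ^ n := by omega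
    exact_mod_cast this
  have hM0 : (0 : ℝ) < M := by exact_mod_cast hM
  have hS := avg_bound (RR F d) b (RR_finite d) (fun x hx => hx.1)
    (fun φ => (Set.ncard {p : Option F | ∃ n : ℕ, 1 ≤ n ∧ (projMap φ.num φ.denom d)^[n] p = p} : ℝ) / ((p : ℝ) ^ n + 1))
    (8 / M + (2 * d ^ N + 3) / (p : ℝ) ^ n) (by positivity) (by
      intro φ hφ
      rw [div_le_one (by positivity)]
      have := Set.ncard_le_card {p : Option F | ∃ n : ℕ, 1 ≤ n ∧ (projMap φ.num φ.denom d)^[n] p = p}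
      rw [Nat.card_eq_fintype_card, Fintype.card_option, hF] at this
      exact_mod_cast this) (by
      intro φ hφ hφb
      have hg : Good d N (φ.num.map (algebraMap F k)) (φ.denom.map (algebraMap F k)) := by
        by_contra h; exact hφb ⟨hφ, h⟩
      have h := good_per p n d N M (by omega) F hF hn _ _ hN hM hg
      generalize {p : Option F | ∃ n : ℕ, 1 ≤ n ∧ (projMap φ.num φ.denom d)^[n] p = p}.ncard = P at h ⊢
      have h' : (M : ℝ) * P ≤ 8 * (p : ℝ) ^ n + M * (2 * d ^ N + 3) := by exact_mod_cast h
      calc (P : ℝ) / ((p : ℝ) ^ n + 1) ≤ P / (p : ℝ) ^ n := by gcongr; linarith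
        _ ≤ _ := by
          rw [div_le_iff₀ hQ0, add_mul, div_mul_cancel₀ _ hQ0.ne']
          have : (8 : ℝ) / M * (p : ℝ) ^ n = (8 * (p : ℝ) ^ n) / M := by ring
          rw [this, ← sub_le_iff_le_add, le_div_iff₀ hM0]
          linarith)
  have hR0 : (0 : ℝ) < (RR F d).ncard := by
    have : 0 < (p ^ n) ^ (2 * d + 1) := pow_pos (by omega) _
    have : 0 < (RR F d).ncard := by omega
    exact_mod_cast this
  show (∑ᶠ φ ∈ RR F d, (Set.ncard {p : Option F | ∃ n : ℕ, 1 ≤ n ∧ (projMap φ.num φ.denom d)^[n] p = p} : ℝ) / ((p : ℝ) ^ n + 1)) / ((RR F d).ncard : ℝ) ≤ _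
  rw [div_le_iff₀ hR0]
  refine hS.trans ?_
  have h1 : (b.ncard : ℝ) ≤ (2 * (d + 1 + BC d N) : ℕ) / (p : ℝ) ^ n * (RR F d).ncard := by
    rw [div_mul_eq_mul_div, le_div_iff₀ hQ0]
    have : b.ncard * p ^ n ≤ (2 * (d + 1 + BC d N)) * (RR F d).ncard := by
      refine hbad.trans ?_
      calc _ ≤ (d + 1 + BC d N) * (2 * (RR F d).ncard) := by gcongr
        _ = _ := by ring
    exact_mod_cast this
  have h2 : ((2 * (d + 1 + BC d N) + (2 * d ^ N + 3) : ℕ) : ℝ) / (p : ℝ) ^ n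
      = (2 * (d + 1 + BC d N) : ℕ) / (p : ℝ) ^ n + (2 * d ^ N + 3) / (p : ℝ) ^ n := by
    rw [← add_div]; push_cast; rfl
  rw [h2]
  linarith

end APP

/-- Let `q` be a prime power and `d ≥ 2` with `gcd(q, d!) = 1`.  For `j ≥ 1` let
`R(q,d,j)` be the average, over all rational functions `φ` of degree exactly `d` over
the field with `q ^ j` elements, of the proportion of `P^1(F_{q^j})` (of size
`q ^ j + 1`) consisting of points periodic under the self-map of `P^1(F_{q^j})`
induced by `φ`.  Then `R(q,d,j) → 0` as `j → ∞`. -/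
theorem average_periodic_proportion_rational_tendsto_zero
    (q d : ℕ) (hq : ∃ p k : ℕ, p.Prime ∧ 0 < k ∧ q = p ^ k) (hd : 2 ≤ d)
    (hgcd : Nat.gcd q (Nat.factorial d) = 1) :
    ∀ ε : ℝ, 0 < ε → ∃ J : ℕ, ∀ j : ℕ, J ≤ j → 1 ≤ j →
      ∀ (F : Type) [Field F] [Fintype F], Fintype.card F = q ^ j →
        (∑ᶠ φ ∈ {φ : RatFunc F | ratDegree φ = d},
            (Set.ncard {p : Option F | ∃ n : ℕ, 1 ≤ n ∧
                (projMap φ.num φ.denom d)^[n] p = p} : ℝ)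
              / ((q : ℝ) ^ j + 1))
          / (Set.ncard {φ : RatFunc F | ratDegree φ = d} : ℝ) < ε := by
  intro ε hε
  obtain ⟨p, e, hp, he, rfl⟩ := hq
  haveI : Fact p.Prime := ⟨hp⟩
  have hpd : d < p := by
    by_contra h
    have h1 : p ∣ d.factorial := (Nat.Prime.dvd_factorial hp).mpr (by omega)
    have h2 : p ∣ p ^ e := dvd_pow_self p (by omega)
    have := Nat.dvd_gcd h2 h1
    rw [hgcd] at this
    exact hp.one_lt.ne' (Nat.dvd_one.mp this)
  obtain ⟨M, hM⟩ := exists_nat_gt (16 / ε)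
  have hM0 : (0 : ℝ) < M := lt_trans (by positivity) hM
  have hM1 : 1 ≤ M := by exact_mod_cast hM0
  set N := M * (d * M).factorial + 1 with hN
  set K := 2 * (d + 1 + APP.BC d N) + (2 * d ^ N + 3) with hK
  obtain ⟨J, hJ⟩ := exists_nat_gt (2 * K / ε)
  refine ⟨J + 2 * d + (4 * ((d ^ N).factorial) ^ 2 + 2), ?_⟩
  intro j hj hj1 F _ _ hF
  rw [← pow_mul] at hF
  have hej : j ≤ e * j := Nat.le_mul_of_pos_left j he
  have hlt : e * j < p ^ (e * j) := Nat.lt_pow_self hp.one_lt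
  have h := APP.final_bound p (e * j) d N M hd hpd F hF (by omega) (by omega) (by omega) hM1
  rw [← hK] at h
  have hcast : ((p ^ e : ℕ) : ℝ) ^ j = (p : ℝ) ^ (e * j) := by push_cast; rw [pow_mul]
  rw [hcast]
  refine lt_of_le_of_lt h ?_
  have h8 : (8 : ℝ) / M < ε / 2 := by
    rw [div_lt_iff₀ hε] at hM
    rw [div_lt_iff₀ hM0]
    linarith
  have hQ : (J : ℝ) < (p : ℝ) ^ (e * j) := by
    have : J < p ^ (e * j) := by omega
    exact_mod_cast this
  have hK2 : (K : ℝ) / (p : ℝ) ^ (e * j) < ε / 2 := by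
    have h3 : 2 * K / ε < (p : ℝ) ^ (e * j) := hJ.trans hQ
    rw [div_lt_iff₀ hε] at h3
    rw [div_lt_iff₀ (lt_of_le_of_lt (Nat.cast_nonneg J) hQ)]
    linarith
  linarith
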